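/- Fix σ² > 1/2. There exist positive numerical constants C, c, c′ such that for every δ ∈ (0,1), every ε ∈ (0,1), and every x ∈ ℂ^n with ‖x‖ = 1, whenever m ≥ C ‖C_x‖² δ^{−2} n (log n)⁴, with probability at least 1 − c m^{−c′ (log n)³} over a ∼ CN(0, I_m) the following holds: for all w ∈ ℂ^n with ⟨x, w⟩ = 0, one has ‖ sqrt((2σ²+1)/m) · diag(ζ_{σ²}(y)^{1/2}) · Im((A w) ∘ exp(−iφ(A x))) ‖² ≤ ((1 + (2+ε)δ + (1+δ)·Δ_∞(ε))/2) · ‖w‖², where y := |A x| and the square root, Im, and ζ_{σ²} are applied entrywise. -/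

import Mathlib

open MeasureTheory ProbabilityTheory Matrix Complex
open scoped NNReal ENNReal

noncomputable section

namespace ConvPR

/-- The complex Gaussian distribution `CN(0, σ²)` on `ℂ`, as the pushforward of the
product of two real Gaussians `N(0, σ²/2)` under `(u, v) ↦ u + i v`. -/
def cgaussian (σ2 : ℝ) : Measure ℂ :=
  Measure.map (fun p : ℝ × ℝ => (p.1 : ℂ) + (p.2 : ℂ) * Complex.I)
    ((gaussianReal 0 (σ2 / 2).toNNReal).prod (gaussianReal 0 (σ2 / 2).toNNReal))

/-- The complex Gaussian `CN(0, σ² I_m)` on `Fin m → ℂ`. -/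
def cgaussianVec (m : ℕ) (σ2 : ℝ) : Measure (Fin m → ℂ) :=
  Measure.pi fun _ => cgaussian σ2

/-- The Euclidean norm on `Fin k → ℂ`. -/
def cnorm {k : ℕ} (v : Fin k → ℂ) : ℝ := Real.sqrt (∑ i, ‖v i‖ ^ 2)

/-- The Euclidean norm on `Fin k → ℝ`. -/
def rnorm {k : ℕ} (v : Fin k → ℝ) : ℝ := Real.sqrt (∑ i, v i ^ 2)

/-- The operator (spectral) norm of a complex matrix. -/
def opNorm {k l : ℕ} (M : Matrix (Fin k) (Fin l) ℂ) : ℝ :=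
  sSup {r : ℝ | ∃ v : Fin l → ℂ, cnorm v ≤ 1 ∧ r = cnorm (M.mulVec v)}

/-- Zero-padding `ℂ^n → ℂ^m`. -/
def pad {n : ℕ} (m : ℕ) (x : Fin n → ℂ) : Fin m → ℂ :=
  fun i => if hi : (i : ℕ) < n then x ⟨(i : ℕ), hi⟩ else 0

/-- The `m × n` matrix `A` formed by the first `n` columns of the circulant matrix `C_a`,
so that `A x = a ⊛ x`. -/
def Amat {n m : ℕ} (h : n ≤ m) (a : Fin m → ℂ) : Matrix (Fin m) (Fin n) ℂ :=
  Matrix.of fun i j => Matrix.circulant a i (Fin.castLE h j)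

/-- The circulant matrix `C_x` generated by the zero-padding of `x`. -/
def Cx {n : ℕ} (m : ℕ) (x : Fin n → ℂ) : Matrix (Fin m) (Fin m) ℂ :=
  Matrix.circulant (pad m x)

/-- `exp (i φ(u)) = u / |u|` for `u ≠ 0`, and `1` for `u = 0`. -/
def phase (u : ℂ) : ℂ := if u = 0 then 1 else u / (‖u‖ : ℂ)

/-- `ζ_{σ²}(t) = 1 − exp (−|t|² / (2σ²))`. -/
def zeta (σ2 : ℝ) (t : ℂ) : ℝ := 1 - Real.exp (-‖t‖ ^ 2 / (2 * σ2))

/-- `dist (z, X)` where `X = { x e^{iθ} : θ ∈ [0, 2π) }`. -/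
def distX {n : ℕ} (x z : Fin n → ℂ) : ℝ :=
  sInf {r : ℝ | ∃ θ ∈ Set.Ico (0 : ℝ) (2 * Real.pi),
    r = cnorm (z - Complex.exp ((θ : ℂ) * Complex.I) • x)}

/-- `y = |A x|`. -/
def yvec {n m : ℕ} (h : n ≤ m) (x : Fin n → ℂ) (a : Fin m → ℂ) : Fin m → ℝ :=
  fun k => ‖(Amat h a).mulVec x k‖

/-- The Hermitian inner product `x^* z`. -/
def dotc {n : ℕ} (x z : Fin n → ℂ) : ℂ := ∑ i, starRingEnd ℂ (x i) * z i

/-- `ψ(t) = exp (−2 i φ(t))`. -/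
def psi (t : ℂ) : ℂ := starRingEnd ℂ (phase t) ^ 2

/-- The Gaussian smoothing `h(t) = E_{s ∼ CN(0,1)} [ψ(t+s)]`. -/
def hfun (t : ℂ) : ℂ := ∫ s, psi (t + s) ∂(cgaussian 1)

/-- `Δ_∞(ε) = (1 + 2σ²) · sup_t |(1+ε) h(t) − ζ_{σ²}(t) ψ(t)|`. -/
def DeltaInf (σ2 ε : ℝ) : ℝ :=
  (1 + 2 * σ2) *
    sSup {r : ℝ | ∃ t : ℂ, r = ‖((1 + ε : ℝ) : ℂ) * hfun t - ((zeta σ2 t : ℝ) : ℂ) * psi t‖}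

/-- The generalized (Wirtinger) gradient of the weighted amplitude objective. -/
def grad {n m : ℕ} (h : n ≤ m) (σ2 : ℝ) (x : Fin n → ℂ) (a : Fin m → ℂ)
    (z : Fin n → ℂ) : Fin n → ℂ :=
  ((1 / (m : ℝ) : ℝ) : ℂ) •
    (Amat h a)ᴴ.mulVec fun k =>
      ((zeta σ2 ((yvec h x a k : ℝ) : ℂ) : ℝ) : ℂ) *
        ((Amat h a).mulVec z k - ((yvec h x a k : ℝ) : ℂ) * phase ((Amat h a).mulVec z k))

/-- The spectral-method matrix `Y = (1/m) A^* diag(y²) A`. -/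
def Ymat {n m : ℕ} (h : n ≤ m) (x : Fin n → ℂ) (a : Fin m → ℂ) :
    Matrix (Fin n) (Fin n) ℂ :=
  ((1 / (m : ℝ) : ℝ) : ℂ) •
    ((Amat h a)ᴴ * Matrix.diagonal (fun k => ((yvec h x a k ^ 2 : ℝ) : ℂ)) * Amat h a)

/-- The norm estimate `λ = sqrt((1/m) ∑ y_k²)`. -/
def lam {n m : ℕ} (h : n ≤ m) (x : Fin n → ℂ) (a : Fin m → ℂ) : ℝ :=
  Real.sqrt ((1 / (m : ℝ)) * ∑ k, yvec h x a k ^ 2)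

/-- `v` is a unit-norm eigenvector of `Y` associated with its largest eigenvalue. -/
def IsTopEigenvector {n : ℕ} (Y : Matrix (Fin n) (Fin n) ℂ) (v : Fin n → ℂ) : Prop :=
  cnorm v = 1 ∧ ∃ μ : ℝ, Y.mulVec v = (μ : ℂ) • v ∧
    ∀ μ' : ℝ, (∃ w : Fin n → ℂ, w ≠ 0 ∧ Y.mulVec w = (μ' : ℂ) • w) → μ' ≤ μ

/-- `M = ((2σ²+1)/m) A^* diag(ζ_{σ²}(y)) A`. -/
def Mmat {n m : ℕ} (h : n ≤ m) (σ2 : ℝ) (x : Fin n → ℂ) (a : Fin m → ℂ) :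
    Matrix (Fin n) (Fin n) ℂ :=
  (((2 * σ2 + 1) / (m : ℝ) : ℝ) : ℂ) •
    ((Amat h a)ᴴ *
      Matrix.diagonal (fun k => ((zeta σ2 ((yvec h x a k : ℝ) : ℂ) : ℝ) : ℂ)) * Amat h a)

/-- The vector `d(z)` from the contraction analysis. -/
def dvec {n m : ℕ} (h : n ≤ m) (σ2 : ℝ) (x : Fin n → ℂ) (a : Fin m → ℂ)
    (z : Fin n → ℂ) (θ : ℝ) : Fin n → ℂ :=
  (1 - Mmat h σ2 x a).mulVec (z - Complex.exp ((θ : ℂ) * Complex.I) • x)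
    - Complex.exp ((θ : ℂ) * Complex.I) • (Mmat h σ2 x a).mulVec x
    + (((2 * σ2 + 1) / (m : ℝ) : ℝ) : ℂ) •
        (Amat h a)ᴴ.mulVec fun k =>
          ((zeta σ2 ((yvec h x a k : ℝ) : ℂ) : ℝ) : ℂ) *
            (((yvec h x a k : ℝ) : ℂ) * phase ((Amat h a).mulVec z k))

/-- Projection onto the orthogonal complement of a unit vector `x`. -/
def projPerp {n : ℕ} (x v : Fin n → ℂ) : Fin n → ℂ := v - dotc x v • x

/-- Projection onto the span of a unit vector `x`. -/
def projPar {n : ℕ} (x v : Fin n → ℂ) : Fin n → ℂ := dotc x v • x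

/-- The matrix `P_{x⊥} = I − x x^*`. -/
def Pperp {n : ℕ} (x : Fin n → ℂ) : Matrix (Fin n) (Fin n) ℂ :=
  1 - Matrix.vecMulVec x (star x)

/-- `T = (1/m) R_{[1:n]} C_g^* diag(b) C_g R_{[1:n]}ᵀ`. -/
def Tmat {n m : ℕ} (h : n ≤ m) (b : Fin m → ℝ) (g : Fin m → ℂ) :
    Matrix (Fin n) (Fin n) ℂ :=
  ((1 / (m : ℝ) : ℝ) : ℂ) •
    (((Matrix.circulant g)ᴴ * Matrix.diagonal (fun k => ((b k : ℝ) : ℂ)) *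
        Matrix.circulant g).submatrix (Fin.castLE h) (Fin.castLE h))

/-- `L(g) = ‖T − (1/m)(∑ b_k) I‖`. -/
def Lfun {n m : ℕ} (h : n ≤ m) (b : Fin m → ℝ) (g : Fin m → ℂ) : ℝ :=
  opNorm (Tmat h b g -
    (((1 / (m : ℝ)) * ∑ k, b k : ℝ) : ℂ) • (1 : Matrix (Fin n) (Fin n) ℂ))

/-- `G = R_{[1:n]} C_g^*`. -/
def Gmat {n m : ℕ} (h : n ≤ m) (g : Fin m → ℂ) : Matrix (Fin n) (Fin m) ℂ :=
  ((Matrix.circulant g)ᴴ).submatrix (Fin.castLE h) id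

/-- `ξ_{σ²}(t) = (1/(2πσ²)) exp(−|t|²/(2σ²))`. -/
def xiF (σ2 : ℝ) (t : ℂ) : ℝ :=
  (1 / (2 * Real.pi * σ2)) * Real.exp (-‖t‖ ^ 2 / (2 * σ2))

/-- `ζ_{σ²}(t) = 1 − 2πσ² ξ_{σ²}(t)`. -/
def zetaF (σ2 : ℝ) (t : ℂ) : ℝ := 1 - 2 * Real.pi * σ2 * xiF σ2 t

/-- `η_{σ²}(t) = 1 − 2πσ² ξ_{σ²−1/2}(t)`. -/
def etaF (σ2 : ℝ) (t : ℂ) : ℝ := 1 - 2 * Real.pi * σ2 * xiF (σ2 - 1 / 2) t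

/-- `ν_{σ²}(t) = 1 − (4πσ⁴/(2σ²−1)) ξ_{σ²−1/2}(t)`. -/
def nuF (σ2 : ℝ) (t : ℂ) : ℝ :=
  1 - (4 * Real.pi * σ2 ^ 2 / (2 * σ2 - 1)) * xiF (σ2 - 1 / 2) t

/-- `g(t) = E_{v₁,v₂ ∼ N(0,1/2)} [((|t|+v₁)² − v₂²)/((|t|+v₁)² + v₂²)]`. -/
def gfun (t : ℂ) : ℝ :=
  ∫ p : ℝ × ℝ, ((‖t‖ + p.1) ^ 2 - p.2 ^ 2) / ((‖t‖ + p.1) ^ 2 + p.2 ^ 2)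
    ∂((gaussianReal 0 (1 / 2 : ℝ≥0)).prod (gaussianReal 0 (1 / 2 : ℝ≥0)))

section Concentration

lemma ofReal_exp_integral_le {α : Type*} [MeasurableSpace α] (ν : Measure α)
    [IsProbabilityMeasure ν] {g : α → ℝ} (hg : Integrable g ν) :
    ENNReal.ofReal (Real.exp (∫ x, g x ∂ν)) ≤ ∫⁻ x, ENNReal.ofReal (Real.exp (g x)) ∂ν := by
  by_cases h : Integrable (fun x => Real.exp (g x)) ν
  · rw [← ofReal_integral_eq_lintegral_ofReal h (ae_of_all _ fun x => (Real.exp_pos _).le)]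
    exact ENNReal.ofReal_le_ofReal
      (convexOn_exp.map_integral_le Real.continuous_exp.continuousOn isClosed_univ
        (by simp) hg h)
  · have : ∫⁻ x, ENNReal.ofReal (Real.exp (g x)) ∂ν = ⊤ := by
      by_contra hne
      refine h ⟨(Real.measurable_exp.comp_aemeasurable hg.aemeasurable).aestronglyMeasurable, ?_⟩
      rw [hasFiniteIntegral_iff_ofReal (ae_of_all _ fun x => (Real.exp_pos _).le)]
      exact lt_top_iff_ne_top.2 hne
    rw [this]; exact le_top

variable {E : Type*} [NormedAddCommGroup E] [NormedSpace ℝ E] [FiniteDimensional ℝ E]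
  [MeasurableSpace E] [BorelSpace E] {μ : Measure E} [IsGaussian μ]

omit [FiniteDimensional ℝ E] [MeasurableSpace E] [BorelSpace E] in
lemma norm_rotation_snd_le (θ : ℝ) (p : E × E) :
    ‖(ContinuousLinearMap.rotation θ p).2‖ ≤ ‖p.1‖ + ‖p.2‖ := by
  rw [ContinuousLinearMap.rotation_apply]
  refine (norm_add_le _ _).trans (add_le_add ?_ ?_) <;> rw [norm_smul] <;>
    refine mul_le_of_le_one_left (norm_nonneg _) ?_
  · simpa using Real.abs_sin_le_one θ
  · exact Real.abs_cos_le_one θ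

open ContinuousLinearMap in
omit [FiniteDimensional ℝ E] [MeasurableSpace E] [BorelSpace E] in
lemma sub_eq_integral_rotation {f : E → ℝ} {K : ℝ≥0} (hf : LipschitzWith K f) (p : E × E)
    (hp : ∀ᵐ θ : ℝ, DifferentiableAt ℝ f (rotation θ p).1) :
    f p.2 - f p.1 =
      ∫ θ in (0 : ℝ)..(Real.pi / 2), fderiv ℝ f (rotation θ p).1 (rotation θ p).2 := by
  have hpath : ∀ θ : ℝ, HasDerivAt (fun θ : ℝ => (rotation θ p).1) (rotation θ p).2 θ := by
    intro θ
    simp only [ContinuousLinearMap.rotation_apply]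
    exact ((Real.hasDerivAt_cos θ).smul_const p.1).add ((Real.hasDerivAt_sin θ).smul_const p.2)
  have hlip : LipschitzWith (Real.toNNReal (‖p.1‖ + ‖p.2‖)) fun θ : ℝ => (rotation θ p).1 := by
    refine lipschitzWith_of_nnnorm_deriv_le (fun θ => (hpath θ).differentiableAt) fun θ => ?_
    rw [(hpath θ).deriv, ← NNReal.coe_le_coe, coe_nnnorm,
      Real.coe_toNNReal _ (by positivity)]
    exact norm_rotation_snd_le θ p
  have hac := ((hf.comp hlip).lipschitzOnWith
    (s := Set.uIcc 0 (Real.pi / 2))).absolutelyContinuousOnInterval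
  have h1 := hac.integral_deriv_eq_sub
  have e0 : (f ∘ fun θ : ℝ => (rotation θ p).1) (Real.pi / 2) = f p.2 := by
    simp [ContinuousLinearMap.rotation_apply]
  have e1 : (f ∘ fun θ : ℝ => (rotation θ p).1) 0 = f p.1 := by
    simp [ContinuousLinearMap.rotation_apply]
  rw [e0, e1] at h1
  rw [← h1]
  refine intervalIntegral.integral_congr_ae ?_
  filter_upwards [hp] with θ hθ _
  exact (hθ.hasFDerivAt.comp_hasDerivAt θ (hpath θ)).deriv

omit [FiniteDimensional ℝ E] in
lemma lintegral_exp_dual [CompleteSpace E] [SecondCountableTopology E]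
    (hμ : μ[id] = 0) (L : StrongDual ℝ E) (t : ℝ) :
    ∫⁻ y, ENNReal.ofReal (Real.exp (t * L y)) ∂μ
      = ENNReal.ofReal (Real.exp (Var[L; μ] * t ^ 2 / 2)) := by
  have h0 : μ[L] = 0 := by
    rw [IsGaussian.integral_dual]
    have h1 : ∫ x, x ∂μ = 0 := by simpa using hμ
    simp [h1]
  have hm := IsGaussian.map_eq_gaussianReal (μ := μ) L
  rw [h0] at hm
  have h2 := mgf_gaussianReal hm t
  have hfint : Integrable (fun y => Real.exp (t * L y)) μ := by
    have : Integrable (fun y => Real.exp (t * y)) (μ.map L) := by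
      rw [hm]; exact integrable_exp_mul_gaussianReal t
    exact this.comp_measurable (by fun_prop)
  rw [← ofReal_integral_eq_lintegral_ofReal hfint (ae_of_all _ fun x => (Real.exp_pos _).le)]
  rw [mgf] at h2
  rw [h2, Real.coe_toNNReal _ (variance_nonneg _ _)]
  simp

lemma lintegral_exp_average_path_le {Ω : Type*} [MeasurableSpace Ω] {P : Measure Ω}
    [IsProbabilityMeasure P] {Φ : ℝ → Ω → Ω} (hΦ : Measurable fun q : Ω × ℝ => Φ q.2 q.1)
    (hmp : ∀ θ, MeasurePreserving (Φ θ) P P) {G D : Ω → ℝ} (hG : Measurable G)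
    (hD : ∀ᵐ p ∂P, IntervalIntegrable (fun θ => G (Φ θ p)) volume 0 (Real.pi / 2) ∧
      D p = ∫ θ in (0 : ℝ)..(Real.pi / 2), G (Φ θ p)) (t : ℝ) :
    ∫⁻ p, ENNReal.ofReal (Real.exp (t * D p)) ∂P
      ≤ ∫⁻ p, ENNReal.ofReal (Real.exp (t * (Real.pi / 2) * G p)) ∂P := by
  obtain ⟨ν, hν⟩ : ∃ ν : Measure ℝ,
      ν = (ENNReal.ofReal (2 / Real.pi)) • volume.restrict (Set.Ioc 0 (Real.pi / 2)) := ⟨_, rfl⟩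
  have hνp : IsProbabilityMeasure ν := by
    constructor
    rw [hν]
    simp only [Measure.smul_apply, Measure.restrict_apply MeasurableSet.univ, Set.univ_inter,
      Real.volume_Ioc, smul_eq_mul, sub_zero]
    rw [← ENNReal.ofReal_mul (by positivity), ENNReal.ofReal_eq_one]
    field_simp
  have key : ∀ᵐ p ∂P, ENNReal.ofReal (Real.exp (t * D p))
        ≤ ∫⁻ θ, ENNReal.ofReal (Real.exp (t * (Real.pi / 2) * G (Φ θ p))) ∂ν := by
    filter_upwards [hD] with p hp
    have hI : Integrable (fun θ : ℝ => G (Φ θ p)) ν := by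
      rw [hν]
      refine Integrable.smul_measure ?_ (by simp)
      exact (intervalIntegrable_iff_integrableOn_Ioc_of_le (by positivity)).1 hp.1
    refine le_trans (le_of_eq ?_) (ofReal_exp_integral_le ν (hI.const_mul (t * (Real.pi / 2))))
    congr 2
    rw [integral_const_mul, hν, integral_smul_measure, hp.2,
      intervalIntegral.integral_of_le (by positivity), ENNReal.toReal_ofReal (by positivity)]
    have := Real.pi_pos
    simp only [smul_eq_mul]
    field_simp
  have hm2 : Measurable fun p : Ω => ENNReal.ofReal (Real.exp (t * (Real.pi / 2) * G p)) :=
    (Real.measurable_exp.comp (hG.const_mul _)).ennreal_ofReal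
  calc _ ≤ ∫⁻ p, ∫⁻ θ, ENNReal.ofReal (Real.exp (t * (Real.pi / 2) * G (Φ θ p))) ∂ν
          ∂P := lintegral_mono_ae key
    _ = ∫⁻ θ, ∫⁻ p, ENNReal.ofReal (Real.exp (t * (Real.pi / 2) * G (Φ θ p))) ∂P ∂ν :=
        lintegral_lintegral_swap (hm2.comp hΦ).aemeasurable
    _ = ∫⁻ _, ∫⁻ p, ENNReal.ofReal (Real.exp (t * (Real.pi / 2) * G p)) ∂P ∂ν :=
        lintegral_congr fun θ => (hmp θ).lintegral_comp hm2
    _ = _ := by simp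

lemma integrable_of_lipschitz {f : E → ℝ} {K : ℝ≥0} (hf : LipschitzWith K f) :
    Integrable f μ := by
  have : CompleteSpace E := FiniteDimensional.complete ℝ E
  have : Integrable (fun x : E => ‖f 0‖ + K * ‖x‖) μ :=
    (integrable_const _).add (IsGaussian.integrable_id.norm.const_mul _)
  refine this.mono' hf.continuous.aestronglyMeasurable (ae_of_all _ fun x => ?_)
  have := hf.dist_le_mul x 0
  rw [dist_eq_norm, dist_zero_right] at this
  calc ‖f x‖ = ‖f 0 + (f x - f 0)‖ := by congr 1; ring
    _ ≤ _ := (norm_add_le _ _).trans (by linarith)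

omit [FiniteDimensional ℝ E] [BorelSpace E] [MeasurableSpace E] in
lemma continuous_rotation : Continuous fun q : (E × E) × ℝ =>
    ContinuousLinearMap.rotation q.2 q.1 := by
  simp only [ContinuousLinearMap.rotation_apply]
  fun_prop

lemma measurable_rotation : Measurable fun q : (E × E) × ℝ =>
    ContinuousLinearMap.rotation q.2 q.1 := by
  have : ProperSpace E := FiniteDimensional.proper ℝ E
  exact continuous_rotation.measurable

lemma measurable_fderiv_apply_prod (f : E → ℝ) :
    Measurable fun p : E × E => fderiv ℝ f p.1 p.2 := by
  have : CompleteSpace E := FiniteDimensional.complete ℝ E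
  have : ProperSpace E := FiniteDimensional.proper ℝ E
  have h1 : Measurable fun p : E × E => (fderiv ℝ f p.1, p.2) :=
    ((measurable_fderiv ℝ f).comp measurable_fst).prodMk measurable_snd
  exact (isBoundedBilinearMap_apply (𝕜 := ℝ) (E := E) (F := ℝ)).continuous.measurable.comp h1

lemma ae_ae_differentiableAt_rotation (hμ : μ[id] = 0) {f : E → ℝ}
    (hd : ∀ᵐ x ∂μ, DifferentiableAt ℝ f x) :
    ∀ᵐ p ∂(μ.prod μ), ∀ᵐ θ : ℝ,
      DifferentiableAt ℝ f (ContinuousLinearMap.rotation θ p).1 := by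
  have : CompleteSpace E := FiniteDimensional.complete ℝ E
  have : ProperSpace E := FiniteDimensional.proper ℝ E
  rw [Measure.ae_ae_comm]
  · refine ae_of_all _ fun θ => ?_
    have h1 : ∀ᵐ p ∂(μ.prod μ), DifferentiableAt ℝ f p.1 :=
      Measure.quasiMeasurePreserving_fst.ae hd
    have h2 : MeasurePreserving (ContinuousLinearMap.rotation θ : E × E →L[ℝ] E × E)
      (μ.prod μ) (μ.prod μ) :=
      ⟨(ContinuousLinearMap.rotation θ).continuous.measurable,
        IsGaussian.map_rotation_eq_self hμ θ⟩
    exact h2.quasiMeasurePreserving.ae h1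
  · exact (measurableSet_of_differentiableAt ℝ f).preimage
      (measurable_fst.comp measurable_rotation)

lemma lintegral_exp_fderiv_le (hμ : μ[id] = 0) {f : E → ℝ} {V : ℝ}
    (hV : ∀ x, Var[fderiv ℝ f x; μ] ≤ V) (t : ℝ) :
    ∫⁻ p, ENNReal.ofReal (Real.exp (t * (Real.pi / 2) * fderiv ℝ f p.1 p.2)) ∂(μ.prod μ)
      ≤ ENNReal.ofReal (Real.exp (2 * t ^ 2 * V)) := by
  have : CompleteSpace E := FiniteDimensional.complete ℝ E
  have : ProperSpace E := FiniteDimensional.proper ℝ E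
  have hV0 : 0 ≤ V := (variance_nonneg _ _).trans (hV 0)
  have hm2 : Measurable fun p : E × E =>
      ENNReal.ofReal (Real.exp (t * (Real.pi / 2) * fderiv ℝ f p.1 p.2)) :=
    (Real.measurable_exp.comp ((measurable_fderiv_apply_prod f).const_mul _)).ennreal_ofReal
  rw [lintegral_prod _ hm2.aemeasurable]
  calc _ ≤ ∫⁻ _, ENNReal.ofReal (Real.exp (2 * t ^ 2 * V)) ∂μ := by
          refine lintegral_mono fun x => ?_
          dsimp only
          rw [lintegral_exp_dual hμ]
          refine ENNReal.ofReal_le_ofReal (Real.exp_le_exp.2 ?_)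
          have h1 := hV x
          have h3 : Real.pi ^ 2 ≤ 16 := by nlinarith [Real.pi_pos, Real.pi_le_four]
          have h4 := mul_nonneg (sq_nonneg t) hV0
          have h5 : Var[fderiv ℝ f x; μ] * (t * (Real.pi / 2)) ^ 2 / 2
              ≤ V * (t * (Real.pi / 2)) ^ 2 / 2 := by gcongr
          nlinarith
      _ = _ := by simp

open ContinuousLinearMap in
/-- Gaussian concentration for Lipschitz functions (Maurey–Pisier). -/
lemma lintegral_exp_sub_mean_le (hμ : μ[id] = 0) {f : E → ℝ} {K : ℝ≥0} (hf : LipschitzWith K f)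
    (hd : ∀ᵐ x ∂μ, DifferentiableAt ℝ f x) {V : ℝ}
    (hV : ∀ x, Var[fderiv ℝ f x; μ] ≤ V) (t : ℝ) :
    ∫⁻ x, ENNReal.ofReal (Real.exp (t * (f x - ∫ y, f y ∂μ))) ∂μ
      ≤ ENNReal.ofReal (Real.exp (2 * t ^ 2 * V)) := by
  have : CompleteSpace E := FiniteDimensional.complete ℝ E
  have hV0 : 0 ≤ V := (variance_nonneg _ _).trans (hV 0)
  have hfint : Integrable f μ := integrable_of_lipschitz hf
  have hfin : ∫⁻ p, ENNReal.ofReal (Real.exp (t * (f p.2 - f p.1))) ∂(μ.prod μ)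
      ≤ ENNReal.ofReal (Real.exp (2 * t ^ 2 * V)) := by
    refine le_trans ?_ (lintegral_exp_fderiv_le hμ hV t)
    refine lintegral_exp_average_path_le (Φ := fun θ p => rotation θ p)
      (G := fun p => fderiv ℝ f p.1 p.2) (D := fun p => f p.2 - f p.1) measurable_rotation
      (fun θ => ⟨(rotation θ).continuous.measurable, IsGaussian.map_rotation_eq_self hμ θ⟩)
      (measurable_fderiv_apply_prod f) ?_ t
    filter_upwards [ae_ae_differentiableAt_rotation hμ hd] with p hp
    refine ⟨?_, sub_eq_integral_rotation hf p hp⟩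
    have hrp : Measurable fun θ : ℝ => rotation θ p :=
      (continuous_rotation.comp (Continuous.prodMk_right p)).measurable
    have hmeas := (measurable_fderiv_apply_prod f).comp hrp
    have hb : ∀ θ : ℝ, ‖fderiv ℝ f (rotation θ p).1 (rotation θ p).2‖
        ≤ K * (‖p.1‖ + ‖p.2‖) := fun θ => by
      have h1 := ContinuousLinearMap.le_opNorm (fderiv ℝ f (rotation θ p).1) (rotation θ p).2
      have h2 := norm_fderiv_le_of_lipschitz ℝ (x₀ := (rotation θ p).1) hf
      have h3 := norm_rotation_snd_le θ p
      exact h1.trans (mul_le_mul h2 h3 (norm_nonneg _) K.2)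
    refine (intervalIntegrable_iff_integrableOn_Ioc_of_le (by positivity)).2 ?_
    exact Integrable.of_bound hmeas.aestronglyMeasurable _ (ae_of_all _ hb)
  rw [lintegral_prod_symm' _ (by
    have := hf.continuous.measurable
    fun_prop)] at hfin
  refine le_trans (lintegral_mono fun y => ?_) hfin
  have h1 := ofReal_exp_integral_le μ (((integrable_const (f y)).sub hfint).const_mul t)
  refine le_trans (le_of_eq ?_) h1
  congr 2
  rw [integral_const_mul]
  congr 1
  simp only [Pi.sub_apply]
  rw [integral_sub (integrable_const _) hfint]
  simp

lemma measure_ge_mean_add_le (hμ : μ[id] = 0) {f : E → ℝ} {K : ℝ≥0} (hf : LipschitzWith K f)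
    (hd : ∀ᵐ x ∂μ, DifferentiableAt ℝ f x) {V : ℝ}
    (hV : ∀ x, Var[fderiv ℝ f x; μ] ≤ V) {t : ℝ} (ht : 0 ≤ t) (τ : ℝ) :
    μ {x | ∫ y, f y ∂μ + τ ≤ f x} ≤ ENNReal.ofReal (Real.exp (2 * t ^ 2 * V - t * τ)) := by
  have h := lintegral_exp_sub_mean_le hμ hf hd hV t
  have hm : AEMeasurable (fun x => ENNReal.ofReal (Real.exp (t * (f x - ∫ y, f y ∂μ)))) μ := by
    have := hf.continuous.measurable
    fun_prop
  have h2 := mul_meas_ge_le_lintegral₀ hm (ENNReal.ofReal (Real.exp (t * τ)))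
  have h3 : {x | ∫ y, f y ∂μ + τ ≤ f x} ⊆
      {x | ENNReal.ofReal (Real.exp (t * τ)) ≤
        ENNReal.ofReal (Real.exp (t * (f x - ∫ y, f y ∂μ)))} := by
    intro x hx
    refine ENNReal.ofReal_le_ofReal (Real.exp_le_exp.2 (mul_le_mul_of_nonneg_left ?_ ht))
    have : ∫ y, f y ∂μ + τ ≤ f x := hx
    linarith
  have h4 := (mul_le_mul_right (measure_mono (μ := μ) h3)
    (ENNReal.ofReal (Real.exp (t * τ)))).trans (h2.trans h)
  have e : ENNReal.ofReal (Real.exp (2 * t ^ 2 * V - t * τ))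
      = (ENNReal.ofReal (Real.exp (t * τ)))⁻¹ * ENNReal.ofReal (Real.exp (2 * t ^ 2 * V)) := by
    rw [← ENNReal.ofReal_inv_of_pos (Real.exp_pos _), ← ENNReal.ofReal_mul (by positivity),
      ← Real.exp_neg, ← Real.exp_add]
    congr 2; ring
  rw [e, ← ENNReal.mul_le_iff_le_inv (by simp [Real.exp_pos]) (by simp)]
  exact h4

lemma lintegral_pow_le_of_lipschitz (hμ : μ[id] = 0) {f : E → ℝ} {K : ℝ≥0}
    (hf : LipschitzWith K f) (hf0 : ∀ x, 0 ≤ f x)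
    (hd : ∀ᵐ x ∂μ, DifferentiableAt ℝ f x) {V : ℝ}
    (hV : ∀ x, Var[fderiv ℝ f x; μ] ≤ V) {B : ℝ} (hB : 0 < B) (p : ℕ)
    (hmean : ∫ x, f x ∂μ ≤ B) (hpV : p * V ≤ B ^ 2) :
    ∫⁻ x, ENNReal.ofReal (f x) ^ p ∂μ ≤ ENNReal.ofReal (Real.exp 3 * B) ^ p := by
  have h := lintegral_exp_sub_mean_le hμ hf hd hV (p / B)
  have h1 : ∀ x, ENNReal.ofReal (f x) ^ p ≤ ENNReal.ofReal (B ^ p * Real.exp p) *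
      ENNReal.ofReal (Real.exp (p / B * (f x - ∫ y, f y ∂μ))) := by
    intro x
    rw [← ENNReal.ofReal_pow (hf0 x), ← ENNReal.ofReal_mul (by positivity)]
    refine ENNReal.ofReal_le_ofReal ?_
    have h2 : f x / B ≤ Real.exp (f x / B) :=
      (by linarith : f x / B ≤ f x / B + 1).trans (Real.add_one_le_exp _)
    have h3 : (f x / B) ^ p ≤ Real.exp (f x / B) ^ p :=
      pow_le_pow_left₀ (div_nonneg (hf0 x) hB.le) h2 p
    have h4 : f x ^ p = B ^ p * (f x / B) ^ p := by
      rw [← mul_pow]; congr 1; field_simp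
    rw [h4, mul_assoc, ← Real.exp_add]
    refine mul_le_mul_of_nonneg_left (h3.trans ?_) (by positivity)
    rw [← Real.exp_nat_mul]
    refine Real.exp_le_exp.2 ?_
    have h5 : (p : ℝ) / B * (∫ y, f y ∂μ) ≤ p := by
      rw [div_mul_eq_mul_div, div_le_iff₀ hB]
      exact mul_le_mul_of_nonneg_left hmean (by positivity)
    have h6 : (p : ℝ) * (f x / B) = p / B * f x := by ring
    rw [h6, mul_sub]
    linarith
  refine (lintegral_mono h1).trans ?_
  have hfm := hf.continuous.measurable
  rw [lintegral_const_mul _ (by fun_prop)]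
  refine (mul_le_mul_right h _).trans ?_
  rw [← ENNReal.ofReal_mul (by positivity), ← ENNReal.ofReal_pow (by positivity)]
  refine ENNReal.ofReal_le_ofReal ?_
  rw [mul_assoc, ← Real.exp_add, mul_pow, mul_comm, ← Real.exp_nat_mul]
  refine mul_le_mul_of_nonneg_right (Real.exp_le_exp.2 ?_) (by positivity)
  have : 2 * ((p : ℝ) / B) ^ 2 * V ≤ 2 * p := by
    have e : 2 * ((p : ℝ) / B) ^ 2 * V = 2 * p * (p * V) / B ^ 2 := by field_simp
    rw [e, div_le_iff₀ (by positivity)]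
    exact mul_le_mul_of_nonneg_left hpV (by positivity)
  linarith

end Concentration

section ComplexGaussian

/-- The standard real structure map `(u, v) ↦ u + iv` as a continuous linear map. -/
def realProdToComplex : ℝ × ℝ →L[ℝ] ℂ := equivRealProdCLM.symm

lemma realProdToComplex_apply (p : ℝ × ℝ) : realProdToComplex p = (p.1 : ℂ) + p.2 * Complex.I := by
  simp [realProdToComplex, equivRealProdCLM_symm_apply]

lemma cgaussian_eq_map (s : ℝ) : cgaussian s = Measure.map realProdToComplex
    ((gaussianReal 0 (s / 2).toNNReal).prod (gaussianReal 0 (s / 2).toNNReal)) := by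
  rw [cgaussian]; congr 1; ext p; exact (realProdToComplex_apply p).symm

instance (s : ℝ) : IsGaussian (cgaussian s) := by
  rw [cgaussian_eq_map]; infer_instance

instance (m : ℕ) (s : ℝ) : IsProbabilityMeasure (cgaussianVec m s) := by
  rw [cgaussianVec]; infer_instance

lemma iIndepFun_eval_cgaussianVec (m : ℕ) (s : ℝ) :
    iIndepFun (fun (i : Fin m) (a : Fin m → ℂ) => a i) (cgaussianVec m s) :=
  iIndepFun_pi (X := fun _ => id) fun _ => aemeasurable_id

lemma measurePreserving_eval_cgaussianVec {m : ℕ} (s : ℝ) (i : Fin m) :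
    MeasurePreserving (fun a : Fin m → ℂ => a i) (cgaussianVec m s) (cgaussian s) :=
  measurePreserving_eval (fun _ : Fin m => cgaussian s) i

instance (m : ℕ) (s : ℝ) : IsGaussian (cgaussianVec m s) := by
  have h := iIndepFun.hasGaussianLaw (fun i : Fin m => (?_ : HasGaussianLaw
    (fun a : Fin m → ℂ => a i) (cgaussianVec m s))) (iIndepFun_eval_cgaussianVec m s)
  · have := h.isGaussian_map
    have e : (fun ω : Fin m → ℂ => fun x => ω x) = id := rfl
    rwa [e, Measure.map_id] at this
  · constructor
    rw [(measurePreserving_eval_cgaussianVec s i).map_eq]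
    infer_instance

lemma integral_cgaussian {F : Type*} [NormedAddCommGroup F] [NormedSpace ℝ F] (s : ℝ) (f : ℂ → F) :
    ∫ z, f z ∂(cgaussian s) = ∫ p : ℝ × ℝ, f ((p.1 : ℂ) + p.2 * Complex.I)
      ∂((gaussianReal 0 (s / 2).toNNReal).prod (gaussianReal 0 (s / 2).toNNReal)) := by
  rw [cgaussian_eq_map]
  have h : MeasurableEmbedding realProdToComplex :=
    equivRealProdCLM.symm.toHomeomorph.measurableEmbedding
  rw [h.integral_map]
  simp only [realProdToComplex_apply]

lemma integral_sq_gaussianReal (v : ℝ≥0) : ∫ u, u ^ 2 ∂(gaussianReal 0 v) = v := by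
  have h := variance_eq_integral (X := fun u : ℝ => u) (μ := gaussianReal 0 v) (by fun_prop)
  rw [variance_fun_id_gaussianReal] at h
  simpa using h.symm

lemma integrable_pow_gaussianReal (v : ℝ≥0) (k : ℕ) :
    Integrable (fun u : ℝ => u ^ k) (gaussianReal 0 v) := by
  have := (IsGaussian.memLp_id (gaussianReal 0 v) k (by simp)).integrable_norm_pow'
  refine this.mono (by fun_prop) (ae_of_all _ fun u => by simp)

lemma integrable_monomial_gaussianReal_prod (v : ℝ≥0) (j k : ℕ) :
    Integrable (fun p : ℝ × ℝ => ((p.1 : ℂ) ^ j * (p.2 : ℂ) ^ k))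
      ((gaussianReal 0 v).prod (gaussianReal 0 v)) := by
  have := ((integrable_pow_gaussianReal v j).mul_prod (integrable_pow_gaussianReal v k)).ofReal
    (𝕜 := ℂ)
  simpa using this

lemma integral_monomial_gaussianReal_prod (v : ℝ≥0) (j k : ℕ) :
    ∫ p : ℝ × ℝ, ((p.1 : ℂ) ^ j * (p.2 : ℂ) ^ k) ∂((gaussianReal 0 v).prod (gaussianReal 0 v))
      = ((∫ u, u ^ j ∂(gaussianReal 0 v) : ℝ) : ℂ) * ((∫ u, u ^ k ∂(gaussianReal 0 v) : ℝ) : ℂ) := by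
  have h := integral_prod_mul (μ := gaussianReal 0 v) (ν := gaussianReal 0 v)
    (fun u : ℝ => (u : ℂ) ^ j) (fun u : ℝ => (u : ℂ) ^ k)
  rw [h]
  congr 1 <;> rw [← integral_complex_ofReal] <;> simp

lemma integral_id_cgaussian (s : ℝ) : ∫ z, z ∂(cgaussian s) = 0 := by
  rw [integral_cgaussian]
  set v := (s / 2).toNNReal
  have h1 := integrable_monomial_gaussianReal_prod v 1 0
  have h2 := integrable_monomial_gaussianReal_prod v 0 1
  have e1 := integral_monomial_gaussianReal_prod v 1 0
  have e2 := integral_monomial_gaussianReal_prod v 0 1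
  simp only [pow_one, pow_zero, mul_one, one_mul, integral_id_gaussianReal] at h1 h2 e1 e2
  rw [integral_add h1 (h2.mul_const _), integral_mul_const, e1, e2]
  simp

lemma integral_sq_cgaussian (s : ℝ) : ∫ z, z * z ∂(cgaussian s) = 0 := by
  rw [integral_cgaussian]
  set v := (s / 2).toNNReal
  have h1 := integrable_monomial_gaussianReal_prod v 2 0
  have h2 := integrable_monomial_gaussianReal_prod v 0 2
  have h3 := integrable_monomial_gaussianReal_prod v 1 1
  have e1 := integral_monomial_gaussianReal_prod v 2 0
  have e2 := integral_monomial_gaussianReal_prod v 0 2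
  have e3 := integral_monomial_gaussianReal_prod v 1 1
  simp only [pow_one, pow_zero, mul_one, one_mul, integral_id_gaussianReal,
    integral_sq_gaussianReal] at h1 h2 h3 e1 e2 e3
  have e : ∀ p : ℝ × ℝ, ((p.1 : ℂ) + p.2 * Complex.I) * ((p.1 : ℂ) + p.2 * Complex.I)
      = ((p.1 : ℂ) ^ 2 - (p.2 : ℂ) ^ 2) + 2 * Complex.I * ((p.1 : ℂ) * p.2) := by
    intro p; linear_combination (p.2 : ℂ) ^ 2 * Complex.I_sq
  simp_rw [e]
  rw [integral_add (f := fun p : ℝ × ℝ => (p.1 : ℂ) ^ 2 - (p.2 : ℂ) ^ 2)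
    (h1.sub h2) (h3.const_mul _), integral_const_mul, integral_sub h1 h2, e1, e2, e3]
  simp

lemma integral_mul_conj_cgaussian : ∫ z, z * starRingEnd ℂ z ∂(cgaussian 1) = 1 := by
  rw [integral_cgaussian]
  have hv : (((1 / 2 : ℝ).toNNReal : ℝ≥0) : ℝ) = 1 / 2 := Real.coe_toNNReal _ (by norm_num)
  set v := (1 / 2 : ℝ).toNNReal
  have h1 := integrable_monomial_gaussianReal_prod v 2 0
  have h2 := integrable_monomial_gaussianReal_prod v 0 2
  have e1 := integral_monomial_gaussianReal_prod v 2 0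
  have e2 := integral_monomial_gaussianReal_prod v 0 2
  simp only [pow_zero, mul_one, one_mul, integral_sq_gaussianReal] at h1 h2 e1 e2
  have e : ∀ p : ℝ × ℝ, ((p.1 : ℂ) + p.2 * Complex.I) *
      starRingEnd ℂ ((p.1 : ℂ) + p.2 * Complex.I) = (p.1 : ℂ) ^ 2 + (p.2 : ℂ) ^ 2 := by
    intro p
    simp only [map_add, conj_ofReal, map_mul, conj_I]
    linear_combination -(p.2 : ℂ) ^ 2 * Complex.I_sq
  simp_rw [e]
  rw [integral_add h1 h2, e1, e2, hv]
  norm_num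

/-! ### Moments of the standard complex Gaussian vector -/

variable {m : ℕ}

lemma integral_comp_eval_cgaussianVec {F : Type*} [NormedAddCommGroup F] [NormedSpace ℝ F] (s : ℝ)
    (i : Fin m) {f : ℂ → F} (hf : Continuous f) :
    ∫ a, f (a i) ∂(cgaussianVec m s) = ∫ z, f z ∂(cgaussian s) := by
  have h := measurePreserving_eval_cgaussianVec s i
  rw [← h.map_eq, integral_map h.measurable.aemeasurable]
  exact hf.stronglyMeasurable.aestronglyMeasurable

lemma integral_eval_cgaussianVec (s : ℝ) (i : Fin m) : ∫ a, a i ∂(cgaussianVec m s) = 0 := by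
  rw [← integral_id_cgaussian s]
  exact integral_comp_eval_cgaussianVec s i continuous_id

lemma memLp_cgaussianVec (s : ℝ) (p : ℝ≥0∞) (hp : p ≠ ⊤) (i : Fin m) :
    MemLp (fun a : Fin m → ℂ => a i) p (cgaussianVec m s) := by
  have := IsGaussian.memLp_id (cgaussianVec m s) p hp
  exact this.eval i

lemma integral_id_cgaussianVec (s : ℝ) : (cgaussianVec m s)[id] = 0 := by
  ext i
  have h := (ContinuousLinearMap.proj (R := ℝ) (φ := fun _ : Fin m => ℂ) i).integral_comp_comm
    (IsGaussian.integrable_id (μ := cgaussianVec m s))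
  simp only [ContinuousLinearMap.proj_apply, id] at h
  rw [integral_eval_cgaussianVec] at h
  simpa using h.symm

lemma integral_eval_mul_eval (i j : Fin m) : ∫ a, a i * a j ∂(cgaussianVec m 1) = 0 := by
  by_cases hij : i = j
  · subst hij
    rw [← integral_sq_cgaussian 1]
    exact integral_comp_eval_cgaussianVec (f := fun z => z * z) 1 i (by fun_prop)
  · have h := ((iIndepFun_eval_cgaussianVec m 1).indepFun hij).integral_fun_mul_eq_mul_integral
      (measurable_pi_apply i).aestronglyMeasurable (measurable_pi_apply j).aestronglyMeasurable
    rw [h, integral_eval_cgaussianVec]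
    simp

lemma integral_eval_mul_conj_eval (i j : Fin m) :
    ∫ a, a i * starRingEnd ℂ (a j) ∂(cgaussianVec m 1) = if i = j then 1 else 0 := by
  by_cases hij : i = j
  · subst hij
    rw [if_pos rfl, ← integral_mul_conj_cgaussian]
    exact integral_comp_eval_cgaussianVec (f := fun z => z * starRingEnd ℂ z) 1 i
      (continuous_id.mul Complex.continuous_conj)
  · have h := (((iIndepFun_eval_cgaussianVec m 1).indepFun hij).comp (φ := id)
      (ψ := starRingEnd ℂ) measurable_id Complex.continuous_conj.measurable).integral_fun_mul_eq_mul_integral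
      (measurable_pi_apply i).aestronglyMeasurable
      (Complex.continuous_conj.measurable.comp (measurable_pi_apply j)).aestronglyMeasurable
    rw [if_neg hij]
    refine h.trans ?_
    have := integral_eval_cgaussianVec 1 i
    simp only [Function.comp_def, id]
    rw [this]
    simp

lemma memLp_dotProduct (c : Fin m → ℂ) (p : ℝ≥0∞) (hp : p ≠ ⊤) :
    MemLp (fun a => c ⬝ᵥ a) p (cgaussianVec m 1) := by
  simp only [dotProduct]
  exact memLp_finsetSum _ fun i _ => (memLp_cgaussianVec 1 p hp i).const_mul _

lemma integral_dotProduct (c : Fin m → ℂ) : ∫ a, c ⬝ᵥ a ∂(cgaussianVec m 1) = 0 := by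
  simp only [dotProduct]
  rw [integral_finsetSum _ fun i _ =>
    ((memLp_cgaussianVec 1 1 (by simp) i).integrable le_rfl).const_mul _]
  simp [integral_const_mul, integral_eval_cgaussianVec]

lemma integrable_dotProduct_mul (c d : Fin m → ℂ) :
    Integrable (fun a => (c ⬝ᵥ a) * (d ⬝ᵥ a)) (cgaussianVec m 1) :=
  (memLp_dotProduct c 2 (by simp)).integrable_mul (memLp_dotProduct d 2 (by simp))

lemma integrable_dotProduct_mul_conj (c d : Fin m → ℂ) :
    Integrable (fun a => (c ⬝ᵥ a) * starRingEnd ℂ (d ⬝ᵥ a)) (cgaussianVec m 1) :=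
  (memLp_dotProduct c 2 (by simp)).integrable_mul (memLp_dotProduct d 2 (by simp)).star

lemma integral_dotProduct_mul (c d : Fin m → ℂ) :
    ∫ a, (c ⬝ᵥ a) * (d ⬝ᵥ a) ∂(cgaussianVec m 1) = 0 := by
  have hI : ∀ i j : Fin m, Integrable (fun a => c i * a i * (d j * a j)) (cgaussianVec m 1) :=
    fun i j => ((memLp_cgaussianVec 1 2 (by simp) i).const_mul _).integrable_mul
      ((memLp_cgaussianVec 1 2 (by simp) j).const_mul _)
  simp only [dotProduct, Finset.sum_mul_sum]
  rw [integral_finsetSum _ fun i _ => integrable_finsetSum _ fun j _ => hI i j]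
  refine Finset.sum_eq_zero fun i _ => ?_
  rw [integral_finsetSum _ fun j _ => hI i j]
  refine Finset.sum_eq_zero fun j _ => ?_
  have e : ∀ a : Fin m → ℂ, c i * a i * (d j * a j) = c i * d j * (a i * a j) := fun a => by ring
  simp_rw [e]
  rw [integral_const_mul, integral_eval_mul_eval, mul_zero]

lemma integral_dotProduct_mul_conj (c d : Fin m → ℂ) :
    ∫ a, (c ⬝ᵥ a) * starRingEnd ℂ (d ⬝ᵥ a) ∂(cgaussianVec m 1)
      = ∑ i, c i * starRingEnd ℂ (d i) := by
  have hI : ∀ i j : Fin m, Integrable (fun a => c i * a i * starRingEnd ℂ (d j * a j))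
      (cgaussianVec m 1) :=
    fun i j => ((memLp_cgaussianVec 1 2 (by simp) i).const_mul _).integrable_mul
      ((memLp_cgaussianVec 1 2 (by simp) j).const_mul _).star
  simp only [dotProduct, map_sum, Finset.sum_mul_sum]
  rw [integral_finsetSum _ fun i _ => integrable_finsetSum _ fun j _ => hI i j]
  refine Finset.sum_congr rfl fun i _ => ?_
  rw [integral_finsetSum _ fun j _ => hI i j]
  have e : ∀ (j : Fin m) (a : Fin m → ℂ), c i * a i * starRingEnd ℂ (d j * a j)
      = c i * starRingEnd ℂ (d j) * (a i * starRingEnd ℂ (a j)) := fun j a => by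
    rw [map_mul]; ring
  simp_rw [e]
  simp_rw [integral_const_mul, integral_eval_mul_conj_eval]
  simp

/-! ### Variances of dual vectors, law and independence of linear forms -/

lemma integral_re_dotProduct_sq (c : Fin m → ℂ) :
    ∫ a, (c ⬝ᵥ a).re ^ 2 ∂(cgaussianVec m 1) = (∑ i, ‖c i‖ ^ 2) / 2 := by
  have e : ∀ a : Fin m → ℂ, (c ⬝ᵥ a).re ^ 2 =
      (((c ⬝ᵥ a) * starRingEnd ℂ (c ⬝ᵥ a)).re + ((c ⬝ᵥ a) * (c ⬝ᵥ a)).re) / 2 := by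
    intro a
    simp only [mul_re, conj_re, conj_im]; ring
  simp_rw [e]
  have i1 := integrable_dotProduct_mul_conj c c
  have i2 := integrable_dotProduct_mul c c
  rw [integral_div, integral_add (by simpa using i1.re) (by simpa using i2.re)]
  have h1 := integral_re i1
  have h2 := integral_re i2
  simp only [RCLike.re_eq_complex_re] at h1 h2
  rw [h1, h2, integral_dotProduct_mul, integral_dotProduct_mul_conj]
  simp [Complex.mul_conj, Complex.normSq_eq_norm_sq]
  exact Finset.sum_congr rfl fun i _ => by rw [← ofReal_pow, ofReal_re]

lemma exists_dual_eq_re_dotProduct (L : StrongDual ℝ (Fin m → ℂ)) :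
    ∃ c : Fin m → ℂ, ∀ y, L y = (c ⬝ᵥ y).re := by
  refine ⟨fun i => (L (Pi.single i 1) : ℂ) - L (Pi.single i Complex.I) * Complex.I, fun y => ?_⟩
  have hy : y = ∑ i, ((y i).re • (Pi.single i 1 : Fin m → ℂ) +
      (y i).im • (Pi.single i Complex.I : Fin m → ℂ)) := by
    ext j
    simp only [Finset.sum_apply, Pi.add_apply, Pi.smul_apply, Finset.sum_add_distrib]
    simp only [Pi.single_apply, smul_ite, smul_zero, Finset.sum_ite_eq, Finset.mem_univ, if_true]
    simp
  conv_lhs => rw [hy]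
  simp only [map_sum, map_add, map_smul, smul_eq_mul, dotProduct, re_sum]
  refine Finset.sum_congr rfl fun i _ => ?_
  simp
  ring

lemma variance_re_dotProduct (c : Fin m → ℂ) :
    Var[fun a => (c ⬝ᵥ a).re; cgaussianVec m 1] = (∑ i, ‖c i‖ ^ 2) / 2 := by
  have hi := (memLp_dotProduct c 1 (by simp)).integrable le_rfl
  have h0 : ∫ a, (c ⬝ᵥ a).re ∂(cgaussianVec m 1) = 0 := by
    have := integral_re hi
    simp only [RCLike.re_eq_complex_re] at this
    rw [this, integral_dotProduct]; simp
  rw [variance_eq_integral (by simpa using hi.re.aemeasurable), h0]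
  simpa using integral_re_dotProduct_sq c

lemma variance_dual_le_of_le_cnorm (L : StrongDual ℝ (Fin m → ℂ)) {K : ℝ}
    (hL : ∀ y, L y ≤ K * cnorm y) : Var[L; cgaussianVec m 1] ≤ K ^ 2 := by
  obtain ⟨c, hc⟩ := exists_dual_eq_re_dotProduct L
  have e : (L : (Fin m → ℂ) → ℝ) = fun a => (c ⬝ᵥ a).re := funext hc
  rw [e, variance_re_dotProduct]
  have h := hL (star c)
  have h1 : (c ⬝ᵥ star c).re = ∑ i, ‖c i‖ ^ 2 := by
    simp [dotProduct, Complex.normSq_eq_norm_sq, Complex.mul_conj]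
    exact Finset.sum_congr rfl fun i _ => by rw [← ofReal_pow, ofReal_re]
  have hn : cnorm (star c) = √(∑ i, ‖c i‖ ^ 2) := by simp [cnorm]
  rw [hc, h1, hn] at h
  set S := ∑ i, ‖c i‖ ^ 2
  have hS : 0 ≤ S := Finset.sum_nonneg fun i _ => by positivity
  have h2 := Real.sq_sqrt hS
  have h3 := Real.sqrt_nonneg S
  rcases h3.eq_or_lt with h4 | h4
  · rw [← h4] at h2; nlinarith [sq_nonneg K]
  · have : √S ≤ K := by nlinarith
    nlinarith

lemma exists_dual_complex (L : StrongDual ℝ ℂ) : ∃ κ : ℂ, ∀ z, L z = (κ * z).re := by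
  refine ⟨(L 1 : ℂ) - L Complex.I * Complex.I, fun z => ?_⟩
  have hz : z = z.re • (1 : ℂ) + z.im • Complex.I := by simp
  conv_lhs => rw [hz, map_add, map_smul, map_smul]
  simp
  ring

/-- The linear form `a ↦ ∑ cᵢ aᵢ` as a real continuous linear map. -/
def dotCLM (c : Fin m → ℂ) : (Fin m → ℂ) →L[ℝ] ℂ :=
  ∑ i, (ContinuousLinearMap.mul ℝ ℂ (c i)).comp (ContinuousLinearMap.proj i)

lemma dotCLM_apply (c a : Fin m → ℂ) : dotCLM c a = c ⬝ᵥ a := by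
  simp [dotCLM, dotProduct]

lemma integral_re_dotProduct (c : Fin m → ℂ) :
    ∫ a, (c ⬝ᵥ a).re ∂(cgaussianVec m 1) = 0 := by
  have hi := (memLp_dotProduct c 1 (by simp)).integrable le_rfl
  have := integral_re hi
  simp only [RCLike.re_eq_complex_re] at this
  rw [this, integral_dotProduct]; simp

lemma map_dotCLM_eq {k : ℕ} {c : Fin m → ℂ} {d : Fin k → ℂ}
    (h : ∑ i, ‖c i‖ ^ 2 = ∑ i, ‖d i‖ ^ 2) :
    (cgaussianVec m 1).map (dotCLM c) = (cgaussianVec k 1).map (dotCLM d) := by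
  have key : ∀ {l : ℕ} (c : Fin l → ℂ) (L : StrongDual ℝ ℂ) (κ : ℂ),
      (∀ z, L z = (κ * z).re) → charFunDual ((cgaussianVec l 1).map (dotCLM c)) L =
        Complex.exp (-((‖κ‖ ^ 2 * (∑ i, ‖c i‖ ^ 2) / 2 : ℝ) : ℂ) / 2) := by
    intro l c L κ hL
    have e : ∀ a : Fin l → ℂ, L (dotCLM c a) = ((κ • c) ⬝ᵥ a).re := fun a => by
      rw [dotCLM_apply, hL, smul_dotProduct, smul_eq_mul]
    rw [IsGaussian.charFunDual_eq, variance_map (by fun_prop) (by fun_prop),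
      integral_map (by fun_prop) (by fun_prop)]
    have e2 : (L ∘ dotCLM c) = fun a => ((κ • c) ⬝ᵥ a).re := funext e
    simp_rw [e]
    rw [e2, variance_re_dotProduct, integral_complex_ofReal, integral_re_dotProduct]
    congr 1
    simp only [Pi.smul_apply, smul_eq_mul, norm_mul, mul_pow, ← Finset.mul_sum]
    push_cast
    ring
  refine Measure.ext_of_charFunDual (funext fun L => ?_)
  obtain ⟨κ, hκ⟩ := exists_dual_complex L
  rw [key c L κ hκ, key d L κ hκ, h]

/-- A unit-norm linear form of a standard complex Gaussian vector is standard complex Gaussian. -/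
lemma map_dotProduct_cgaussianVec {c : Fin m → ℂ} (hc : ∑ i, ‖c i‖ ^ 2 = 1) :
    (cgaussianVec m 1).map (fun a => c ⬝ᵥ a) = cgaussian 1 := by
  have h := map_dotCLM_eq (c := c) (d := fun _ : Fin 1 => (1 : ℂ)) (by simpa using hc)
  have e1 : (dotCLM c : (Fin m → ℂ) → ℂ) = fun a => c ⬝ᵥ a := funext (dotCLM_apply c)
  have e2 : (dotCLM (fun _ : Fin 1 => (1 : ℂ)) : (Fin 1 → ℂ) → ℂ) = fun a => a 0 :=
    funext fun a => by rw [dotCLM_apply]; simp [dotProduct]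
  rw [← e1, h, e2, (measurePreserving_eval_cgaussianVec 1 0).map_eq]

lemma indepFun_dotProduct {c d : Fin m → ℂ} (h : ∑ i, c i * starRingEnd ℂ (d i) = 0) :
    IndepFun (fun a => c ⬝ᵥ a) (fun a => d ⬝ᵥ a) (cgaussianVec m 1) := by
  have hg : HasGaussianLaw (fun a => (c ⬝ᵥ a, d ⬝ᵥ a)) (cgaussianVec m 1) := by
    have := (IsGaussian.hasGaussianLaw_id (μ := cgaussianVec m 1)).map
      ((dotCLM c).prod (dotCLM d))
    have e : (⇑((dotCLM c).prod (dotCLM d)) ∘ id) = fun a => (c ⬝ᵥ a, d ⬝ᵥ a) := by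
      ext a <;> simp [dotCLM_apply]
    rwa [e] at this
  refine hg.indepFun_of_covariance_strongDual fun L₁ L₂ => ?_
  obtain ⟨κ, hκ⟩ := exists_dual_complex L₁
  obtain ⟨κ', hκ'⟩ := exists_dual_complex L₂
  have e1 : (L₁ ∘ fun a => c ⬝ᵥ a) = fun a => ((κ • c) ⬝ᵥ a).re := by
    ext a; simp only [Function.comp, hκ, smul_dotProduct, smul_eq_mul]
  have e2 : (L₂ ∘ fun a => d ⬝ᵥ a) = fun a => ((κ' • d) ⬝ᵥ a).re := by
    ext a; simp only [Function.comp, hκ', smul_dotProduct, smul_eq_mul]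
  have l1 := (memLp_dotProduct (κ • c) 2 (by simp)).re
  have l2 := (memLp_dotProduct (κ' • d) 2 (by simp)).re
  simp only [RCLike.re_eq_complex_re] at l1 l2
  rw [e1, e2, covariance_eq_sub l1 l2, integral_re_dotProduct, zero_mul, sub_zero]
  have e : ∀ a : Fin m → ℂ, ((κ • c) ⬝ᵥ a).re * ((κ' • d) ⬝ᵥ a).re =
      ((((κ • c) ⬝ᵥ a) * starRingEnd ℂ ((κ' • d) ⬝ᵥ a)).re +
        (((κ • c) ⬝ᵥ a) * ((κ' • d) ⬝ᵥ a)).re) / 2 := by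
    intro a
    simp only [mul_re, conj_re, conj_im]; ring
  simp only [Pi.mul_apply]
  simp_rw [e]
  have i1 := integrable_dotProduct_mul_conj (κ • c) (κ' • d)
  have i2 := integrable_dotProduct_mul (κ • c) (κ' • d)
  rw [integral_div, integral_add (by simpa using i1.re) (by simpa using i2.re)]
  have h1 := integral_re i1
  have h2 := integral_re i2
  simp only [RCLike.re_eq_complex_re] at h1 h2
  have h3 : ∑ i, (κ • c) i * starRingEnd ℂ ((κ' • d) i) = 0 := by
    have : ∀ i, (κ • c) i * starRingEnd ℂ ((κ' • d) i)
        = κ * starRingEnd ℂ κ' * (c i * starRingEnd ℂ (d i)) := fun i => by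
      simp only [Pi.smul_apply, smul_eq_mul, map_mul]; ring
    simp_rw [this]
    rw [← Finset.mul_sum, h, mul_zero]
  rw [h1, h2, integral_dotProduct_mul, integral_dotProduct_mul_conj, h3]
  simp

lemma cgaussian_absolutelyContinuous : cgaussian 1 ≪ (volume : Measure ℂ) := by
  have hv : (1 / 2 : ℝ).toNNReal ≠ 0 := by
    rw [Ne, Real.toNNReal_eq_zero]; norm_num
  have h1 := (gaussianReal_absolutelyContinuous 0 hv).prod (gaussianReal_absolutelyContinuous 0 hv)
  have h2 : MeasurePreserving realProdToComplex (volume.prod volume) (volume : Measure ℂ) :=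
    Complex.volume_preserving_equiv_real_prod.symm
  rw [cgaussian_eq_map, ← h2.map_eq]
  exact h1.map h2.measurable

lemma cgaussianVec_absolutelyContinuous (m : ℕ) :
    cgaussianVec m 1 ≪ (volume : Measure (Fin m → ℂ)) := by
  rw [cgaussianVec, volume_pi]
  induction m with
  | zero => 
    rw [Measure.pi_of_empty, Measure.pi_of_empty]
  | succ n ih =>
    have h1 := measurePreserving_piFinSuccAbove (fun _ : Fin (n + 1) => cgaussian 1) 0
    have h2 := measurePreserving_piFinSuccAbove (fun _ : Fin (n + 1) => (volume : Measure ℂ)) 0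
    have h3 := (cgaussian_absolutelyContinuous.prod ih).map
      (MeasurableEquiv.piFinSuccAbove (fun _ : Fin (n + 1) => ℂ) 0).symm.measurable
    rw [h1.symm.map_eq, h2.symm.map_eq] at h3
    exact h3

lemma ae_differentiableAt_cgaussianVec {f : (Fin m → ℂ) → ℝ} {K : ℝ≥0} (hf : LipschitzWith K f) :
    ∀ᵐ a ∂(cgaussianVec m 1), DifferentiableAt ℝ f a :=
  (cgaussianVec_absolutelyContinuous m).ae_le hf.ae_differentiableAt

lemma integral_exp_neg_sq_gaussianReal {b : ℝ} (hb : 0 ≤ b) :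
    ∫ u, Real.exp (-b * u ^ 2) ∂(gaussianReal 0 (1 / 2 : ℝ).toNNReal) = (√(1 + b))⁻¹ := by
  have hv : (1 / 2 : ℝ).toNNReal ≠ 0 := by
    rw [Ne, Real.toNNReal_eq_zero]; norm_num
  rw [integral_gaussianReal_eq_integral_smul hv]
  have e : ∀ u : ℝ, gaussianPDFReal 0 (1 / 2 : ℝ).toNNReal u • Real.exp (-b * u ^ 2)
      = (√Real.pi)⁻¹ * Real.exp (-(1 + b) * u ^ 2) := by
    intro u
    rw [gaussianPDFReal, Real.coe_toNNReal _ (by norm_num), smul_eq_mul, mul_assoc, ← Real.exp_add,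
      show 2 * Real.pi * (1 / 2) = Real.pi by ring]
    congr 2
    ring
  simp_rw [e]
  rw [integral_const_mul, integral_gaussian, Real.sqrt_div Real.pi_pos.le]
  have := Real.sqrt_pos.2 Real.pi_pos
  field_simp

lemma integral_zeta_cgaussian {s : ℝ} (hs : 0 < s) :
    ∫ z, zeta s z ∂(cgaussian 1) = 1 / (2 * s + 1) := by
  have hb : 0 ≤ 1 / (2 * s) := by positivity
  have e : ∀ p : ℝ × ℝ, zeta s ((p.1 : ℂ) + p.2 * Complex.I) =
      1 - Real.exp (-(1 / (2 * s)) * p.1 ^ 2) * Real.exp (-(1 / (2 * s)) * p.2 ^ 2) := by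
    intro p
    rw [zeta, ← Complex.normSq_eq_norm_sq, Complex.normSq_add_mul_I, ← Real.exp_add]
    congr 2; ring
  have hi : Integrable (fun u => Real.exp (-(1 / (2 * s)) * u ^ 2))
      (gaussianReal 0 (1 / 2 : ℝ).toNNReal) := by
    refine Integrable.of_bound (by fun_prop) 1 (ae_of_all _ fun u => ?_)
    rw [Real.norm_eq_abs, abs_of_pos (Real.exp_pos _), Real.exp_le_one_iff]
    have := mul_nonneg hb (sq_nonneg u)
    linarith
  rw [integral_cgaussian]
  simp_rw [e]
  rw [integral_sub (integrable_const _) (hi.mul_prod hi), integral_prod_mul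
    (fun u : ℝ => Real.exp (-(1 / (2 * s)) * u ^ 2)) (fun u : ℝ => Real.exp (-(1 / (2 * s)) * u ^ 2)),
    integral_exp_neg_sq_gaussianReal hb, ← mul_inv, Real.mul_self_sqrt (by positivity)]
  simp
  field_simp
  ring

end ComplexGaussian

section Khintchine

variable {E : Type*} [NormedAddCommGroup E] [NormedSpace ℝ E] [FiniteDimensional ℝ E]
  [MeasurableSpace E] [BorelSpace E] {μ : Measure E} [IsGaussian μ]
  {A : Type*} [NormedRing A] [NormedAlgebra ℝ A]

omit [NormedAlgebra ℝ A] in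
lemma norm_pow_le_mul (a : A) (k : ℕ) : ‖a ^ k‖ ≤ (1 + ‖(1 : A)‖) * ‖a‖ ^ k := by
  rcases Nat.eq_zero_or_pos k with rfl | hk
  · simp
  · refine (norm_pow_le' a hk).trans (le_mul_of_one_le_left (by positivity) ?_)
    linarith [norm_nonneg (1 : A)]

/-- The derivative at angle `0` of `τ(H(y) H(x)ⁿ)` along rotations of `(x, y)`. -/
def wickDeriv (H : E →L[ℝ] A) (τ : A →L[ℝ] ℝ) (n : ℕ) (p : E × E) : ℝ :=
  τ (-(H p.1) * H p.1 ^ n +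
    H p.2 * ∑ i ∈ Finset.range n, H p.1 ^ (n.pred - i) * H p.2 * H p.1 ^ i)

omit [FiniteDimensional ℝ E] [MeasurableSpace E] [BorelSpace E] in
lemma continuous_wickDeriv (H : E →L[ℝ] A) (τ : A →L[ℝ] ℝ) (n : ℕ) :
    Continuous (wickDeriv H τ n) := by
  unfold wickDeriv
  fun_prop

omit [FiniteDimensional ℝ E] [MeasurableSpace E] [BorelSpace E] in
lemma exists_norm_wickDeriv_le (H : E →L[ℝ] A) (τ : A →L[ℝ] ℝ) (n : ℕ) :
    ∃ C, 0 ≤ C ∧ ∀ p : E × E, ‖wickDeriv H τ n p‖ ≤ C * ‖p‖ ^ (n + 1) := by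
  set u := 1 + ‖(1 : A)‖
  have hu : 0 ≤ u := by positivity
  refine ⟨‖τ‖ * (u * ‖H‖ ^ (n + 1) + n * (u * u * ‖H‖ ^ (n + 1))), by positivity, fun p => ?_⟩
  have h1 : ‖H p.1‖ ≤ ‖H‖ * ‖p‖ := (H.le_opNorm _).trans (by gcongr; exact norm_fst_le p)
  have h2 : ‖H p.2‖ ≤ ‖H‖ * ‖p‖ := (H.le_opNorm _).trans (by gcongr; exact norm_snd_le p)
  have hp : ∀ k, ‖H p.1 ^ k‖ ≤ u * (‖H‖ * ‖p‖) ^ k := fun k =>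
    (norm_pow_le_mul _ k).trans (by gcongr)
  set R := ‖H‖ * ‖p‖
  have hR : 0 ≤ R := by positivity
  have key : ‖-(H p.1) * H p.1 ^ n +
      H p.2 * ∑ i ∈ Finset.range n, H p.1 ^ (n.pred - i) * H p.2 * H p.1 ^ i‖
      ≤ R * (u * R ^ n) + R * (n * (u * u * R ^ n)) := by
    refine (norm_add_le _ _).trans (add_le_add ?_ ?_)
    · refine (norm_mul_le _ _).trans ?_
      rw [norm_neg]
      gcongr
      exact hp n
    · refine (norm_mul_le _ _).trans ?_
      gcongr
      refine (norm_sum_le _ _).trans ?_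
      rw [← nsmul_eq_mul]
      conv_rhs => rw [← Finset.card_range n, ← Finset.sum_const]
      rw [Finset.card_range]
      refine Finset.sum_le_sum fun i hi => ?_
      have hi' : n = (n.pred - i) + 1 + i := by
        have := Finset.mem_range.1 hi
        simp only [Nat.pred_eq_sub_one]; omega
      calc _ ≤ ‖H p.1 ^ (n.pred - i)‖ * ‖H p.2‖ * ‖H p.1 ^ i‖ :=
            (norm_mul_le _ _).trans (by gcongr; exact norm_mul_le _ _)
        _ ≤ (u * R ^ (n.pred - i)) * R * (u * R ^ i) := by
            gcongr
            · exact hp _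
            · exact hp _
        _ = u * u * R ^ ((n.pred - i) + 1 + i) := by ring
        _ = _ := by rw [← hi']
  calc _ ≤ ‖τ‖ * _ := τ.le_opNorm _
    _ ≤ ‖τ‖ * (R * (u * R ^ n) + R * (n * (u * u * R ^ n))) := by gcongr
    _ = _ := by simp only [R]; ring

open ContinuousLinearMap in
/-- Gaussian integration by parts for traces of powers, via rotation invariance. -/
lemma integral_wickDeriv_eq_zero (hμ : μ[id] = 0) (H : E →L[ℝ] A) (τ : A →L[ℝ] ℝ) (n : ℕ) :
    Integrable (wickDeriv H τ n) (μ.prod μ) ∧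
      ∫ p, wickDeriv H τ n p ∂(μ.prod μ) = 0 := by
  have : CompleteSpace E := FiniteDimensional.complete ℝ E
  have : ProperSpace E := FiniteDimensional.proper ℝ E
  set F : E × E → ℝ := fun p => τ (H p.2 * H p.1 ^ n) with hF
  have hFc : Continuous F := by fun_prop
  obtain ⟨C, hC, hb⟩ := exists_norm_wickDeriv_le H τ n
  have hmp : ∀ θ : ℝ, MeasurePreserving (rotation θ : E × E →L[ℝ] E × E)
      (μ.prod μ) (μ.prod μ) := fun θ =>
    ⟨(rotation θ).continuous.measurable, IsGaussian.map_rotation_eq_self hμ θ⟩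
  have hfint : ∀ k : ℕ, Integrable (fun p : E × E => ‖p‖ ^ k) (μ.prod μ) := fun k =>
    (IsGaussian.memLp_id (μ.prod μ) k (by simp)).integrable_norm_pow'
  have hpath : ∀ (p : E × E) (θ : ℝ),
      HasDerivAt (fun θ : ℝ => (rotation θ p).1) (rotation θ p).2 θ ∧
      HasDerivAt (fun θ : ℝ => (rotation θ p).2) (-(rotation θ p).1) θ := by
    intro p θ
    simp only [ContinuousLinearMap.rotation_apply]
    refine ⟨((Real.hasDerivAt_cos θ).smul_const p.1).add ((Real.hasDerivAt_sin θ).smul_const p.2),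
      ?_⟩
    refine (((Real.hasDerivAt_sin θ).neg.smul_const p.1).add
      ((Real.hasDerivAt_cos θ).smul_const p.2)).congr_deriv ?_
    rw [neg_smul, neg_smul, neg_add]
  have hder : ∀ (p : E × E) (θ : ℝ),
      HasDerivAt (fun θ : ℝ => F (rotation θ p)) (wickDeriv H τ n (rotation θ p)) θ := by
    intro p θ
    obtain ⟨d1, d2⟩ := hpath p θ
    have e1 := H.hasFDerivAt.comp_hasDerivAt θ d1
    have e2 := H.hasFDerivAt.comp_hasDerivAt θ d2
    have e3 := τ.hasFDerivAt.comp_hasDerivAt θ (e2.mul (e1.fun_pow' n))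
    refine e3.congr_deriv ?_
    simp only [wickDeriv, map_neg, Function.comp_apply]
  have hnorm : ∀ (θ : ℝ) (p : E × E), ‖rotation θ p‖ ≤ 2 * ‖p‖ := by
    intro θ p
    have h1 := norm_fst_le p
    have h2 := norm_snd_le p
    rw [ContinuousLinearMap.rotation_apply, Prod.norm_def]
    refine max_le ?_ ?_ <;> refine (norm_add_le _ _).trans ?_ <;>
      rw [norm_smul, norm_smul]
    · have : ‖Real.cos θ‖ ≤ 1 := Real.abs_cos_le_one θ
      have : ‖Real.sin θ‖ ≤ 1 := Real.abs_sin_le_one θ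
      nlinarith [norm_nonneg p.1, norm_nonneg p.2]
    · have : ‖Real.cos θ‖ ≤ 1 := Real.abs_cos_le_one θ
      have : ‖-Real.sin θ‖ ≤ 1 := by simpa using Real.abs_sin_le_one θ
      nlinarith [norm_nonneg p.1, norm_nonneg p.2]
  have hFint : Integrable F (μ.prod μ) := by
    refine ((hfint (n + 1)).const_mul (‖τ‖ * (‖H‖ * ((1 + ‖(1 : A)‖) * ‖H‖ ^ n)))).mono'
      hFc.aestronglyMeasurable (ae_of_all _ fun p => ?_)
    have h1 : ‖H p.1‖ ≤ ‖H‖ * ‖p‖ := (H.le_opNorm _).trans (by gcongr; exact norm_fst_le p)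
    have h2 : ‖H p.2‖ ≤ ‖H‖ * ‖p‖ := (H.le_opNorm _).trans (by gcongr; exact norm_snd_le p)
    calc ‖F p‖ ≤ ‖τ‖ * (‖H p.2‖ * ‖H p.1 ^ n‖) :=
          (τ.le_opNorm _).trans (by gcongr; exact norm_mul_le _ _)
      _ ≤ ‖τ‖ * ((‖H‖ * ‖p‖) * ((1 + ‖(1 : A)‖) * (‖H‖ * ‖p‖) ^ n)) := by
          gcongr
          exact (norm_pow_le_mul _ n).trans (by gcongr)
      _ = _ := by ring
  have e0 : ∀ p : E × E, rotation 0 p = p := fun p => by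
    simp [ContinuousLinearMap.rotation_apply]
  have main := hasDerivAt_integral_of_dominated_loc_of_deriv_le (μ := μ.prod μ) (𝕜 := ℝ)
    (x₀ := (0 : ℝ)) (s := Set.univ) (F := fun θ p => F (rotation θ p))
    (F' := fun θ p => wickDeriv H τ n (rotation θ p))
    (bound := fun p => C * 2 ^ (n + 1) * ‖p‖ ^ (n + 1)) Filter.univ_mem
    (Filter.Eventually.of_forall fun θ =>
      (hFc.comp (rotation θ).continuous).aestronglyMeasurable)
    (by simpa only [e0] using hFint)
    (((continuous_wickDeriv H τ n).comp (rotation 0).continuous).aestronglyMeasurable)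
    (ae_of_all _ fun p θ _ => by
      refine (hb _).trans ?_
      rw [mul_assoc, ← mul_pow]
      gcongr
      exact hnorm θ p)
    ((hfint (n + 1)).const_mul _)
    (ae_of_all _ fun p θ _ => hder p θ)
  obtain ⟨m1, m2⟩ := main
  simp only [e0] at m1 m2
  refine ⟨m1, ?_⟩
  have hconst : (fun θ : ℝ => ∫ p, F (rotation θ p) ∂(μ.prod μ)) =
      fun _ => ∫ p, F p ∂(μ.prod μ) := by
    funext θ
    conv_rhs => rw [← (hmp θ).map_eq]
    rw [integral_map (hmp θ).measurable.aemeasurable hFc.aestronglyMeasurable]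
  rw [hconst] at m2
  exact m2.unique (hasDerivAt_const _ _)

end Khintchine

section MatrixKhintchine

open scoped Matrix.Norms.L2Operator

variable {ι : Type*} [Fintype ι] [DecidableEq ι]

/-- The real part of the trace as a continuous real functional. -/
def reTrace (ι : Type*) [Fintype ι] [DecidableEq ι] : Matrix ι ι ℂ →L[ℝ] ℝ :=
  LinearMap.toContinuousLinearMap
    (reLm ∘ₗ (Matrix.traceLinearMap ι ℝ ℂ))

lemma reTrace_apply (M : Matrix ι ι ℂ) : reTrace ι M = M.trace.re := rfl

lemma trace_conj_pow {B : Matrix ι ι ℂ} (l : ι → ℝ) (i j : ℕ) :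
    (B * diagonal (fun k => (l k : ℂ)) ^ i * B * diagonal (fun k => (l k : ℂ)) ^ j).trace =
      ∑ a, ∑ b, B a b * B b a * ((l b ^ i * l a ^ j : ℝ) : ℂ) := by
  simp only [diagonal_pow, trace, diag_apply]
  refine Finset.sum_congr rfl fun a _ => ?_
  rw [mul_diagonal, mul_apply, Finset.sum_mul]
  refine Finset.sum_congr rfl fun b _ => ?_
  rw [mul_diagonal]
  push_cast
  simp only [Pi.pow_apply]
  ring

lemma abs_pow_mul_pow_le (x y : ℝ) {i j r : ℕ} (h : i + j = 2 * r) :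
    x ^ i * y ^ j ≤ x ^ (2 * r) + y ^ (2 * r) := by
  have e1 : x ^ (2 * r) = |x| ^ (2 * r) := by rw [pow_mul, pow_mul, sq_abs]
  have e2 : y ^ (2 * r) = |y| ^ (2 * r) := by rw [pow_mul, pow_mul, sq_abs]
  have e3 : x ^ i * y ^ j ≤ |x| ^ i * |y| ^ j := by
    rw [← abs_pow, ← abs_pow, ← abs_mul]; exact le_abs_self _
  refine e3.trans ?_
  rw [e1, e2, ← h]
  rcases le_total |x| |y| with hxy | hxy
  · calc _ ≤ |y| ^ i * |y| ^ j := by gcongr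
      _ = |y| ^ (i + j) := (pow_add _ _ _).symm
      _ ≤ _ := le_add_of_nonneg_left (by positivity)
  · calc _ ≤ |x| ^ i * |x| ^ j := by gcongr
      _ = |x| ^ (i + j) := (pow_add _ _ _).symm
      _ ≤ _ := le_add_of_nonneg_right (by positivity)

lemma reTrace_mul_pow_mul_pow_le_diagonal {B : Matrix ι ι ℂ} (hB : B.IsHermitian) (l : ι → ℝ)
    {i j r : ℕ} (h : i + j = 2 * r) :
    (B * diagonal (fun k => (l k : ℂ)) ^ i * B * diagonal (fun k => (l k : ℂ)) ^ j).trace.re ≤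
      2 * (B * diagonal (fun k => (l k : ℂ)) ^ 0 * B * diagonal (fun k => (l k : ℂ)) ^ (2 * r)).trace.re := by
  rw [trace_conj_pow, trace_conj_pow, re_sum, re_sum]
  simp only [re_sum, pow_zero, one_mul]
  have hn : ∀ a b, B a b * B b a = ((‖B a b‖ ^ 2 : ℝ) : ℂ) := fun a b => by
    rw [← hB.apply b a]
    push_cast
    exact Complex.mul_conj' _
  simp only [hn, ← ofReal_mul, ofReal_re]
  have hs : ∑ a, ∑ b, ‖B a b‖ ^ 2 * l b ^ (2 * r) = ∑ a, ∑ b, ‖B a b‖ ^ 2 * l a ^ (2 * r) := by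
    rw [Finset.sum_comm]
    refine Finset.sum_congr rfl fun a _ => Finset.sum_congr rfl fun b _ => ?_
    rw [← hB.apply b a, norm_star]
  calc _ ≤ ∑ a, ∑ b, (‖B a b‖ ^ 2 * l b ^ (2 * r) + ‖B a b‖ ^ 2 * l a ^ (2 * r)) := by
        gcongr with a _ b _
        rw [← mul_add]
        gcongr
        exact abs_pow_mul_pow_le _ _ h
    _ = _ := by
        simp only [Finset.sum_add_distrib]
        rw [hs]; ring

lemma reTrace_mul_pow_mul_pow_le {M B : Matrix ι ι ℂ} (hM : M.IsHermitian) (hB : B.IsHermitian)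
    {i j r : ℕ} (h : i + j = 2 * r) :
    (B * M ^ i * B * M ^ j).trace.re ≤ 2 * (B * B * M ^ (2 * r)).trace.re := by
  obtain ⟨U, l, hU, hM'⟩ : ∃ (U : Matrix.unitaryGroup ι ℂ) (l : ι → ℝ), True ∧
      M = (U : Matrix ι ι ℂ) * diagonal (fun k => (l k : ℂ)) * star (U : Matrix ι ι ℂ) := by
    refine ⟨hM.eigenvectorUnitary, hM.eigenvalues, trivial, ?_⟩
    conv_lhs => rw [hM.spectral_theorem, Unitary.conjStarAlgAut_apply]
    rfl
  set D := diagonal (fun k => (l k : ℂ))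
  have hUU : star (U : Matrix ι ι ℂ) * (U : Matrix ι ι ℂ) = 1 := Unitary.coe_star_mul_self U
  have hUU' : (U : Matrix ι ι ℂ) * star (U : Matrix ι ι ℂ) = 1 := Unitary.coe_mul_star_self U
  have hp : ∀ k, M ^ k = (U : Matrix ι ι ℂ) * D ^ k * star (U : Matrix ι ι ℂ) := by
    intro k
    induction k with
    | zero => simp [hUU']
    | succ k ih =>
      rw [pow_succ, ih, hM', pow_succ]
      calc _ = (U : Matrix ι ι ℂ) * D ^ k * (star (U : Matrix ι ι ℂ) * (U : Matrix ι ι ℂ)) * D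
            * star (U : Matrix ι ι ℂ) := by simp only [Matrix.mul_assoc]
        _ = _ := by rw [hUU, Matrix.mul_one, Matrix.mul_assoc (U : Matrix ι ι ℂ)]
  set B' := star (U : Matrix ι ι ℂ) * B * (U : Matrix ι ι ℂ) with hB'
  have hBh : B'.IsHermitian := by
    have := isHermitian_conjTranspose_mul_mul (U : Matrix ι ι ℂ) hB
    exact this
  have tr : ∀ i j, (B * M ^ i * B * M ^ j).trace = (B' * D ^ i * B' * D ^ j).trace := by
    intro i j
    rw [hp, hp]
    calc _ = ((B * U * D ^ i * star (U : Matrix ι ι ℂ) * B * U * D ^ j)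
          * star (U : Matrix ι ι ℂ)).trace := by simp only [Matrix.mul_assoc]
      _ = _ := by
        rw [trace_mul_comm]
        simp only [hB', Matrix.mul_assoc]
  have h0 := tr 0 (2 * r)
  rw [pow_zero, Matrix.mul_one] at h0
  rw [tr, h0]
  exact reTrace_mul_pow_mul_pow_le_diagonal hBh l h

lemma norm_pow_le_reTrace_pow [Nonempty ι] {M : Matrix ι ι ℂ} (hM : M.IsHermitian) (q : ℕ) :
    ‖M‖ ^ (2 * q) ≤ (M ^ (2 * q)).trace.re := by
  have e : M = (hM.eigenvectorUnitary : Matrix ι ι ℂ) *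
      diagonal (fun k => (hM.eigenvalues k : ℂ)) *
        star (hM.eigenvectorUnitary : Matrix ι ι ℂ) := by
    conv_lhs => rw [hM.spectral_theorem, Unitary.conjStarAlgAut_apply]
    rfl
  have hn : ‖M‖ = ‖(fun k => (hM.eigenvalues k : ℂ))‖ := by
    conv_lhs => rw [e]
    rw [CStarRing.norm_mul_mem_unitary _ (Unitary.star_mem hM.eigenvectorUnitary.2),
      CStarRing.norm_coe_unitary_mul, l2_opNorm_diagonal]
  have ht : (M ^ (2 * q)).trace.re = ∑ k, hM.eigenvalues k ^ (2 * q) := by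
    conv_lhs => rw [hM.spectral_theorem, ← map_pow, Unitary.conjStarAlgAut_apply, trace_mul_comm,
      ← Matrix.mul_assoc, Unitary.coe_star_mul_self, Matrix.one_mul, diagonal_pow, trace_diagonal]
    simp [← ofReal_pow]
  obtain ⟨k, hk⟩ : ∃ k, ‖(fun k => (hM.eigenvalues k : ℂ))‖ = ‖(hM.eigenvalues k : ℂ)‖ := by
    obtain ⟨k, -, hk⟩ := Finset.exists_mem_eq_sup' Finset.univ_nonempty
      (fun k => ‖(hM.eigenvalues k : ℂ)‖₊)
    refine ⟨k, ?_⟩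
    rw [Finset.sup'_eq_sup] at hk
    rw [Pi.norm_def, hk, coe_nnnorm]
  rw [hn, hk, ht, norm_real, Real.norm_eq_abs, pow_mul, sq_abs, ← pow_mul]
  exact Finset.single_le_sum (f := fun k => hM.eigenvalues k ^ (2 * q))
    (fun i _ => by rw [pow_mul]; positivity) (Finset.mem_univ k)

variable {E : Type*} [NormedAddCommGroup E] [NormedSpace ℝ E] [FiniteDimensional ℝ E]
  [MeasurableSpace E] [BorelSpace E] {μ : Measure E} [IsGaussian μ]

lemma integrable_norm_pow_gaussian (k : ℕ) : Integrable (fun p : E => ‖p‖ ^ k) μ := by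
  have : CompleteSpace E := FiniteDimensional.complete ℝ E
  have : ProperSpace E := FiniteDimensional.proper ℝ E
  exact (IsGaussian.memLp_id μ k (by simp)).integrable_norm_pow'

lemma integrable_of_norm_le_pow {F : Type*} [NormedAddCommGroup F] {f : E → F}
    (hf : AEStronglyMeasurable f μ) {C : ℝ} {k : ℕ} (h : ∀ x, ‖f x‖ ≤ C * ‖x‖ ^ k) :
    Integrable f μ :=
  ((integrable_norm_pow_gaussian k).const_mul C).mono' hf (ae_of_all _ h)

lemma reTrace_sq_mul_pow {M B : Matrix ι ι ℂ} (hM : M.IsHermitian) (hB : B.IsHermitian) (r : ℕ) :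
    (B * B * M ^ (2 * r)).trace.re =
      ∑ k, ∑ i, ‖(B *ᵥ fun j => (M ^ r) j k) i‖ ^ 2 := by
  have hMr : (M ^ r).IsHermitian := hM.pow r
  have e : B * B * M ^ (2 * r) = B * ((B * M ^ r) * M ^ r) := by
    rw [two_mul, pow_add]; simp only [Matrix.mul_assoc]
  have e2 : (B * B * M ^ (2 * r)).trace = ((B * M ^ r)ᴴ * (B * M ^ r)).trace := by
    rw [e, trace_mul_comm, conjTranspose_mul, hMr.eq, hB.eq, Matrix.mul_assoc, trace_mul_comm]
  rw [e2]
  simp only [trace, diag_apply, mul_apply, conjTranspose_apply, re_sum]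
  refine Finset.sum_congr rfl fun k _ => Finset.sum_congr rfl fun i _ => ?_
  have : (B *ᵥ fun j => (M ^ r) j k) i = ∑ j, B i j * (M ^ r) j k := rfl
  rw [this, ← mul_apply, star_def, mul_comm, Complex.mul_conj, ofReal_re, normSq_eq_norm_sq]

lemma integrable_reTrace_pow (H : E →L[ℝ] Matrix ι ι ℂ) (n : ℕ) :
    Integrable (fun x => (H x ^ n).trace.re) μ := by
  have : ProperSpace E := FiniteDimensional.proper ℝ E
  refine integrable_of_norm_le_pow (C := ‖reTrace ι‖ * ((1 + ‖(1 : Matrix ι ι ℂ)‖) * ‖H‖ ^ n)) (k := n)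
    (f := fun x => reTrace ι (H x ^ n)) ?_ fun x => ?_
  · have : Continuous fun x => reTrace ι (H x ^ n) := by fun_prop
    exact this.aestronglyMeasurable
  · calc _ ≤ ‖reTrace ι‖ * ‖H x ^ n‖ := (reTrace ι).le_opNorm _
      _ ≤ ‖reTrace ι‖ * ((1 + ‖(1 : Matrix ι ι ℂ)‖) * (‖H‖ * ‖x‖) ^ n) := by
        gcongr
        refine (norm_pow_le_mul _ _).trans ?_
        gcongr
        exact H.le_opNorm x
      _ = _ := by ring

lemma integrable_reTrace_sq_mul_pow (H : E →L[ℝ] Matrix ι ι ℂ) (n : ℕ) :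
    Integrable (fun p : E × E => (H p.2 * H p.2 * H p.1 ^ n).trace.re) (μ.prod μ) := by
  have : ProperSpace E := FiniteDimensional.proper ℝ E
  refine integrable_of_norm_le_pow
    (C := ‖reTrace ι‖ * ((1 + ‖(1 : Matrix ι ι ℂ)‖) * ‖H‖ ^ (n + 2))) (k := n + 2)
    (f := fun p : E × E => reTrace ι (H p.2 * H p.2 * H p.1 ^ n)) ?_ fun p => ?_
  · have : Continuous fun p : E × E => reTrace ι (H p.2 * H p.2 * H p.1 ^ n) := by fun_prop
    exact this.aestronglyMeasurable
  · have h1 : ‖H p.1‖ ≤ ‖H‖ * ‖p‖ := (H.le_opNorm _).trans (by gcongr; exact norm_fst_le p)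
    have h2 : ‖H p.2‖ ≤ ‖H‖ * ‖p‖ := (H.le_opNorm _).trans (by gcongr; exact norm_snd_le p)
    calc _ ≤ ‖reTrace ι‖ * ‖H p.2 * H p.2 * H p.1 ^ n‖ := (reTrace ι).le_opNorm _
      _ ≤ ‖reTrace ι‖ * (((‖H‖ * ‖p‖) * (‖H‖ * ‖p‖)) *
          ((1 + ‖(1 : Matrix ι ι ℂ)‖) * (‖H‖ * ‖p‖) ^ n)) := by
        gcongr
        refine (norm_mul_le _ _).trans (mul_le_mul ((norm_mul_le _ _).trans ?_)
          ((norm_pow_le_mul _ _).trans ?_) (norm_nonneg _) (by positivity))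
        · gcongr
        · gcongr
      _ = _ := by ring

/-- One step of the Gaussian trace moment recursion. -/
lemma integral_reTrace_pow_succ_le (hμ : μ[id] = 0) (H : E →L[ℝ] Matrix ι ι ℂ)
    (hH : ∀ x, (H x).IsHermitian) {v : ℝ}
    (hfint : ∀ ξ : ι → ℂ, Integrable (fun y => ∑ i, ‖(H y *ᵥ ξ) i‖ ^ 2) μ)
    (hv : ∀ ξ : ι → ℂ, ∫ y, ∑ i, ‖(H y *ᵥ ξ) i‖ ^ 2 ∂μ ≤ v * ∑ i, ‖ξ i‖ ^ 2) (r : ℕ) :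
    ∫ x, (H x ^ (2 * (r + 1))).trace.re ∂μ ≤
      2 * (2 * r + 1) * v * ∫ x, (H x ^ (2 * r)).trace.re ∂μ := by
  have : ProperSpace E := FiniteDimensional.proper ℝ E
  obtain ⟨w1, w2⟩ := integral_wickDeriv_eq_zero hμ H (reTrace ι) (2 * r + 1)
  have hT := integrable_reTrace_pow (μ := μ) H (2 * (r + 1))
  have hS := integrable_reTrace_sq_mul_pow (μ := μ) H (2 * r)
  have hpt : ∀ p : E × E, wickDeriv H (reTrace ι) (2 * r + 1) p ≤
      -(H p.1 ^ (2 * (r + 1))).trace.re +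
        2 * (2 * r + 1) * (H p.2 * H p.2 * H p.1 ^ (2 * r)).trace.re := by
    intro p
    rw [wickDeriv, map_add, Finset.mul_sum, map_sum]
    refine add_le_add (le_of_eq ?_) ?_
    · rw [neg_mul, ← pow_succ', map_neg]
      rfl
    · calc _ ≤ ∑ i ∈ Finset.range (2 * r + 1),
            2 * (H p.2 * H p.2 * H p.1 ^ (2 * r)).trace.re := by
            refine Finset.sum_le_sum fun i hi => ?_
            rw [reTrace_apply, ← Matrix.mul_assoc, ← Matrix.mul_assoc]
            refine reTrace_mul_pow_mul_pow_le (hH _) (hH _) ?_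
            have := Finset.mem_range.1 hi
            simp only [Nat.pred_eq_sub_one]; omega
        _ = _ := by
            rw [Finset.sum_const, Finset.card_range, nsmul_eq_mul]; push_cast; ring
  have h1 : ∫ p : E × E, (H p.1 ^ (2 * (r + 1))).trace.re ∂(μ.prod μ) =
      ∫ x, (H x ^ (2 * (r + 1))).trace.re ∂μ := by
    have := integral_fun_fst (μ := μ) (ν := μ) (f := fun x => (H x ^ (2 * (r + 1))).trace.re)
    simpa using this
  have h2 : ∫ p : E × E, (H p.2 * H p.2 * H p.1 ^ (2 * r)).trace.re ∂(μ.prod μ) ≤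
      v * ∫ x, (H x ^ (2 * r)).trace.re ∂μ := by
    rw [integral_prod _ hS, ← integral_const_mul]
    refine integral_mono hS.integral_prod_left
      ((integrable_reTrace_pow H (2 * r)).const_mul v) fun x => ?_
    simp only [reTrace_sq_mul_pow (hH x) (hH _)]
    rw [integral_finsetSum _ fun k _ => hfint _]
    have e1 := reTrace_sq_mul_pow (hH x) (B := 1) isHermitian_one r
    rw [Matrix.mul_one, Matrix.one_mul] at e1
    rw [e1, Finset.mul_sum]
    simp only [one_mulVec]
    exact Finset.sum_le_sum fun k _ => hv _
  have h3 : 0 ≤ ∫ p : E × E, (-(H p.1 ^ (2 * (r + 1))).trace.re +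
        2 * (2 * r + 1) * (H p.2 * H p.2 * H p.1 ^ (2 * r)).trace.re) ∂(μ.prod μ) := by
    rw [← w2]
    exact integral_mono w1 ((hT.comp_fst μ).neg.add (hS.const_mul _)) hpt
  have hT' : Integrable (fun p : E × E => -(H p.1 ^ (2 * (r + 1))).trace.re) (μ.prod μ) :=
    (hT.comp_fst μ).neg
  rw [integral_add hT' (hS.const_mul _), integral_neg, integral_const_mul, h1] at h3
  have h4 : (0 : ℝ) ≤ 2 * (2 * r + 1) := by positivity
  nlinarith [mul_le_mul_of_nonneg_left h2 h4]

lemma integral_reTrace_pow_le (hμ : μ[id] = 0) (H : E →L[ℝ] Matrix ι ι ℂ)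
    (hH : ∀ x, (H x).IsHermitian) {v : ℝ} (hv0 : 0 ≤ v)
    (hfint : ∀ ξ : ι → ℂ, Integrable (fun y => ∑ i, ‖(H y *ᵥ ξ) i‖ ^ 2) μ)
    (hv : ∀ ξ : ι → ℂ, ∫ y, ∑ i, ‖(H y *ᵥ ξ) i‖ ^ 2 ∂μ ≤ v * ∑ i, ‖ξ i‖ ^ 2) (q : ℕ) :
    ∫ x, (H x ^ (2 * q)).trace.re ∂μ ≤ (4 * q * v) ^ q * Fintype.card ι := by
  have key : ∀ r ≤ q, ∫ x, (H x ^ (2 * r)).trace.re ∂μ ≤ (4 * q * v) ^ r * Fintype.card ι := by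
    intro r
    induction r with
    | zero => intro _; simp [trace_one]
    | succ r ih =>
      intro hr
      refine (integral_reTrace_pow_succ_le hμ H hH hfint hv r).trans ?_
      have h1 : (2 * (2 * r + 1) : ℝ) ≤ 4 * q := by
        have : ((r + 1 : ℕ) : ℝ) ≤ q := by exact_mod_cast hr
        push_cast at this; linarith
      calc _ ≤ (4 * q : ℝ) * v * ((4 * q * v) ^ r * Fintype.card ι) := by
            refine mul_le_mul (by gcongr) (ih (by omega)) ?_ (by positivity)
            refine integral_nonneg fun x => ?_
            have e1 := reTrace_sq_mul_pow (hH x) (B := 1) isHermitian_one r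
            rw [Matrix.mul_one, Matrix.one_mul] at e1
            simp only [Pi.zero_apply]
            rw [e1]; positivity
        _ = _ := by ring
  exact key q le_rfl

/-- Gaussian noncommutative Khintchine inequality for Hermitian matrices. -/
lemma integral_norm_le_of_isHermitian [Nonempty ι] (hμ : μ[id] = 0) (H : E →L[ℝ] Matrix ι ι ℂ)
    (hH : ∀ x, (H x).IsHermitian) {v : ℝ} (hv0 : 0 ≤ v)
    (hfint : ∀ ξ : ι → ℂ, Integrable (fun y => ∑ i, ‖(H y *ᵥ ξ) i‖ ^ 2) μ)
    (hv : ∀ ξ : ι → ℂ, ∫ y, ∑ i, ‖(H y *ᵥ ξ) i‖ ^ 2 ∂μ ≤ v * ∑ i, ‖ξ i‖ ^ 2)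
    {q : ℕ} (hq0 : q ≠ 0) (hq : (Fintype.card ι : ℝ) ≤ Real.exp q) :
    ∫ x, ‖H x‖ ∂μ ≤ 4 * √(q * v) := by
  have : ProperSpace E := FiniteDimensional.proper ℝ E
  have hcont : Continuous fun x => ‖H x‖ := by fun_prop
  have hi : ∀ k, Integrable (fun x => ‖H x‖ ^ k) μ := fun k =>
    integrable_of_norm_le_pow (C := ‖H‖ ^ k) (k := k) (hcont.pow k).aestronglyMeasurable fun x => by
      rw [norm_pow, norm_norm, ← mul_pow]
      gcongr
      exact H.le_opNorm x
  have hJ : (∫ x, ‖H x‖ ∂μ) ^ (2 * q) ≤ ∫ x, ‖H x‖ ^ (2 * q) ∂μ :=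
    (convexOn_pow (2 * q)).map_integral_le (by fun_prop) isClosed_Ici
      (ae_of_all _ fun x => norm_nonneg _) (by simpa using hi 1) (hi (2 * q))
  have hT : ∫ x, ‖H x‖ ^ (2 * q) ∂μ ≤ (4 * q * v) ^ q * Fintype.card ι :=
    (integral_mono (hi _) (integrable_reTrace_pow H _)
      fun x => norm_pow_le_reTrace_pow (hH x) q).trans
      (integral_reTrace_pow_le hμ H hH hv0 hfint hv q)
  have he : Real.exp q ≤ 4 ^ q := by
    rw [← mul_one (q : ℝ), Real.exp_nat_mul]
    gcongr
    linarith [Real.exp_one_lt_d9]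
  refine le_of_pow_le_pow_left₀ (n := 2 * q) (by omega) (by positivity) ?_
  calc _ ≤ (4 * q * v) ^ q * 4 ^ q := (hJ.trans hT).trans (by gcongr; exact hq.trans he)
    _ = (4 * √(q * v)) ^ (2 * q) := by
      rw [pow_mul, mul_pow 4 √(q * v), Real.sq_sqrt (by positivity), ← mul_pow]
      congr 1; ring

end MatrixKhintchine

section OperatorNorm

open scoped Matrix.Norms.L2Operator

variable {ι κ : Type*} [Fintype ι] [DecidableEq ι] [Fintype κ] [DecidableEq κ]

omit [DecidableEq κ] in
lemma sum_norm_sq_mulVec_le (M : Matrix κ ι ℂ) (w : ι → ℂ) :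
    ∑ i, ‖(M *ᵥ w) i‖ ^ 2 ≤ ‖M‖ ^ 2 * ∑ i, ‖w i‖ ^ 2 := by
  have h := M.l2_opNorm_mulVec (WithLp.toLp 2 w)
  have h2 := pow_le_pow_left₀ (norm_nonneg _) h 2
  rw [mul_pow, EuclideanSpace.norm_sq_eq, EuclideanSpace.norm_sq_eq] at h2
  exact h2

omit [DecidableEq κ] in
lemma l2_opNorm_le_of_sum_norm_sq_le (M : Matrix κ ι ℂ) {C : ℝ} (hC : 0 ≤ C)
    (h : ∀ w : ι → ℂ, ∑ i, ‖(M *ᵥ w) i‖ ^ 2 ≤ C ^ 2 * ∑ i, ‖w i‖ ^ 2) : ‖M‖ ≤ C := by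
  rw [Matrix.l2_opNorm_def]
  refine ContinuousLinearMap.opNorm_le_bound _ hC fun x => ?_
  refine le_of_sq_le_sq ?_ (by positivity)
  rw [mul_pow, EuclideanSpace.norm_sq_eq, EuclideanSpace.norm_sq_eq]
  exact h x.ofLp

lemma norm_le_norm_fromBlocks (M : Matrix κ ι ℂ) :
    ‖M‖ ≤ ‖fromBlocks (0 : Matrix κ κ ℂ) M Mᴴ (0 : Matrix ι ι ℂ)‖ := by
  refine l2_opNorm_le_of_sum_norm_sq_le _ (norm_nonneg _) fun w => ?_
  have := sum_norm_sq_mulVec_le (fromBlocks (0 : Matrix κ κ ℂ) M Mᴴ (0 : Matrix ι ι ℂ))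
    (Sum.elim 0 w)
  rw [fromBlocks_mulVec] at this
  have h0 : (Mᴴ *ᵥ fun _ : κ => (0 : ℂ)) = 0 := mulVec_zero _
  simp only [Function.comp_def] at this
  simpa [h0] using this

variable {E : Type*} [NormedAddCommGroup E] [NormedSpace ℝ E] [FiniteDimensional ℝ E]
  [MeasurableSpace E] [BorelSpace E] {μ : Measure E} [IsGaussian μ]

/-- Gaussian noncommutative Khintchine inequality for rectangular matrices. -/
lemma integral_norm_linearMap_le [Nonempty ι] (hμ : μ[id] = 0) (X : E →ₗ[ℝ] Matrix κ ι ℂ)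
    {v : ℝ} (hv0 : 0 ≤ v)
    (hv : ∀ ξ : ι → ℂ, ∫ y, ∑ i, ‖(X y *ᵥ ξ) i‖ ^ 2 ∂μ ≤ v * ∑ i, ‖ξ i‖ ^ 2)
    (hv' : ∀ ξ : κ → ℂ, ∫ y, ∑ i, ‖((X y)ᴴ *ᵥ ξ) i‖ ^ 2 ∂μ ≤ v * ∑ i, ‖ξ i‖ ^ 2)
    {q : ℕ} (hq0 : q ≠ 0) (hq : (Fintype.card κ + Fintype.card ι : ℝ) ≤ Real.exp q) :
    ∫ x, ‖X x‖ ∂μ ≤ 4 * √(q * v) := by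
  have : ProperSpace E := FiniteDimensional.proper ℝ E
  set Hl : E →ₗ[ℝ] Matrix (κ ⊕ ι) (κ ⊕ ι) ℂ :=
    { toFun := fun x => fromBlocks 0 (X x) (X x)ᴴ 0
      map_add' := fun x y => by simp [fromBlocks_add]
      map_smul' := fun r x => by simp [fromBlocks_smul, conjTranspose_smul] }
  set H : E →L[ℝ] Matrix (κ ⊕ ι) (κ ⊕ ι) ℂ := LinearMap.toContinuousLinearMap Hl
  have hH : ∀ x, H x = fromBlocks 0 (X x) (X x)ᴴ 0 := fun x => rfl
  set X' : E →L[ℝ] Matrix κ ι ℂ := LinearMap.toContinuousLinearMap X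
  have hX' : ∀ x, X' x = X x := fun x => rfl
  have hi : ∀ ξ : ι → ℂ, Integrable (fun y => ∑ i, ‖(X y *ᵥ ξ) i‖ ^ 2) μ := by
    intro ξ
    have hc : Continuous fun y => ∑ i, ‖(X' y *ᵥ ξ) i‖ ^ 2 := by
      refine continuous_finsetSum _ fun i _ => (continuous_pi_iff.1 ?_ i).norm.pow 2
      exact X'.continuous.matrix_mulVec continuous_const
    refine integrable_of_norm_le_pow (C := ‖X'‖ ^ 2 * ∑ i, ‖ξ i‖ ^ 2) (k := 2)
      hc.aestronglyMeasurable fun y => ?_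
    rw [Real.norm_of_nonneg (by positivity)]
    calc _ ≤ ‖X' y‖ ^ 2 * ∑ i, ‖ξ i‖ ^ 2 := sum_norm_sq_mulVec_le (X y) ξ
      _ ≤ (‖X'‖ * ‖y‖) ^ 2 * ∑ i, ‖ξ i‖ ^ 2 := by gcongr; exact X'.le_opNorm y
      _ = _ := by ring
  have hi' : ∀ ξ : κ → ℂ, Integrable (fun y => ∑ i, ‖((X y)ᴴ *ᵥ ξ) i‖ ^ 2) μ := by
    intro ξ
    have hc : Continuous fun y => ∑ i, ‖((X' y)ᴴ *ᵥ ξ) i‖ ^ 2 := by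
      refine continuous_finsetSum _ fun i _ => (continuous_pi_iff.1 ?_ i).norm.pow 2
      exact X'.continuous.matrix_conjTranspose.matrix_mulVec continuous_const
    refine integrable_of_norm_le_pow (C := ‖X'‖ ^ 2 * ∑ i, ‖ξ i‖ ^ 2) (k := 2)
      hc.aestronglyMeasurable fun y => ?_
    rw [Real.norm_of_nonneg (by positivity)]
    calc _ ≤ ‖(X' y)ᴴ‖ ^ 2 * ∑ i, ‖ξ i‖ ^ 2 := sum_norm_sq_mulVec_le (X y)ᴴ ξ
      _ ≤ (‖X'‖ * ‖y‖) ^ 2 * ∑ i, ‖ξ i‖ ^ 2 := by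
        rw [l2_opNorm_conjTranspose]; gcongr; exact X'.le_opNorm y
      _ = _ := by ring
  have e : ∀ (ξ : κ ⊕ ι → ℂ) y, ∑ i, ‖(H y *ᵥ ξ) i‖ ^ 2 =
      ∑ i, ‖(X y *ᵥ (ξ ∘ Sum.inr)) i‖ ^ 2 + ∑ i, ‖((X y)ᴴ *ᵥ (ξ ∘ Sum.inl)) i‖ ^ 2 := by
    intro ξ y
    rw [hH, fromBlocks_mulVec]
    simp
  have hN : ∫ x, ‖X x‖ ∂μ ≤ ∫ x, ‖H x‖ ∂μ := by
    refine integral_mono ?_ ?_ fun x => norm_le_norm_fromBlocks (X x)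
    · refine integrable_of_norm_le_pow (C := ‖X'‖) (k := 1)
        (X'.continuous.norm).aestronglyMeasurable fun x => ?_
      rw [norm_norm, pow_one]; exact X'.le_opNorm x
    · refine integrable_of_norm_le_pow (C := ‖H‖) (k := 1)
        (H.continuous.norm).aestronglyMeasurable fun x => ?_
      rw [norm_norm, pow_one]; exact H.le_opNorm x
  refine hN.trans (integral_norm_le_of_isHermitian hμ H (fun x => ?_) hv0 (fun ξ => ?_)
    (fun ξ => ?_) hq0 (by simpa using hq))
  · rw [hH]
    exact isHermitian_fromBlocks_iff.2 ⟨isHermitian_zero, rfl, conjTranspose_conjTranspose _, isHermitian_zero⟩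
  · simp only [e]
    exact (hi _).add (hi' _)
  · simp only [e]
    rw [integral_add (hi _) (hi' _)]
    have h1 := hv (ξ ∘ Sum.inr)
    have h2 := hv' (ξ ∘ Sum.inl)
    rw [Fintype.sum_sum_type, mul_add]
    simp only [Function.comp_apply] at h1 h2
    linarith

end OperatorNorm

set_option linter.unusedSectionVars false

section LinearMatrixModel

open scoped Matrix.Norms.L2Operator

variable {m : ℕ}

lemma cnorm_nonneg (v : Fin m → ℂ) : 0 ≤ cnorm v := Real.sqrt_nonneg _

lemma cnorm_sq (v : Fin m → ℂ) : cnorm v ^ 2 = ∑ i, ‖v i‖ ^ 2 :=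
  Real.sq_sqrt (by positivity)

lemma cnorm_le_sqrt_mul_norm (v : Fin m → ℂ) : cnorm v ≤ √m * ‖v‖ := by
  refine Real.sqrt_le_iff.2 ⟨by positivity, ?_⟩
  rw [mul_pow, Real.sq_sqrt (by positivity)]
  calc _ ≤ ∑ _i : Fin m, ‖v‖ ^ 2 := by
        gcongr with i
        exact norm_le_pi_norm v i
    _ = _ := by simp

lemma cnorm_smul (r : ℝ) (v : Fin m → ℂ) : cnorm (r • v) = |r| * cnorm v := by
  simp only [cnorm, Pi.smul_apply, norm_smul, mul_pow, ← Finset.mul_sum, Real.norm_eq_abs]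
  rw [Real.sqrt_mul (by positivity), Real.sqrt_sq (abs_nonneg r)]

lemma fderiv_le_of_sub_le {f : (Fin m → ℂ) → ℝ} {K : ℝ} (hK : 0 ≤ K)
    (h : ∀ x y, f (x + y) - f x ≤ K * cnorm y) (x y : Fin m → ℂ) :
    fderiv ℝ f x y ≤ K * cnorm y := by
  by_cases hd : DifferentiableAt ℝ f x
  · have h1 : HasDerivAt (fun t : ℝ => f (x + t • y)) (fderiv ℝ f x y) 0 := by
      have := hd.hasFDerivAt.hasLineDerivAt y
      exact this
    have h2 := h1.tendsto_slope_zero_right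
    refine le_of_tendsto h2 ?_
    filter_upwards [self_mem_nhdsWithin] with t (ht : 0 < t)
    have h3 := h x (t • y)
    rw [cnorm_smul, abs_of_pos ht] at h3
    simp only [zero_add, zero_smul, add_zero, smul_eq_mul]
    rw [inv_mul_le_iff₀ ht]
    linarith
  · rw [fderiv_zero_of_not_differentiableAt hd]
    simpa using mul_nonneg hK (cnorm_nonneg y)

lemma lipschitzWith_of_sub_le {f : (Fin m → ℂ) → ℝ} {K : ℝ} (hK : 0 ≤ K)
    (h : ∀ x y, f (x + y) - f x ≤ K * cnorm y) :
    LipschitzWith (K * √m).toNNReal f := by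
  refine LipschitzWith.of_le_add_mul _ fun x y => ?_
  rw [Real.coe_toNNReal _ (by positivity)]
  have h1 := h y (x - y)
  have h2 := mul_le_mul_of_nonneg_left (cnorm_le_sqrt_mul_norm (x - y)) hK
  rw [add_sub_cancel] at h1
  rw [dist_eq_norm, mul_assoc]
  linarith

lemma variance_fderiv_le {f : (Fin m → ℂ) → ℝ} {K : ℝ} (hK : 0 ≤ K)
    (h : ∀ x y, f (x + y) - f x ≤ K * cnorm y) (x : Fin m → ℂ) :
    Var[fderiv ℝ f x; cgaussianVec m 1] ≤ K ^ 2 :=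
  variance_dual_le_of_le_cnorm _ (fderiv_le_of_sub_le hK h x)

variable {ι κ : Type*} [Fintype ι] [DecidableEq ι] [Fintype κ] [DecidableEq κ]

/-- Moments of the norm of a matrix depending linearly on a complex Gaussian vector. -/
lemma lintegral_norm_pow_le_of_linearMap (X : (Fin m → ℂ) →ₗ[ℝ] Matrix κ ι ℂ) {K B : ℝ}
    (hK : 0 ≤ K) (hX : ∀ y, ‖X y‖ ≤ K * cnorm y) (hB : 0 ≤ B)
    (hmean : ∫ a, ‖X a‖ ∂(cgaussianVec m 1) ≤ B) (p : ℕ) (hp : p * K ^ 2 ≤ B ^ 2) :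
    ∫⁻ a, ENNReal.ofReal ‖X a‖ ^ p ∂(cgaussianVec m 1) ≤ ENNReal.ofReal (Real.exp 3 * B) ^ p := by
  have hsub : ∀ x y, ‖X (x + y)‖ - ‖X x‖ ≤ K * cnorm y := fun x y => by
    have := norm_add_le (X x) (X y)
    rw [map_add]; linarith [hX y]
  have hlip := lipschitzWith_of_sub_le (f := fun a => ‖X a‖) hK hsub
  have key : ∀ t > (0 : ℝ), ∫⁻ a, ENNReal.ofReal ‖X a‖ ^ p ∂(cgaussianVec m 1) ≤
      ENNReal.ofReal (Real.exp 3 * (B + t)) ^ p := fun t ht =>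
    lintegral_pow_le_of_lipschitz (integral_id_cgaussianVec 1) hlip (fun _ => norm_nonneg _)
      (ae_differentiableAt_cgaussianVec hlip) (variance_fderiv_le (f := fun a => ‖X a‖) hK hsub)
      (by positivity) p (by linarith) (by nlinarith)
  have hc : Continuous fun t : ℝ => ENNReal.ofReal (Real.exp 3 * (B + t)) ^ p :=
    (ENNReal.continuous_pow p).comp (ENNReal.continuous_ofReal.comp (by fun_prop))
  have ht : Filter.Tendsto (fun t : ℝ => ENNReal.ofReal (Real.exp 3 * (B + t)) ^ p)
      (nhdsWithin 0 (Set.Ioi 0)) (nhds (ENNReal.ofReal (Real.exp 3 * (B + 0)) ^ p)) :=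
    (hc.tendsto 0).mono_left nhdsWithin_le_nhds
  rw [add_zero] at ht
  refine ge_of_tendsto ht ?_
  filter_upwards [self_mem_nhdsWithin] with t ht using key t ht

lemma integral_norm_sum_mul_sq {π : ι → Fin m} (hπ : Function.Injective π) (c : ι → ℂ) :
    Integrable (fun a : Fin m → ℂ => ‖∑ j, c j * a (π j)‖ ^ 2) (cgaussianVec m 1) ∧
    ∫ a, ‖∑ j, c j * a (π j)‖ ^ 2 ∂(cgaussianVec m 1) = ∑ j, ‖c j‖ ^ 2 := by
  set c' : Fin m → ℂ := fun i => ∑ j, if π j = i then c j else 0 with hc'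
  have e : ∀ a : Fin m → ℂ, ∑ j, c j * a (π j) = c' ⬝ᵥ a := by
    intro a
    simp only [dotProduct, hc', Finset.sum_mul, ite_mul, zero_mul]
    rw [Finset.sum_comm]
    simp
  have e2 : ∀ j, c' (π j) = c j := by
    intro j
    simp only [hc', hπ.eq_iff]
    simp
  have e3 : ∑ i, c' i * starRingEnd ℂ (c' i) = ((∑ j, ‖c j‖ ^ 2 : ℝ) : ℂ) := by
    have : ∑ i, c' i * starRingEnd ℂ (c' i) = ∑ j, c j * starRingEnd ℂ (c j) := by
      calc _ = ∑ i, (∑ j, if π j = i then c j else 0) * starRingEnd ℂ (c' i) := rfl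
        _ = ∑ j, c j * starRingEnd ℂ (c' (π j)) := by
          simp only [Finset.sum_mul, ite_mul, zero_mul]
          rw [Finset.sum_comm]
          simp
        _ = _ := by simp only [e2]
    rw [this]
    push_cast
    exact Finset.sum_congr rfl fun j _ => Complex.mul_conj' _
  have e4 : ∀ a : Fin m → ℂ, ((‖c' ⬝ᵥ a‖ ^ 2 : ℝ) : ℂ) =
      (c' ⬝ᵥ a) * starRingEnd ℂ (c' ⬝ᵥ a) := fun a => by
    rw [Complex.mul_conj']; push_cast; rfl
  simp only [e]
  have h1 := integrable_dotProduct_mul_conj c' c'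
  have h2 := integral_dotProduct_mul_conj c' c'
  simp only [← e4, e3] at h1 h2
  rw [integral_complex_ofReal] at h2
  have h3 := h1.re
  simp only [RCLike.re_eq_complex_re, ofReal_re] at h3
  exact ⟨h3, by exact_mod_cast h2⟩

/-- The matrix with entries `d k j * a (π k j)`, as a linear function of `a`. -/
def entryMap (d : κ → ι → ℂ) (π : κ → ι → Fin m) : (Fin m → ℂ) →ₗ[ℝ] Matrix κ ι ℂ where
  toFun a := Matrix.of fun k j => d k j * a (π k j)
  map_add' a b := by ext; simp [mul_add]
  map_smul' r a := by ext; simp; ring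

lemma sum_comp_le {π : κ → Fin m} (hπ : Function.Injective π) (f : Fin m → ℝ) (hf : ∀ i, 0 ≤ f i) :
    ∑ k, f (π k) ≤ ∑ i, f i := by
  calc _ = ∑ i ∈ Finset.univ.map ⟨π, hπ⟩, f i := (Finset.sum_map _ _ _).symm
    _ ≤ _ := Finset.sum_le_sum_of_subset_of_nonneg (Finset.subset_univ _) fun i _ _ => hf i

lemma norm_entryMap_le {d : κ → ι → ℂ} {π : κ → ι → Fin m} (hd : ∀ k j, ‖d k j‖ ≤ 1)
    (h1 : ∀ j, Function.Injective fun k => π k j) (a : Fin m → ℂ) :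
    ‖entryMap d π a‖ ≤ √(Fintype.card ι) * cnorm a := by
  have := cnorm_nonneg a
  refine l2_opNorm_le_of_sum_norm_sq_le _ (by positivity) fun w => ?_
  rw [mul_pow, Real.sq_sqrt (by positivity), cnorm_sq]
  calc _ ≤ ∑ k, (∑ j, ‖a (π k j)‖ ^ 2) * ∑ j, ‖w j‖ ^ 2 := by
        gcongr with k _
        calc _ ≤ (∑ j, ‖a (π k j)‖ * ‖w j‖) ^ 2 := by
              gcongr
              refine (norm_sum_le _ _).trans ?_
              gcongr with j _
              simp only [entryMap, LinearMap.coe_mk, AddHom.coe_mk, of_apply, norm_mul]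
              gcongr
              exact mul_le_of_le_one_left (norm_nonneg _) (hd k j)
          _ ≤ _ := Finset.sum_mul_sq_le_sq_mul_sq _ _ _
    _ = (∑ j, ∑ k, ‖a (π k j)‖ ^ 2) * ∑ j, ‖w j‖ ^ 2 := by
        rw [← Finset.sum_mul, Finset.sum_comm]
    _ ≤ (∑ _j : ι, ∑ i, ‖a i‖ ^ 2) * ∑ j, ‖w j‖ ^ 2 := by
        gcongr with j _
        exact sum_comp_le (h1 j) (fun i => ‖a i‖ ^ 2) fun i => by positivity
    _ = _ := by simp

lemma integral_entryMap_mulVec_le {d : κ → ι → ℂ} {π : κ → ι → Fin m} (hd : ∀ k j, ‖d k j‖ ≤ 1)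
    (h2 : ∀ k, Function.Injective (π k)) (ξ : ι → ℂ) :
    ∫ a, ∑ k, ‖(entryMap d π a *ᵥ ξ) k‖ ^ 2 ∂(cgaussianVec m 1) ≤
      Fintype.card κ * ∑ j, ‖ξ j‖ ^ 2 := by
  have e : ∀ a k, (entryMap d π a *ᵥ ξ) k = ∑ j, (d k j * ξ j) * a (π k j) := fun a k => by
    simp only [entryMap, LinearMap.coe_mk, AddHom.coe_mk, mulVec, dotProduct, of_apply]
    exact Finset.sum_congr rfl fun j _ => by ring
  simp only [e]
  rw [integral_finsetSum _ fun k _ => (integral_norm_sum_mul_sq (h2 k) _).1]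
  calc _ = ∑ k, ∑ j, ‖d k j * ξ j‖ ^ 2 :=
        Finset.sum_congr rfl fun k _ => (integral_norm_sum_mul_sq (h2 k) _).2
    _ ≤ ∑ _k : κ, ∑ j, ‖ξ j‖ ^ 2 := by
        gcongr with k _ j _
        rw [norm_mul]
        exact mul_le_of_le_one_left (norm_nonneg _) (hd k j)
    _ = _ := by simp

lemma integral_entryMap_conjTranspose_mulVec_le {d : κ → ι → ℂ} {π : κ → ι → Fin m}
    (hd : ∀ k j, ‖d k j‖ ≤ 1) (h1 : ∀ j, Function.Injective fun k => π k j) (ξ : κ → ℂ) :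
    ∫ a, ∑ k, ‖((entryMap d π a)ᴴ *ᵥ ξ) k‖ ^ 2 ∂(cgaussianVec m 1) ≤
      Fintype.card ι * ∑ j, ‖ξ j‖ ^ 2 := by
  have h := integral_entryMap_mulVec_le (d := fun j k => d k j) (π := fun j k => π k j)
    (fun j k => hd k j) h1 (star ξ)
  have e : ∀ a k, ‖((entryMap d π a)ᴴ *ᵥ ξ) k‖ =
      ‖(entryMap (fun j k => d k j) (fun j k => π k j) a *ᵥ star ξ) k‖ := fun a k => by
    rw [← norm_star]
    congr 1
    simp [mulVec, dotProduct, entryMap, star_sum]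
  simp only [e]
  simpa using h

/-- Moment bound for the norm of a Gaussian matrix of circulant type. -/
lemma lintegral_norm_entryMap_pow_le [Nonempty ι] {d : κ → ι → ℂ} {π : κ → ι → Fin m}
    (hd : ∀ k j, ‖d k j‖ ≤ 1) (h1 : ∀ j, Function.Injective fun k => π k j)
    (h2 : ∀ k, Function.Injective (π k)) (hm : Fintype.card κ ≤ m) (hn : Fintype.card ι ≤ m)
    {q : ℕ} (hq0 : q ≠ 0) (hq : (2 * m : ℝ) ≤ Real.exp q) (p : ℕ)
    (hp : p * Fintype.card ι ≤ m) :
    ∫⁻ a, ENNReal.ofReal ‖entryMap d π a‖ ^ p ∂(cgaussianVec m 1) ≤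
      ENNReal.ofReal (Real.exp 3 * (4 * √(q * m))) ^ p := by
  have hm' : (Fintype.card κ : ℝ) ≤ m := by exact_mod_cast hm
  have hn' : (Fintype.card ι : ℝ) ≤ m := by exact_mod_cast hn
  have hq1 : (1 : ℝ) ≤ q := by exact_mod_cast Nat.one_le_iff_ne_zero.2 hq0
  refine lintegral_norm_pow_le_of_linearMap _ (by positivity) (norm_entryMap_le hd h1)
    (by positivity) ?_ p ?_
  · refine integral_norm_linearMap_le (integral_id_cgaussianVec 1) _ (by positivity)
      (fun ξ => (integral_entryMap_mulVec_le hd h2 ξ).trans (by gcongr))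
      (fun ξ => (integral_entryMap_conjTranspose_mulVec_le hd h1 ξ).trans (by gcongr)) hq0
      (by linarith)
  · rw [mul_pow, Real.sq_sqrt (by positivity), Real.sq_sqrt (by positivity)]
    have : (p * Fintype.card ι : ℝ) ≤ m := by exact_mod_cast hp
    nlinarith [(Nat.cast_nonneg m : (0 : ℝ) ≤ m)]

end LinearMatrixModel

section DecoupledChaos

open scoped Matrix.Norms.L2Operator

variable {m n : ℕ}

lemma Amat_eq_entryMap [NeZero m] (h : n ≤ m) (a : Fin m → ℂ) :
    Amat h a = entryMap (fun _ _ => 1) (fun k j => k - Fin.castLE h j) a := by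
  ext i j
  simp [Amat, entryMap, circulant_apply]

lemma castLE_injective (h : n ≤ m) : Function.Injective (Fin.castLE h) :=
  fun _ _ => by simp

lemma sub_castLE_injective [NeZero m] (h : n ≤ m) (k : Fin m) :
    Function.Injective fun j : Fin n => k - Fin.castLE h j :=
  fun _ _ hij => castLE_injective h (sub_right_injective hij)

lemma norm_Amat_le [NeZero m] (h : n ≤ m) (a : Fin m → ℂ) : ‖Amat h a‖ ≤ √n * cnorm a := by
  rw [Amat_eq_entryMap]
  simpa using norm_entryMap_le (d := fun _ _ => (1 : ℂ)) (π := fun k j => k - Fin.castLE h j)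
    (by simp) (fun j => sub_left_injective) a

lemma Amat_add (h : n ≤ m) (a b : Fin m → ℂ) : Amat h (a + b) = Amat h a + Amat h b := by
  ext i j; simp [Amat, circulant_apply]

lemma Amat_smul (h : n ≤ m) (r : ℝ) (a : Fin m → ℂ) : Amat h (r • a) = r • Amat h a := by
  ext i j; simp [Amat, circulant_apply]

/-- The real-linear map `a ↦ A_aᴴ M`. -/
def conjMulMap (h : n ≤ m) (M : Matrix (Fin m) (Fin n) ℂ) :
    (Fin m → ℂ) →ₗ[ℝ] Matrix (Fin n) (Fin n) ℂ where
  toFun a := (Amat h a)ᴴ * M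
  map_add' a b := by simp [Amat_add, Matrix.add_mul]
  map_smul' r a := by simp [Amat_smul, conjTranspose_smul]

/-- The matrix with entries `M (r + j) l`. -/
def shiftMat (h : n ≤ m) [NeZero m] (M : Matrix (Fin m) (Fin n) ℂ) (l : Fin n) :
    Matrix (Fin m) (Fin n) ℂ := Matrix.of fun r j => M (r + Fin.castLE h j) l

lemma norm_conjMulMap_le [NeZero m] (h : n ≤ m) (M : Matrix (Fin m) (Fin n) ℂ) (a : Fin m → ℂ) :
    ‖conjMulMap h M a‖ ≤ √n * ‖M‖ * cnorm a := by
  calc _ ≤ ‖(Amat h a)ᴴ‖ * ‖M‖ := l2_opNorm_mul _ _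
    _ ≤ √n * cnorm a * ‖M‖ := by
        rw [l2_opNorm_conjTranspose]
        gcongr
        exact norm_Amat_le h a
    _ = _ := by ring

lemma integral_conjMulMap_mulVec_le [NeZero m] (h : n ≤ m) (M : Matrix (Fin m) (Fin n) ℂ)
    (ξ : Fin n → ℂ) :
    ∫ a, ∑ i, ‖(conjMulMap h M a *ᵥ ξ) i‖ ^ 2 ∂(cgaussianVec m 1) ≤
      n * ‖M‖ ^ 2 * ∑ i, ‖ξ i‖ ^ 2 := by
  have h1 := integral_entryMap_conjTranspose_mulVec_le (d := fun _ _ => (1 : ℂ))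
    (π := fun k j => k - Fin.castLE h j) (by simp) (fun j => sub_left_injective) (M *ᵥ ξ)
  simp only [← Amat_eq_entryMap, mulVec_mulVec, Fintype.card_fin] at h1
  calc _ ≤ _ := h1
    _ ≤ n * (‖M‖ ^ 2 * ∑ i, ‖ξ i‖ ^ 2) := by
        gcongr
        exact sum_norm_sq_mulVec_le M ξ
    _ = _ := by ring

lemma integral_conjMulMap_conjTranspose_mulVec_le [NeZero m] (h : n ≤ m)
    (M : Matrix (Fin m) (Fin n) ℂ) (ξ : Fin n → ℂ) :
    ∫ a, ∑ i, ‖((conjMulMap h M a)ᴴ *ᵥ ξ) i‖ ^ 2 ∂(cgaussianVec m 1) ≤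
      (∑ l, ‖shiftMat h M l‖ ^ 2) * ∑ i, ‖ξ i‖ ^ 2 := by
  have e : ∀ a l, ((conjMulMap h M a)ᴴ *ᵥ ξ) l =
      ∑ r, star ((shiftMat h M l *ᵥ star ξ) r) * a (id r) := by
    intro a l
    have h1 : ((conjMulMap h M a)ᴴ *ᵥ ξ) l =
        ∑ j, ξ j * ∑ k, star (M k l) * a (k - Fin.castLE h j) := by
      simp [conjMulMap, mulVec, dotProduct, mul_apply, Amat, circulant_apply, mul_comm]
    have h2 : ∀ j : Fin n, ∑ k, star (M k l) * a (k - Fin.castLE h j) =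
        ∑ r, star (M (r + Fin.castLE h j) l) * a r := fun j => by
      rw [← Equiv.sum_comp (Equiv.addRight (Fin.castLE h j))
        fun k => star (M k l) * a (k - Fin.castLE h j)]
      simp
    rw [h1]
    simp only [h2, id, shiftMat, mulVec, dotProduct, of_apply, star_sum, Finset.sum_mul,
      Finset.mul_sum]
    rw [Finset.sum_comm]
    refine Finset.sum_congr rfl fun r _ => Finset.sum_congr rfl fun j _ => ?_
    simp
    ring
  simp only [e]
  rw [integral_finsetSum _ fun l _ => (integral_norm_sum_mul_sq Function.injective_id _).1,
    Finset.sum_mul]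
  refine Finset.sum_le_sum fun l _ => ?_
  rw [(integral_norm_sum_mul_sq Function.injective_id _).2]
  simpa using sum_norm_sq_mulVec_le (shiftMat h M l) (star ξ)

lemma lintegral_norm_conjMulMap_pow_le [NeZero m] [NeZero n] (h : n ≤ m)
    (M : Matrix (Fin m) (Fin n) ℂ) {q : ℕ} (hq0 : q ≠ 0) (hq : (2 * n : ℝ) ≤ Real.exp q) (p : ℕ) :
    ∫⁻ a, ENNReal.ofReal ‖conjMulMap h M a‖ ^ p ∂(cgaussianVec m 1) ≤
      ENNReal.ofReal (Real.exp 3 *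
        (4 * √(q * (n * ‖M‖ ^ 2 + ∑ l, ‖shiftMat h M l‖ ^ 2)) + √(p * n) * ‖M‖)) ^ p := by
  have hS : 0 ≤ ∑ l, ‖shiftMat h M l‖ ^ 2 := by positivity
  have hS' : 0 ≤ n * ‖M‖ ^ 2 := by positivity
  refine lintegral_norm_pow_le_of_linearMap _ (K := √n * ‖M‖) (by positivity)
    (norm_conjMulMap_le h M) (by positivity) ?_ p ?_
  · have h1 : 0 ≤ √(p * n) * ‖M‖ := by positivity
    have := integral_norm_linearMap_le (integral_id_cgaussianVec (m := m) 1) (conjMulMap h M)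
      (v := n * ‖M‖ ^ 2 + ∑ l, ‖shiftMat h M l‖ ^ 2) (by positivity)
      (fun ξ => (integral_conjMulMap_mulVec_le h M ξ).trans (by gcongr; linarith))
      (fun ξ => (integral_conjMulMap_conjTranspose_mulVec_le h M ξ).trans (by gcongr; linarith))
      hq0 (by simpa [two_mul] using hq)
    linarith
  · calc (p * (√n * ‖M‖) ^ 2 : ℝ) = (√(p * n) * ‖M‖) ^ 2 := by
          rw [mul_pow, mul_pow, Real.sq_sqrt (by positivity), Real.sq_sqrt (by positivity)]; ring
      _ ≤ _ := by
          gcongr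
          linarith [Real.sqrt_nonneg (q * (n * ‖M‖ ^ 2 + ∑ l, ‖shiftMat h M l‖ ^ 2))]

lemma weighted_sum_pow_le [NeZero n] {α β u : ℝ} (hα : 0 ≤ α) (hβ : 0 ≤ β) (hu : 0 ≤ u)
    {v : Fin n → ℝ} (hv : ∀ l, 0 ≤ v l) (s : ℕ) :
    (α * u + β * ∑ l, v l) ^ s ≤
      2⁻¹ * (2 * α * u) ^ s + (2 * n : ℝ)⁻¹ * ∑ l, (2 * (n * β) * v l) ^ s := by
  have hn : (n : ℝ) ≠ 0 := by exact_mod_cast NeZero.ne n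
  have := Real.pow_arith_mean_le_arith_mean_pow (Finset.univ : Finset (Fin n ⊕ Fin n))
    (fun _ => (2 * n : ℝ)⁻¹) (Sum.elim (fun _ => 2 * α * u) fun l => 2 * (n * β) * v l)
    (fun _ _ => by positivity) (by simp; field_simp; norm_num)
    (fun i _ => by
      rcases i with i | i
      · simp only [Sum.elim_inl]; positivity
      · have := hv i; simp only [Sum.elim_inr]; positivity) s
  simp only [Fintype.sum_sum_type, Sum.elim_inl, Sum.elim_inr, Finset.sum_const, Finset.card_univ,
    Fintype.card_fin, nsmul_eq_mul] at this
  convert this using 2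
  · rw [← Finset.mul_sum, ← Finset.mul_sum]
    field_simp
  · field_simp
  · rw [Finset.mul_sum]

/-- Moments of a decoupled quadratic chaos with circulant structure. -/
lemma lintegral_lintegral_norm_chaos_pow_le [NeZero m] [NeZero n] (h : n ≤ m) {D : Fin m → ℂ}
    (hD : ∀ k, ‖D k‖ ≤ 1) {q q' : ℕ} (hq0 : q ≠ 0) (hq : (2 * n : ℝ) ≤ Real.exp q)
    (hq0' : q' ≠ 0) (hq' : (2 * m : ℝ) ≤ Real.exp q') (s : ℕ) (hs : 2 * s * n ≤ m) {T : ℝ}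
    (hT0 : 0 ≤ T)
    (hT : ∫⁻ a, ENNReal.ofReal ‖Amat h a‖ ^ (2 * s) ∂(cgaussianVec m 1) ≤
      ENNReal.ofReal T ^ (2 * s)) :
    ∫⁻ a', ∫⁻ a, ENNReal.ofReal ‖(Amat h a)ᴴ * (diagonal D * Amat h a')‖ ^ (2 * s)
        ∂(cgaussianVec m 1) ∂(cgaussianVec m 1) ≤
      ENNReal.ofReal (Real.exp 3 * √(2 * (32 * q * n + 2 * (2 * s) * n) * T ^ 2 +
        2 * (n * (32 * q)) * (Real.exp 3 * (4 * √(q' * m))) ^ 2)) ^ (2 * s) := by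
  set T1 := Real.exp 3 * (4 * √(q' * m)) with hT1
  set α : ℝ := 32 * q * n + 2 * (2 * s) * n with hα
  set b : Fin n → (Fin m → ℂ) → Matrix (Fin m) (Fin n) ℂ := fun l =>
    entryMap (fun r j => D (r + Fin.castLE h j)) (fun r j => r + Fin.castLE h j - Fin.castLE h l)
    with hb
  have hbs : ∀ a l, shiftMat h (diagonal D * Amat h a) l = b l a := fun a l => by
    ext r j
    simp [shiftMat, hb, entryMap, diagonal_mul, Amat, circulant_apply]
  have hbT : ∀ l, ∫⁻ a, ENNReal.ofReal ‖b l a‖ ^ (2 * s) ∂(cgaussianVec m 1) ≤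
      ENNReal.ofReal T1 ^ (2 * s) := fun l =>
    lintegral_norm_entryMap_pow_le (fun _ _ => hD _)
      (fun j r r' hr => by simpa using hr)
      (fun r j j' hj => castLE_injective h (by simpa using hj))
      (by simp) (by simpa using h) hq0' hq' _ (by simpa using hs)
  have hMA : ∀ a, ‖diagonal D * Amat h a‖ ≤ ‖Amat h a‖ := fun a => by
    refine (l2_opNorm_mul _ _).trans (mul_le_of_le_one_left (norm_nonneg _) ?_)
    rw [l2_opNorm_diagonal]
    exact (pi_norm_le_iff_of_nonneg zero_le_one).2 hD
  set R : ℝ := Real.exp 3 ^ 2 * (2 * α * T ^ 2 + 2 * (n * (32 * q)) * T1 ^ 2) with hR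
  have hα0 : 0 ≤ α := by positivity
  have hpt : ∀ a', ∫⁻ a, ENNReal.ofReal ‖(Amat h a)ᴴ * (diagonal D * Amat h a')‖ ^ (2 * s)
        ∂(cgaussianVec m 1) ≤ ENNReal.ofReal (2⁻¹ * (Real.exp 3 ^ 2 * (2 * α)) ^ s) *
          ENNReal.ofReal ‖Amat h a'‖ ^ (2 * s) +
        ENNReal.ofReal ((2 * n : ℝ)⁻¹ * (Real.exp 3 ^ 2 * (2 * (n * (32 * q)))) ^ s) *
          ∑ l, ENNReal.ofReal ‖b l a'‖ ^ (2 * s) := by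
    intro a'
    have h1 := lintegral_norm_conjMulMap_pow_le h (diagonal D * Amat h a') hq0 hq (2 * s)
    simp only [hbs] at h1
    refine h1.trans ?_
    have hS : 0 ≤ ∑ l, ‖b l a'‖ ^ 2 := by positivity
    have e1 : ∀ x : ℝ, 0 ≤ x → ENNReal.ofReal x ^ (2 * s) = ENNReal.ofReal (x ^ (2 * s)) :=
      fun x hx => (ENNReal.ofReal_pow hx _).symm
    rw [e1 _ (by positivity), e1 _ (norm_nonneg _)]
    simp only [e1 _ (norm_nonneg _)]
    rw [← ENNReal.ofReal_sum_of_nonneg fun _ _ => by positivity,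
      ← ENNReal.ofReal_mul (by positivity), ← ENNReal.ofReal_mul (by positivity),
      ← ENNReal.ofReal_add (by positivity) (by positivity)]
    refine ENNReal.ofReal_le_ofReal ?_
    have h2 : (4 * √(q * (n * ‖diagonal D * Amat h a'‖ ^ 2 + ∑ l, ‖b l a'‖ ^ 2)) +
        √((2 * s : ℕ) * n) * ‖diagonal D * Amat h a'‖) ^ 2 ≤
        α * ‖Amat h a'‖ ^ 2 + 32 * q * ∑ l, ‖b l a'‖ ^ 2 := by
      refine (add_sq_le).trans ?_
      rw [mul_pow, mul_pow, Real.sq_sqrt (by positivity), Real.sq_sqrt (by positivity)]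
      have h3 : α * ‖diagonal D * Amat h a'‖ ^ 2 ≤ α * ‖Amat h a'‖ ^ 2 := by
        gcongr
        exact hMA a'
      refine le_trans (le_of_eq ?_) (add_le_add_left h3 _)
      rw [hα]
      push_cast
      ring
    rw [pow_mul, mul_pow, mul_pow]
    calc _ ≤ (Real.exp 3 ^ 2) ^ s * (α * ‖Amat h a'‖ ^ 2 + 32 * q * ∑ l, ‖b l a'‖ ^ 2) ^ s := by
          gcongr
      _ ≤ (Real.exp 3 ^ 2) ^ s * (2⁻¹ * (2 * α * ‖Amat h a'‖ ^ 2) ^ s +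
          (2 * n : ℝ)⁻¹ * ∑ l, (2 * (n * (32 * q)) * ‖b l a'‖ ^ 2) ^ s) := by
          gcongr
          exact weighted_sum_pow_le hα0 (by positivity) (by positivity) (fun l => by positivity) s
      _ = _ := by
          simp only [mul_pow _ (_ ^ 2), ← pow_mul, ← Finset.mul_sum]
          ring_nf
  have hc : ∀ l, Measurable fun a => ENNReal.ofReal ‖b l a‖ ^ (2 * s) := fun l =>
    ((entryMap (fun r j => D (r + Fin.castLE h j)) (fun r j => r + Fin.castLE h j -
      Fin.castLE h l)).continuous_of_finiteDimensional.norm.measurable.ennreal_ofReal).pow_const _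
  have hcA : Measurable fun a => ENNReal.ofReal ‖Amat h a‖ ^ (2 * s) := by
    simp only [Amat_eq_entryMap]
    exact ((entryMap _ _).continuous_of_finiteDimensional.norm.measurable.ennreal_ofReal).pow_const _
  refine (lintegral_mono hpt).trans ?_
  rw [lintegral_add_left (hcA.const_mul _), lintegral_const_mul _ hcA,
    lintegral_const_mul _ (Finset.measurable_sum _ fun l _ => hc l),
    lintegral_finsetSum _ fun l _ => hc l]
  have hn : (n : ℝ) ≠ 0 := by exact_mod_cast NeZero.ne n
  calc _ ≤ ENNReal.ofReal (2⁻¹ * (Real.exp 3 ^ 2 * (2 * α)) ^ s) * ENNReal.ofReal T ^ (2 * s) +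
        ENNReal.ofReal ((2 * n : ℝ)⁻¹ * (Real.exp 3 ^ 2 * (2 * (n * (32 * q)))) ^ s) *
          ∑ _l : Fin n, ENNReal.ofReal T1 ^ (2 * s) := by
        gcongr with l _
        exact hbT l
    _ = ENNReal.ofReal (2⁻¹ * (Real.exp 3 ^ 2 * (2 * α) * T ^ 2) ^ s +
        2⁻¹ * (Real.exp 3 ^ 2 * (2 * (n * (32 * q))) * T1 ^ 2) ^ s) := by
        rw [← ENNReal.ofReal_pow hT0, ← ENNReal.ofReal_pow (by positivity),
          ← ENNReal.ofReal_sum_of_nonneg fun _ _ => by positivity,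
          ← ENNReal.ofReal_mul (by positivity), ← ENNReal.ofReal_mul (by positivity),
          ← ENNReal.ofReal_add (by positivity) (by positivity)]
        congr 1
        simp only [Finset.sum_const, Finset.card_univ, Fintype.card_fin, nsmul_eq_mul,
          mul_pow _ (_ ^ 2), ← pow_mul]
        field_simp
    _ ≤ ENNReal.ofReal (2⁻¹ * R ^ s + 2⁻¹ * R ^ s) := by
        refine ENNReal.ofReal_le_ofReal ?_
        have h1 : 0 ≤ Real.exp 3 ^ 2 * (2 * α) * T ^ 2 := by positivity
        have h2 : 0 ≤ Real.exp 3 ^ 2 * (2 * (n * (32 * q))) * T1 ^ 2 := by positivity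
        gcongr
        · rw [hR]; linarith
        · rw [hR]; linarith
    _ = _ := by
        have h1 : R = (Real.exp 3 * √(2 * α * T ^ 2 + 2 * (n * (32 * q)) * T1 ^ 2)) ^ 2 := by
          rw [mul_pow, Real.sq_sqrt (by positivity)]
        rw [← ENNReal.ofReal_pow (by positivity), pow_mul, ← h1]
        congr 1
        ring

end DecoupledChaos

section NormMoments

open scoped Matrix.Norms.L2Operator

variable {m n : ℕ}

lemma measurePreserving_rotation_cgaussianVec (θ : ℝ) :
    MeasurePreserving (ContinuousLinearMap.rotation (E := Fin m → ℂ) θ)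
      ((cgaussianVec m 1).prod (cgaussianVec m 1)) ((cgaussianVec m 1).prod (cgaussianVec m 1)) :=
  ⟨(ContinuousLinearMap.rotation θ).continuous.measurable,
    IsGaussian.map_rotation_eq_self (integral_id_cgaussianVec 1) θ⟩

lemma continuous_Amat (h : n ≤ m) : Continuous (Amat h) :=
  continuous_matrix fun i j => by simp only [Amat, of_apply, circulant_apply]; fun_prop

lemma lintegral_ofReal_le_of_sq {Ω : Type*} [MeasurableSpace Ω] {μ : Measure Ω}
    [IsProbabilityMeasure μ] {f : Ω → ℝ} (hf : ∀ x, 0 ≤ f x) {R : ℝ} (hR : 0 < R)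
    (h : ∫⁻ x, ENNReal.ofReal (f x) ^ 2 ∂μ ≤ ENNReal.ofReal R ^ 2) :
    ∫⁻ x, ENNReal.ofReal (f x) ∂μ ≤ ENNReal.ofReal R := by
  have hc : ENNReal.ofReal (1 / (2 * R)) ≠ ∞ := ENNReal.ofReal_ne_top
  calc _ ≤ ∫⁻ x, (ENNReal.ofReal (1 / (2 * R)) * ENNReal.ofReal (f x) ^ 2 +
        ENNReal.ofReal (R / 2)) ∂μ := by
        refine lintegral_mono fun x => ?_
        rw [← ENNReal.ofReal_pow (hf x), ← ENNReal.ofReal_mul (by positivity),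
          ← ENNReal.ofReal_add (by have := hf x; positivity) (by positivity)]
        refine ENNReal.ofReal_le_ofReal ?_
        have h1 : 1 / (2 * R) * f x ^ 2 + R / 2 - f x = (f x - R) ^ 2 / (2 * R) := by
          field_simp
          ring
        have h2 : 0 ≤ (f x - R) ^ 2 / (2 * R) := by positivity
        linarith
    _ = ENNReal.ofReal (1 / (2 * R)) * (∫⁻ x, ENNReal.ofReal (f x) ^ 2 ∂μ) +
        ENNReal.ofReal (R / 2) := by
        rw [lintegral_add_right _ measurable_const, lintegral_const_mul' _ _ hc]
        simp
    _ ≤ ENNReal.ofReal (1 / (2 * R)) * ENNReal.ofReal R ^ 2 + ENNReal.ofReal (R / 2) := by gcongr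
    _ = _ := by
        rw [← ENNReal.ofReal_pow hR.le, ← ENNReal.ofReal_mul (by positivity),
          ← ENNReal.ofReal_add (by positivity) (by positivity)]
        congr 1
        field_simp
        ring

lemma integral_norm_Amat_mulVec_sq [NeZero m] (h : n ≤ m) (w : Fin n → ℂ) :
    ∫⁻ a, ENNReal.ofReal (∑ k, ‖(Amat h a *ᵥ w) k‖ ^ 2) ∂(cgaussianVec m 1) ≤
      ENNReal.ofReal (m * ∑ i, ‖w i‖ ^ 2) := by
  have hi : Integrable (fun a => ∑ k, ‖(Amat h a *ᵥ w) k‖ ^ 2) (cgaussianVec m 1) := by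
    refine integrable_finsetSum _ fun k _ => ?_
    have := (integral_norm_sum_mul_sq (sub_castLE_injective h k) w).1
    simpa [mulVec, dotProduct, Amat, circulant_apply, mul_comm] using this
  rw [← ofReal_integral_eq_lintegral_ofReal hi (ae_of_all _ fun _ => by positivity)]
  refine ENNReal.ofReal_le_ofReal ?_
  have := integral_entryMap_mulVec_le (d := fun _ _ => (1 : ℂ))
    (π := fun k j => k - Fin.castLE h j) (by simp) (sub_castLE_injective h) w
  simpa only [← Amat_eq_entryMap, Fintype.card_fin] using this

lemma Amat_rotation (h : n ≤ m) (z : (Fin m → ℂ) × (Fin m → ℂ)) :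
    (Amat h (ContinuousLinearMap.rotation (Real.pi / 4) z).1)ᴴ *
        Amat h (ContinuousLinearMap.rotation (Real.pi / 4) z).1 -
      (Amat h (ContinuousLinearMap.rotation (Real.pi / 4) z).2)ᴴ *
        Amat h (ContinuousLinearMap.rotation (Real.pi / 4) z).2 =
      (Amat h z.2)ᴴ * Amat h z.1 + ((Amat h z.2)ᴴ * Amat h z.1)ᴴ := by
  have h2 : (√2 / 2 : ℝ) * (√2 / 2) = 1 / 2 := by
    have := Real.mul_self_sqrt (show (0 : ℝ) ≤ 2 by norm_num)
    linarith
  simp only [ContinuousLinearMap.rotation_apply, Real.cos_pi_div_four, Real.sin_pi_div_four,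
    Amat_add, Amat_smul, conjTranspose_add, conjTranspose_smul, conjTranspose_mul,
    conjTranspose_conjTranspose, Matrix.add_mul, Matrix.mul_add, Matrix.smul_mul, Matrix.mul_smul,
    star_trivial]
  match_scalars <;> linarith

/-- Symmetrisation: the second moment of `‖A_a‖` is controlled by a decoupled chaos. -/
lemma lintegral_norm_Amat_sq_le [NeZero m] (h : n ≤ m) :
    ∫⁻ a, ENNReal.ofReal ‖Amat h a‖ ^ 2 ∂(cgaussianVec m 1) ≤ ENNReal.ofReal m +
      2 * ∫⁻ a', ∫⁻ a, ENNReal.ofReal ‖(Amat h a)ᴴ * Amat h a'‖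
        ∂(cgaussianVec m 1) ∂(cgaussianVec m 1) := by
  set N : (Fin m → ℂ) × (Fin m → ℂ) → ℝ := fun z =>
    ‖(Amat h z.1)ᴴ * Amat h z.1 - (Amat h z.2)ᴴ * Amat h z.2‖ with hN
  have hA := continuous_Amat h
  have hAf : Continuous fun z : (Fin m → ℂ) × (Fin m → ℂ) => Amat h z.1 := hA.comp continuous_fst
  have hAs : Continuous fun z : (Fin m → ℂ) × (Fin m → ℂ) => Amat h z.2 := hA.comp continuous_snd
  have hNm : Measurable fun z => ENNReal.ofReal (N z) :=
    ((hAf.matrix_conjTranspose.matrix_mul hAf).sub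
      (hAs.matrix_conjTranspose.matrix_mul hAs)).norm.measurable.ennreal_ofReal
  have hpt : ∀ a, ENNReal.ofReal ‖Amat h a‖ ^ 2 ≤
      ENNReal.ofReal m + ∫⁻ a', ENNReal.ofReal (N (a, a')) ∂(cgaussianVec m 1) := by
    intro a
    by_cases hJ : ∫⁻ a', ENNReal.ofReal (N (a, a')) ∂(cgaussianVec m 1) = ∞
    · simp [hJ]
    set J := ∫⁻ a', ENNReal.ofReal (N (a, a')) ∂(cgaussianVec m 1) with hJdef
    have hw : ∀ w : Fin n → ℂ, ∑ k, ‖(Amat h a *ᵥ w) k‖ ^ 2 ≤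
        √(m + J.toReal) ^ 2 * ∑ i, ‖w i‖ ^ 2 := by
      intro w
      rw [Real.sq_sqrt (by positivity), ← ENNReal.ofReal_le_ofReal_iff (by positivity)]
      have hq : ∀ b, ((∑ k, ‖(Amat h b *ᵥ w) k‖ ^ 2 : ℝ) : ℂ) =
          star w ⬝ᵥ (((Amat h b)ᴴ * Amat h b) *ᵥ w) := fun b => by
        rw [← mulVec_mulVec, dotProduct_mulVec, vecMul_conjTranspose, star_star, dotProduct]
        push_cast
        exact Finset.sum_congr rfl fun k _ => (Complex.conj_mul' _).symm
      have h1 : ∀ a', ∑ k, ‖(Amat h a *ᵥ w) k‖ ^ 2 ≤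
          ∑ k, ‖(Amat h a' *ᵥ w) k‖ ^ 2 + N (a, a') * ∑ i, ‖w i‖ ^ 2 := by
        intro a'
        have h2 : ((∑ k, ‖(Amat h a *ᵥ w) k‖ ^ 2 - ∑ k, ‖(Amat h a' *ᵥ w) k‖ ^ 2 : ℝ) : ℂ) =
            star w ⬝ᵥ (((Amat h a)ᴴ * Amat h a - (Amat h a')ᴴ * Amat h a') *ᵥ w) := by
          rw [Complex.ofReal_sub, hq, hq, ← dotProduct_sub, sub_mulVec]
        set P := (Amat h a)ᴴ * Amat h a - (Amat h a')ᴴ * Amat h a' with hP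
        have h3 : ‖star w ⬝ᵥ (P *ᵥ w)‖ ≤ ‖P‖ * ∑ i, ‖w i‖ ^ 2 := by
          have h4 : ‖star w ⬝ᵥ (P *ᵥ w)‖ ^ 2 ≤ (∑ i, ‖w i‖ ^ 2) * ∑ i, ‖(P *ᵥ w) i‖ ^ 2 := by
            refine le_trans ?_ (Finset.sum_mul_sq_le_sq_mul_sq _ _ _)
            gcongr
            refine (norm_sum_le _ _).trans_eq ?_
            simp
          have h5 := sum_norm_sq_mulVec_le P w
          refine le_of_sq_le_sq (h4.trans ?_) (by positivity)
          rw [mul_pow]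
          nlinarith [show 0 ≤ ∑ i, ‖w i‖ ^ 2 by positivity]
        rw [← h2, Complex.norm_real, Real.norm_eq_abs] at h3
        linarith [le_abs_self (∑ k, ‖(Amat h a *ᵥ w) k‖ ^ 2 - ∑ k, ‖(Amat h a' *ᵥ w) k‖ ^ 2)]
      calc _ = ∫⁻ _a', ENNReal.ofReal (∑ k, ‖(Amat h a *ᵥ w) k‖ ^ 2) ∂(cgaussianVec m 1) := by simp
        _ ≤ ∫⁻ a', (ENNReal.ofReal (∑ k, ‖(Amat h a' *ᵥ w) k‖ ^ 2) +
            ENNReal.ofReal (N (a, a')) * ENNReal.ofReal (∑ i, ‖w i‖ ^ 2)) ∂(cgaussianVec m 1) := by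
          refine lintegral_mono fun a' => ?_
          rw [← ENNReal.ofReal_mul (norm_nonneg _), ← ENNReal.ofReal_add (by positivity)
            (mul_nonneg (norm_nonneg _) (by positivity))]
          exact ENNReal.ofReal_le_ofReal (h1 a')
        _ ≤ ENNReal.ofReal (m * ∑ i, ‖w i‖ ^ 2) + J * ENNReal.ofReal (∑ i, ‖w i‖ ^ 2) := by
          have hNa : Measurable fun a' => ENNReal.ofReal (N (a, a')) :=
            hNm.comp measurable_prodMk_left
          rw [lintegral_add_right _ (hNa.mul_const _),
            lintegral_mul_const' _ _ ENNReal.ofReal_ne_top]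
          gcongr
          exact integral_norm_Amat_mulVec_sq h w
        _ = _ := by
          conv_lhs => rw [← ENNReal.ofReal_toReal hJ]
          rw [← ENNReal.ofReal_mul (by positivity), ← ENNReal.ofReal_add (by positivity)
            (by positivity), add_mul]
    have h6 := l2_opNorm_le_of_sum_norm_sq_le _ (Real.sqrt_nonneg _) hw
    calc _ ≤ ENNReal.ofReal (√(m + J.toReal)) ^ 2 := by gcongr
      _ = _ := by
        rw [← ENNReal.ofReal_pow (Real.sqrt_nonneg _), Real.sq_sqrt (by positivity),
          ENNReal.ofReal_add (by positivity) (by positivity), ENNReal.ofReal_toReal hJ]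
  have hXm : Measurable fun z : (Fin m → ℂ) × (Fin m → ℂ) =>
      ENNReal.ofReal ‖(Amat h z.2)ᴴ * Amat h z.1‖ :=
    (hAs.matrix_conjTranspose.matrix_mul hAf).norm.measurable.ennreal_ofReal
  calc _ ≤ ∫⁻ a, (ENNReal.ofReal m + ∫⁻ a', ENNReal.ofReal (N (a, a')) ∂(cgaussianVec m 1))
        ∂(cgaussianVec m 1) := lintegral_mono hpt
    _ = ENNReal.ofReal m + ∫⁻ z, ENNReal.ofReal (N z)
        ∂((cgaussianVec m 1).prod (cgaussianVec m 1)) := by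
        rw [lintegral_add_left measurable_const, lintegral_prod _ hNm.aemeasurable]
        simp
    _ = ENNReal.ofReal m + ∫⁻ z, ENNReal.ofReal
        (N (ContinuousLinearMap.rotation (Real.pi / 4) z))
        ∂((cgaussianVec m 1).prod (cgaussianVec m 1)) := by
        rw [(measurePreserving_rotation_cgaussianVec (Real.pi / 4)).lintegral_comp hNm]
    _ ≤ ENNReal.ofReal m + ∫⁻ z, 2 * ENNReal.ofReal ‖(Amat h z.2)ᴴ * Amat h z.1‖
        ∂((cgaussianVec m 1).prod (cgaussianVec m 1)) := by
        gcongr with z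
        rw [show (2 : ℝ≥0∞) = ENNReal.ofReal 2 by simp, ← ENNReal.ofReal_mul (by norm_num)]
        refine ENNReal.ofReal_le_ofReal ?_
        simp only [hN]
        rw [Amat_rotation]
        refine (norm_add_le _ _).trans ?_
        rw [l2_opNorm_conjTranspose]
        linarith
    _ = _ := by
        rw [lintegral_const_mul _ hXm, lintegral_prod _ hXm.aemeasurable]

lemma sqrt_le_const_mul {x K y : ℝ} (hK : 0 ≤ K) (h : x ≤ K ^ 2 * y) : √x ≤ K * √y := by
  rw [← Real.sqrt_sq hK, ← Real.sqrt_mul (by positivity)]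
  exact Real.sqrt_le_sqrt h

lemma chaos_parameter_le {E m n q q' : ℝ} (hE : 0 ≤ E) (hn : 0 ≤ n) (hm : 0 ≤ m) (hq : 1 ≤ q)
    (hq' : 0 ≤ q') (hqq : n * q * q' ≤ m) :
    E * √(2 * (32 * q * n + 2 * (2 * (1 : ℕ)) * n) * (E * (4 * √(q' * m))) ^ 2 +
      2 * (n * (32 * q)) * (E * (4 * √(q' * m))) ^ 2) ≤ 47 * E ^ 2 * m := by
  have h1 : √(2 * (32 * q * n + 2 * (2 * (1 : ℕ)) * n) * (E * (4 * √(q' * m))) ^ 2 +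
      2 * (n * (32 * q)) * (E * (4 * √(q' * m))) ^ 2) ≤ 47 * E * m := by
    refine Real.sqrt_le_iff.2 ⟨by positivity, ?_⟩
    rw [mul_pow, mul_pow 4, Real.sq_sqrt (by positivity)]
    have h2 : n * q' ≤ n * q * q' := by
      have : n * q' * 1 ≤ n * q' * q := by gcongr
      linarith
    have h3 : 16 * E ^ 2 * m * (128 * (n * q * q') + 8 * (n * q')) ≤
        16 * E ^ 2 * m * (136 * m) := by
      gcongr
      linarith
    push_cast
    nlinarith [show 0 ≤ E ^ 2 * m ^ 2 by positivity]
  calc _ ≤ E * (47 * E * m) := by gcongr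
    _ = _ := by ring

/-- The second moment of `‖A_a‖` is of order `m`. -/
lemma lintegral_norm_Amat_sq_le_const [NeZero m] [NeZero n] (h : n ≤ m) (hnm : 2 * n ≤ m)
    {q q' : ℕ} (hq0 : q ≠ 0) (hq : (2 * n : ℝ) ≤ Real.exp q)
    (hq0' : q' ≠ 0) (hq' : (2 * m : ℝ) ≤ Real.exp q') (hqq : (n * q * q' : ℝ) ≤ m) :
    ∫⁻ a, ENNReal.ofReal ‖Amat h a‖ ^ 2 ∂(cgaussianVec m 1) ≤
      ENNReal.ofReal (10 * Real.exp 3 * √m) ^ 2 := by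
  have hm : (0 : ℝ) < m := by exact_mod_cast NeZero.pos m
  have hq1 : (1 : ℝ) ≤ q := by exact_mod_cast Nat.one_le_iff_ne_zero.2 hq0
  have hq1' : (1 : ℝ) ≤ q' := by exact_mod_cast Nat.one_le_iff_ne_zero.2 hq0'
  have hE : (1 : ℝ) ≤ Real.exp 3 := Real.one_le_exp (by norm_num)
  set T1 := Real.exp 3 * (4 * √(q' * m)) with hT1
  have hT : ∫⁻ a, ENNReal.ofReal ‖Amat h a‖ ^ (2 * 1) ∂(cgaussianVec m 1) ≤
      ENNReal.ofReal T1 ^ (2 * 1) := by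
    simp only [Amat_eq_entryMap]
    exact lintegral_norm_entryMap_pow_le (by simp) (fun j => sub_left_injective)
      (sub_castLE_injective h) (by simp) (by simpa using h) hq0' hq' _ (by simpa using hnm)
  have h1 := lintegral_lintegral_norm_chaos_pow_le h (D := fun _ => 1) (by simp) hq0 hq hq0' hq' 1
    (by simpa using hnm) (by positivity) hT
  rw [← hT1] at h1
  have hR : Real.exp 3 * √(2 * (32 * q * n + 2 * (2 * (1 : ℕ)) * n) * T1 ^ 2 +
      2 * (n * (32 * q)) * T1 ^ 2) ≤ 47 * Real.exp 3 ^ 2 * m :=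
    chaos_parameter_le (by positivity) (by positivity) hm.le hq1 (by positivity) hqq
  have e : ∀ a a', (Amat h a)ᴴ * ((diagonal fun _ => 1 : Matrix (Fin m) (Fin m) ℂ) * Amat h a') =
      (Amat h a)ᴴ * Amat h a' := fun a a' => by rw [diagonal_one, Matrix.one_mul]
  simp only [e] at h1
  have hcont : Measurable fun z : (Fin m → ℂ) × (Fin m → ℂ) =>
      ENNReal.ofReal ‖(Amat h z.2)ᴴ * Amat h z.1‖ :=
    ((((continuous_Amat h).comp continuous_snd).matrix_conjTranspose).matrix_mul
      ((continuous_Amat h).comp continuous_fst)).norm.measurable.ennreal_ofReal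
  have h3 : ∫⁻ z, ENNReal.ofReal ‖(Amat h z.2)ᴴ * Amat h z.1‖ ^ 2
      ∂((cgaussianVec m 1).prod (cgaussianVec m 1)) ≤
      ENNReal.ofReal (47 * Real.exp 3 ^ 2 * m) ^ 2 := by
    rw [lintegral_prod _ (hcont.pow_const 2).aemeasurable]
    refine h1.trans ?_
    exact pow_le_pow_left₀ (zero_le) (ENNReal.ofReal_le_ofReal hR) 2
  have h4 := lintegral_ofReal_le_of_sq (fun z => norm_nonneg _) (by positivity) h3
  rw [lintegral_prod _ hcont.aemeasurable] at h4
  refine (lintegral_norm_Amat_sq_le h).trans ?_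
  calc _ ≤ ENNReal.ofReal m + 2 * ENNReal.ofReal (47 * Real.exp 3 ^ 2 * m) := by gcongr
    _ = ENNReal.ofReal (m + 2 * (47 * Real.exp 3 ^ 2 * m)) := by
        rw [ENNReal.ofReal_add (by positivity) (by positivity),
          ENNReal.ofReal_mul (p := 2) (by norm_num)]
        simp
    _ ≤ ENNReal.ofReal ((10 * Real.exp 3 * √m) ^ 2) := by
        refine ENNReal.ofReal_le_ofReal ?_
        rw [mul_pow, Real.sq_sqrt hm.le]
        nlinarith [mul_le_mul_of_nonneg_right (one_le_pow₀ hE (n := 2)) hm.le]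
    _ = _ := ENNReal.ofReal_pow (by positivity) _

/-- Moments of `‖A_a‖` up to order `m / n`. -/
lemma lintegral_norm_Amat_pow_le [NeZero m] [NeZero n] (h : n ≤ m) (hnm : 2 * n ≤ m)
    {q q' : ℕ} (hq0 : q ≠ 0) (hq : (2 * n : ℝ) ≤ Real.exp q)
    (hq0' : q' ≠ 0) (hq' : (2 * m : ℝ) ≤ Real.exp q') (hqq : (n * q * q' : ℝ) ≤ m)
    (p : ℕ) (hp : p * n ≤ m) :
    ∫⁻ a, ENNReal.ofReal ‖Amat h a‖ ^ p ∂(cgaussianVec m 1) ≤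
      ENNReal.ofReal (10 * Real.exp 3 ^ 2 * √m) ^ p := by
  have hm : (0 : ℝ) < m := by exact_mod_cast NeZero.pos m
  have hE : (1 : ℝ) ≤ Real.exp 3 := Real.one_le_exp (by norm_num)
  have h1 := lintegral_ofReal_le_of_sq (fun a => norm_nonneg _) (by positivity)
    (lintegral_norm_Amat_sq_le_const h hnm hq0 hq hq0' hq' hqq)
  have h2 : ∫ a, ‖Amat h a‖ ∂(cgaussianVec m 1) ≤ 10 * Real.exp 3 * √m := by
    rw [integral_eq_lintegral_of_nonneg_ae (ae_of_all _ fun a => norm_nonneg _)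
      (continuous_Amat h).norm.aestronglyMeasurable]
    exact ENNReal.toReal_le_of_le_ofReal (by positivity) h1
  have h3 := norm_Amat_le h
  simp only [Amat_eq_entryMap] at h2 h3 ⊢
  refine (lintegral_norm_pow_le_of_linearMap _ (Real.sqrt_nonneg _) h3 (by positivity) h2 p
    ?_).trans_eq (by congr 2; ring)
  rw [mul_pow, Real.sq_sqrt (by positivity), Real.sq_sqrt (by positivity)]
  have : (p * n : ℝ) ≤ m := by exact_mod_cast hp
  nlinarith [mul_le_mul_of_nonneg_right (one_le_pow₀ hE (n := 2)) hm.le]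

/-- Final moment bound for the decoupled chaos. -/
lemma lintegral_norm_chaos_pow_le [NeZero m] [NeZero n] (h : n ≤ m) (hnm : 2 * n ≤ m)
    {q q' : ℕ} (hq0 : q ≠ 0) (hq : (2 * n : ℝ) ≤ Real.exp q)
    (hq0' : q' ≠ 0) (hq' : (2 * m : ℝ) ≤ Real.exp q') (hqq : (n * q * q' : ℝ) ≤ m)
    (s : ℕ) (hs : 2 * s * n ≤ m) {D : Fin m → ℂ} (hD : ∀ k, ‖D k‖ ≤ 1) :
    ∫⁻ z, ENNReal.ofReal ‖(Amat h z.1)ᴴ * (diagonal D * Amat h z.2)‖ ^ (2 * s)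
        ∂((cgaussianVec m 1).prod (cgaussianVec m 1)) ≤
      ENNReal.ofReal (87 * Real.exp 3 ^ 3 * √(m * (n * (q * q' + s)))) ^ (2 * s) := by
  have hE : (1 : ℝ) ≤ Real.exp 3 := Real.one_le_exp (by norm_num)
  have hq1 : (1 : ℝ) ≤ q := by exact_mod_cast Nat.one_le_iff_ne_zero.2 hq0
  have hq1' : (1 : ℝ) ≤ q' := by exact_mod_cast Nat.one_le_iff_ne_zero.2 hq0'
  have h1 := lintegral_lintegral_norm_chaos_pow_le h hD hq0 hq hq0' hq' s hs (by positivity)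
    (lintegral_norm_Amat_pow_le h hnm hq0 hq hq0' hq' hqq (2 * s) hs)
  have hcont : Measurable fun z : (Fin m → ℂ) × (Fin m → ℂ) =>
      ENNReal.ofReal ‖(Amat h z.2)ᴴ * (diagonal D * Amat h z.1)‖ ^ (2 * s) :=
    (((((continuous_Amat h).comp continuous_snd).matrix_conjTranspose).matrix_mul
      (continuous_const.matrix_mul ((continuous_Amat h).comp
        continuous_fst))).norm.measurable.ennreal_ofReal).pow_const _
  rw [← lintegral_prod _ hcont.aemeasurable] at h1
  rw [← lintegral_prod_swap]
  refine h1.trans ?_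
  gcongr ENNReal.ofReal ?_ ^ _
  rw [show 87 * Real.exp 3 ^ 3 * √(m * (n * (q * q' + s))) =
    Real.exp 3 * (87 * Real.exp 3 ^ 2 * √(m * (n * (q * q' + s)))) by ring]
  gcongr
  refine sqrt_le_const_mul (by positivity) ?_
  simp only [mul_pow, Real.sq_sqrt (show 0 ≤ (m : ℝ) by positivity),
    Real.sq_sqrt (show 0 ≤ (q' * m : ℝ) by positivity)]
  set E := Real.exp 3 ^ 2 with hE2
  have hE1 : 1 ≤ E := one_le_pow₀ hE
  have hx : (m * n * q : ℝ) ≤ m * n * q * q' := le_mul_of_one_le_right (by positivity) hq1'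
  have hy : 0 ≤ (m * n * s : ℝ) := by positivity
  have hz : 0 ≤ (m * n * q * q' : ℝ) := by positivity
  have hE3 : E ≤ E ^ 2 := by nlinarith
  have e1 : 2 * (32 * (q : ℝ) * n + 2 * (2 * s) * n) * (10 ^ 2 * E ^ 2 * m) +
      2 * (n * (32 * q)) * (E * (4 ^ 2 * (q' * m))) =
      6400 * E ^ 2 * (m * n * q) + 800 * E ^ 2 * (m * n * s) + 1024 * E * (m * n * q * q') := by
    ring
  have e2 : (87 ^ 2 * E ^ 2 : ℝ) * (m * (n * (q * q' + s))) =
      7569 * E ^ 2 * (m * n * q * q') + 7569 * E ^ 2 * (m * n * s) := by ring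
  have e3 : 6400 * E ^ 2 * (m * n * q) ≤ 6400 * E ^ 2 * (m * n * q * q' : ℝ) := by gcongr
  have e4 : 1024 * E * (m * n * q * q') ≤ 1024 * E ^ 2 * (m * n * q * q' : ℝ) := by gcongr
  have e5 : 0 ≤ E ^ 2 * (m * n * q * q' : ℝ) := by positivity
  have e6 : 0 ≤ E ^ 2 * (m * n * s : ℝ) := by positivity
  linarith

end NormMoments

section Transpose

open scoped Matrix.Norms.L2Operator

variable {m n : ℕ}

lemma measurePreserving_conj_cgaussian (s : ℝ) :
    MeasurePreserving (starRingEnd ℂ) (cgaussian s) (cgaussian s) := by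
  refine ⟨Complex.continuous_conj.measurable, ?_⟩
  have h1 : MeasurePreserving (Prod.map id (Neg.neg : ℝ → ℝ))
      ((gaussianReal 0 (s / 2).toNNReal).prod (gaussianReal 0 (s / 2).toNNReal))
      ((gaussianReal 0 (s / 2).toNNReal).prod (gaussianReal 0 (s / 2).toNNReal)) :=
    (MeasurePreserving.id _).prod ⟨measurable_neg, by
      have := gaussianReal_map_neg (μ := 0) (v := (s / 2).toNNReal)
      rwa [neg_zero] at this⟩
  rw [cgaussian_eq_map, Measure.map_map Complex.continuous_conj.measurable
    realProdToComplex.continuous.measurable]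
  conv_rhs => rw [← h1.map_eq, Measure.map_map realProdToComplex.continuous.measurable h1.measurable]
  congr 1 with p

lemma measurePreserving_star_cgaussianVec (s : ℝ) :
    MeasurePreserving (star : (Fin m → ℂ) → Fin m → ℂ) (cgaussianVec m s) (cgaussianVec m s) :=
  measurePreserving_pi _ _ fun _ => measurePreserving_conj_cgaussian s

lemma Amat_star (h : n ≤ m) (a : Fin m → ℂ) : (Amat h (star a))ᴴ = (Amat h a)ᵀ := by
  ext i j; simp [Amat, circulant_apply]

lemma lintegral_norm_chaos_transpose (h : n ≤ m) (D : Fin m → ℂ) (p : ℕ) :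
    ∫⁻ z, ENNReal.ofReal ‖(Amat h z.1)ᵀ * (diagonal D * Amat h z.2)‖ ^ p
        ∂((cgaussianVec m 1).prod (cgaussianVec m 1)) =
      ∫⁻ z, ENNReal.ofReal ‖(Amat h z.1)ᴴ * (diagonal D * Amat h z.2)‖ ^ p
        ∂((cgaussianVec m 1).prod (cgaussianVec m 1)) := by
  have hcont : Measurable fun z : (Fin m → ℂ) × (Fin m → ℂ) =>
      ENNReal.ofReal ‖(Amat h z.1)ᴴ * (diagonal D * Amat h z.2)‖ ^ p :=
    (((((continuous_Amat h).comp continuous_fst).matrix_conjTranspose).matrix_mul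
      (continuous_const.matrix_mul ((continuous_Amat h).comp
        continuous_snd))).norm.measurable.ennreal_ofReal).pow_const _
  rw [← ((measurePreserving_star_cgaussianVec 1).prod
    (MeasurePreserving.id (cgaussianVec m 1))).lintegral_comp hcont]
  simp only [Prod.map_fst, Prod.map_snd, Amat_star, id]

end Transpose

section DeltaLowerBound

lemma measurable_phase : Measurable phase := by
  unfold phase
  exact Measurable.ite (measurableSet_singleton 0) measurable_const (by fun_prop)

lemma measurable_psi : Measurable psi :=
  (Complex.continuous_conj.measurable.comp measurable_phase).pow_const 2

lemma norm_phase (t : ℂ) : ‖phase t‖ = 1 := by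
  unfold phase
  split_ifs with h
  · simp
  · simp [h]

lemma norm_psi (t : ℂ) : ‖psi t‖ = 1 := by
  rw [psi, norm_pow, RCLike.norm_conj, norm_phase, one_pow]

lemma zeta_nonneg {s : ℝ} (hs : 0 < s) (t : ℂ) : 0 ≤ zeta s t := by
  rw [zeta, sub_nonneg, Real.exp_le_one_iff]
  exact div_nonpos_of_nonpos_of_nonneg (by have := sq_nonneg ‖t‖; linarith) (by positivity)

lemma zeta_le_one (s : ℝ) (t : ℂ) : zeta s t ≤ 1 := by
  rw [zeta]; linarith [Real.exp_pos (-‖t‖ ^ 2 / (2 * s))]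

lemma integrable_psi_add (t : ℂ) : Integrable (fun s => psi (t + s)) (cgaussian 1) :=
  Integrable.of_bound (measurable_psi.comp (measurable_const_add t)).aestronglyMeasurable 1
    (ae_of_all _ fun _ => (norm_psi _).le)

lemma norm_hfun_le (t : ℂ) : ‖hfun t‖ ≤ 1 := by
  have := norm_integral_le_of_norm_le_const (μ := cgaussian 1) (f := fun s => psi (t + s)) (C := 1)
    (ae_of_all _ fun _ => (norm_psi _).le)
  simpa [hfun] using this

lemma psi_re (t : ℂ) : (psi t).re = 1 - 2 * t.im ^ 2 / ‖t‖ ^ 2 := by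
  rw [psi, phase]
  split_ifs with h
  · simp [h]
  · have h1 : t.re ^ 2 + t.im ^ 2 = ‖t‖ ^ 2 := by
      rw [← Complex.normSq_eq_norm_sq, Complex.normSq_apply]; ring
    have h2 : ‖t‖ ≠ 0 := by simpa using h
    rw [pow_two, Complex.mul_re, Complex.conj_re, Complex.conj_im, Complex.div_ofReal_re,
      Complex.div_ofReal_im]
    field_simp
    linarith

lemma one_sub_hfun_re (r : ℝ) :
    Integrable (fun s : ℂ => 2 * s.im ^ 2 / ‖(r : ℂ) + s‖ ^ 2) (cgaussian 1) ∧
    1 - (hfun r).re = ∫ s : ℂ, 2 * s.im ^ 2 / ‖(r : ℂ) + s‖ ^ 2 ∂(cgaussian 1) := by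
  have h1 := integrable_psi_add r
  have h3 := h1.re
  have h2 : (hfun r).re = ∫ s, (psi (r + s)).re ∂(cgaussian 1) := (integral_re h1).symm
  simp only [RCLike.re_eq_complex_re, psi_re, Complex.add_im, Complex.ofReal_im, zero_add] at h2 h3
  have h4 : Integrable (fun s : ℂ => 2 * s.im ^ 2 / ‖(r : ℂ) + s‖ ^ 2) (cgaussian 1) := by
    have := (integrable_const (1 : ℝ)).sub h3
    exact this.congr (ae_of_all _ fun s => by simp)
  refine ⟨h4, ?_⟩
  rw [h2, integral_sub (integrable_const _) h4]
  simp

lemma tendsto_hfun_re : Filter.Tendsto (fun k : ℕ => (hfun ((k : ℝ) : ℂ)).re) Filter.atTop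
    (nhds 1) := by
  have h1 : Filter.Tendsto (fun k : ℕ => ∫ s : ℂ, 2 * s.im ^ 2 / ‖((k : ℝ) : ℂ) + s‖ ^ 2
      ∂(cgaussian 1)) Filter.atTop (nhds (∫ _s : ℂ, (0 : ℝ) ∂(cgaussian 1))) := by
    refine tendsto_integral_of_dominated_convergence (fun _ => (2 : ℝ))
      (fun k => (one_sub_hfun_re k).1.aestronglyMeasurable) (integrable_const _)
      (fun k => ae_of_all _ fun s => ?_) (ae_of_all _ fun s => ?_)
    · rw [Real.norm_eq_abs, abs_of_nonneg (by positivity)]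
      refine div_le_of_le_mul₀ (by positivity) (by norm_num) ?_
      have h2 := Complex.abs_im_le_norm (((k : ℝ) : ℂ) + s)
      rw [Complex.add_im, Complex.ofReal_im, zero_add] at h2
      have h3 := sq_le_sq' (by linarith [abs_nonneg s.im, norm_nonneg (((k : ℝ) : ℂ) + s)]) h2
      rw [sq_abs] at h3
      linarith
    · refine Filter.Tendsto.div_atTop tendsto_const_nhds ?_
      refine (Filter.tendsto_pow_atTop two_ne_zero).comp ?_
      refine Filter.tendsto_atTop_mono (f := fun k : ℕ => (k : ℝ) - ‖s‖) (fun k => ?_) ?_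
      · have := norm_sub_norm_le ((k : ℝ) : ℂ) (-s)
        simpa using this
      · exact Filter.tendsto_atTop_add_const_right _ _ tendsto_natCast_atTop_atTop
  simp only [integral_zero] at h1
  have h5 := h1.const_sub 1
  simp only [← (one_sub_hfun_re _).2] at h5
  simpa using h5

lemma integral_im_sq_cgaussian : ∫ s : ℂ, s.im ^ 2 ∂(cgaussian 1) = 1 / 2 := by
  rw [integral_cgaussian]
  have h := integral_sq_gaussianReal (1 / 2 : ℝ).toNNReal
  have h1 := integral_prod_mul (μ := gaussianReal 0 (1 / 2 : ℝ).toNNReal)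
    (ν := gaussianReal 0 (1 / 2 : ℝ).toNNReal) (fun _ => (1 : ℝ)) (fun y : ℝ => y ^ 2)
  simp only [one_mul, h] at h1
  simpa using h1

lemma integral_im_sq_div_pos :
    0 < ∫ s : ℂ, 2 * s.im ^ 2 / (1 + ‖s‖) ^ 2 ∂(cgaussian 1) := by
  have hi : Integrable (fun s : ℂ => 2 * s.im ^ 2 / (1 + ‖s‖) ^ 2) (cgaussian 1) := by
    refine Integrable.of_bound
      (Measurable.div (by fun_prop) (by fun_prop)).aestronglyMeasurable 2 (ae_of_all _ fun s => ?_)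
    rw [Real.norm_eq_abs, abs_of_nonneg (by positivity)]
    refine div_le_of_le_mul₀ (by positivity) (by norm_num) ?_
    have h2 := Complex.abs_im_le_norm s
    have h3 := sq_le_sq' (by linarith [abs_nonneg s.im, norm_nonneg s]) h2
    rw [sq_abs] at h3
    nlinarith [norm_nonneg s]
  have h0 : ∀ s : ℂ, 0 ≤ 2 * s.im ^ 2 / (1 + ‖s‖) ^ 2 := fun s => by positivity
  refine lt_of_le_of_ne (integral_nonneg h0) fun h => ?_
  rw [eq_comm, integral_eq_zero_iff_of_nonneg h0 hi] at h
  have h1 : ∫ s : ℂ, s.im ^ 2 ∂(cgaussian 1) = 0 := by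
    rw [← integral_zero ℂ ℝ (μ := cgaussian 1)]
    refine integral_congr_ae ?_
    filter_upwards [h] with s hs
    have h2 : (1 + ‖s‖) ^ 2 ≠ 0 := by positivity
    simp only [Pi.zero_apply, div_eq_zero_iff, h2, or_false] at hs
    linarith
  rw [integral_im_sq_cgaussian] at h1
  norm_num at h1

lemma le_one_sub_hfun_re {r : ℝ} (hr : 0 ≤ r) :
    (∫ s : ℂ, 2 * s.im ^ 2 / (1 + ‖s‖) ^ 2 ∂(cgaussian 1)) / (r + 1) ^ 2 ≤ 1 - (hfun r).re := by
  rw [(one_sub_hfun_re r).2, ← integral_div]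
  refine integral_mono_of_nonneg (ae_of_all _ fun s => by positivity) (one_sub_hfun_re r).1
    (ae_of_all _ fun s => ?_)
  by_cases h : (r : ℂ) + s = 0
  · have : s.im = 0 := by
      have := congrArg Complex.im h
      simpa using this
    simp [this]
  · have h1 : 0 < ‖(r : ℂ) + s‖ := norm_pos_iff.2 h
    simp only
    rw [div_div]
    have h2 : ‖(r : ℂ) + s‖ ≤ (1 + ‖s‖) * (r + 1) := by
      refine (norm_add_le _ _).trans ?_
      rw [Complex.norm_real, Real.norm_eq_abs, abs_of_nonneg hr]
      nlinarith [norm_nonneg s]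
    rw [← mul_pow]
    gcongr

/-- The supremum in the definition of `DeltaInf` is bounded away from zero uniformly in `ε`. -/
lemma exists_le_DeltaInf {σ2 : ℝ} (hσ : 0 < σ2) :
    ∃ κ : ℝ, 0 < κ ∧ κ ≤ 1 ∧ ∀ ε ∈ Set.Ioo (0 : ℝ) 1, κ ≤ DeltaInf σ2 ε := by
  set c0 := ∫ s : ℂ, 2 * s.im ^ 2 / (1 + ‖s‖) ^ 2 ∂(cgaussian 1) with hc0
  have hc0pos : 0 < c0 := integral_im_sq_div_pos
  set r : ℝ := 1 + 32 * σ2 ^ 2 / c0 with hr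
  have hq : 0 < 32 * σ2 ^ 2 / c0 := by positivity
  have hr1 : 1 ≤ r := by linarith
  set g := c0 / (r + 1) ^ 2 - Real.exp (-r ^ 2 / (2 * σ2)) with hg
  have hgpos : 0 < g := by
    rw [hg, sub_pos]
    have hx : 0 < r ^ 2 / (2 * σ2) := by positivity
    have h1 := Real.quadratic_le_exp_of_nonneg hx.le
    have h2 : Real.exp (-r ^ 2 / (2 * σ2)) ≤ 8 * σ2 ^ 2 / r ^ 4 := by
      rw [neg_div, Real.exp_neg, inv_le_comm₀ (Real.exp_pos _) (by positivity)]
      calc _ = (r ^ 2 / (2 * σ2)) ^ 2 / 2 := by field_simp; norm_num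
        _ ≤ _ := by linarith
    refine h2.trans_lt ?_
    have h3 : c0 / (4 * r ^ 2) ≤ c0 / (r + 1) ^ 2 := by
      gcongr
      nlinarith
    refine lt_of_lt_of_le ?_ h3
    rw [div_lt_div_iff₀ (by positivity) (by positivity)]
    have h4 : 32 * σ2 ^ 2 < c0 * r ^ 2 := by
      have h5 : 32 * σ2 ^ 2 = c0 * (32 * σ2 ^ 2 / c0) := by field_simp
      rw [h5]
      gcongr
      nlinarith
    calc 8 * σ2 ^ 2 * (4 * r ^ 2) = 32 * σ2 ^ 2 * r ^ 2 := by ring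
      _ < c0 * r ^ 2 * r ^ 2 := by gcongr
      _ = _ := by ring
  refine ⟨min 1 (g / 2), lt_min one_pos (by positivity), min_le_left _ _, fun ε hε => ?_⟩
  refine (min_le_right _ _).trans ?_
  set S := {x : ℝ | ∃ t : ℂ, x = ‖((1 + ε : ℝ) : ℂ) * hfun t - ((zeta σ2 t : ℝ) : ℂ) * psi t‖}
    with hS
  have hbdd : BddAbove S := by
    refine ⟨3, ?_⟩
    rintro _ ⟨t, rfl⟩
    refine (norm_sub_le _ _).trans ?_
    rw [norm_mul, norm_mul, Complex.norm_real, Complex.norm_real, norm_psi, Real.norm_eq_abs,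
      Real.norm_eq_abs, abs_of_pos (by linarith [hε.1]), abs_of_nonneg (zeta_nonneg hσ t)]
    have := norm_hfun_le t
    have := zeta_le_one σ2 t
    nlinarith [hε.1, hε.2, norm_nonneg (hfun t)]
  have hre : ∀ ρ : ℝ, 0 < ρ → |(1 + ε) * (hfun ρ).re - zeta σ2 ρ| ≤ sSup S := by
    intro ρ hρ
    refine le_trans ?_ (le_csSup hbdd ⟨(ρ : ℂ), rfl⟩)
    refine le_trans (le_of_eq ?_) (Complex.abs_re_le_norm _)
    have : psi (ρ : ℂ) = 1 := by
      have : (ρ : ℂ) ≠ 0 := by exact_mod_cast hρ.ne'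
      rw [psi, phase, if_neg this, Complex.norm_real, Real.norm_eq_abs, abs_of_pos hρ, div_self this]
      simp
    rw [this, Complex.sub_re, Complex.re_ofReal_mul]
    simp
  have h1 : g - ε ≤ sSup S := by
    have h2 := hre r (by linarith)
    have h3 := le_one_sub_hfun_re (r := r) (by linarith)
    rw [← hc0] at h3
    have h4 : zeta σ2 r = 1 - Real.exp (-r ^ 2 / (2 * σ2)) := by
      rw [zeta, Complex.norm_real, Real.norm_eq_abs, sq_abs]
    have h5 := (Complex.re_le_norm _).trans (norm_hfun_le (r : ℂ))
    have h6 := neg_abs_le ((1 + ε) * (hfun r).re - zeta σ2 r)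
    nlinarith [hε.1]
  have h2 : ε ≤ sSup S := by
    have h3 : Filter.Tendsto (fun k : ℕ => (1 + ε) * (hfun ((k : ℝ) : ℂ)).re - 1) Filter.atTop
        (nhds ((1 + ε) * 1 - 1)) := (tendsto_hfun_re.const_mul _).sub_const _
    have h4 : (1 + ε) * 1 - 1 = ε := by ring
    rw [h4] at h3
    refine le_of_tendsto h3 ?_
    filter_upwards [Filter.eventually_gt_atTop 0] with k hk
    have h5 := hre k (by exact_mod_cast hk)
    linarith [zeta_le_one σ2 ((k : ℝ) : ℂ),
      le_abs_self ((1 + ε) * (hfun ((k : ℝ) : ℂ)).re - zeta σ2 ((k : ℝ) : ℂ))]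
  have h3 : DeltaInf σ2 ε = (1 + 2 * σ2) * sSup S := rfl
  rw [h3]
  nlinarith

end DeltaLowerBound

section Loss

/-- The contribution `ζ(u) Im(z e^{-iφ(u)})²` of one measurement. -/
def loss (s : ℝ) (u z : ℂ) : ℝ := zeta s u * (z * starRingEnd ℂ (phase u)).im ^ 2

lemma measurable_zeta (s : ℝ) : Measurable (zeta s) := by
  unfold zeta; fun_prop

lemma loss_eq_re (s : ℝ) (u z : ℂ) :
    loss s u z = ((zeta s u : ℂ) * (z * starRingEnd ℂ z) - zeta s u * psi u * (z * z)).re / 2 := by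
  have h1 : ∀ t : ℂ, t.im ^ 2 = (t * starRingEnd ℂ t - t * t).re / 2 := fun t => by
    simp [Complex.mul_re]; ring
  have h2 : starRingEnd ℂ (phase u) * phase u = 1 := by
    rw [Complex.conj_mul', norm_phase]; simp
  rw [loss, h1, ← mul_div_assoc, ← Complex.re_ofReal_mul]
  congr 2
  rw [map_mul, Complex.conj_conj, psi]
  linear_combination (zeta s u : ℂ) * z * starRingEnd ℂ z * h2

lemma loss_ofReal_mul (s r : ℝ) (u z : ℂ) : loss s u (r * z) = r ^ 2 * loss s u z := by
  rw [loss, loss, mul_assoc, Complex.im_ofReal_mul]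
  ring

lemma abs_zeta_sub_le {s : ℝ} (hs : 1 / 2 < s) (u v : ℂ) : |zeta s u - zeta s v| ≤ ‖u - v‖ := by
  have hs0 : 0 < s := by linarith
  have hd : ∀ r : ℝ, HasDerivAt (fun r : ℝ => 1 - Real.exp (-r ^ 2 / (2 * s)))
      (r / s * Real.exp (-r ^ 2 / (2 * s))) r := fun r => by
    have h1 : HasDerivAt (fun r : ℝ => -r ^ 2 / (2 * s)) (-(2 * r) / (2 * s)) r := by
      have := ((hasDerivAt_pow 2 r).neg).div_const (2 * s)
      simpa using this
    have := h1.exp.const_sub 1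
    refine this.congr_deriv ?_
    field_simp
  have hb : ∀ r : ℝ, |r / s * Real.exp (-r ^ 2 / (2 * s))| ≤ 1 := fun r => by
    rw [abs_mul, abs_div, abs_of_pos hs0, Real.abs_exp, neg_div, Real.exp_neg, ← div_eq_mul_inv,
      div_le_one (Real.exp_pos _)]
    refine le_trans ?_ (Real.add_one_le_exp _)
    rw [div_le_iff₀ hs0, add_mul, div_mul_eq_mul_div, mul_comm 2 s, mul_comm (r ^ 2) s,
      mul_div_mul_left _ _ hs0.ne']
    nlinarith [sq_nonneg (|r| - 1), sq_abs r]
  have hl : LipschitzWith 1 fun r : ℝ => 1 - Real.exp (-r ^ 2 / (2 * s)) :=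
    lipschitzWith_of_nnnorm_deriv_le (fun r => (hd r).differentiableAt) fun r => by
      rw [(hd r).deriv, ← NNReal.coe_le_coe, coe_nnnorm, Real.norm_eq_abs]
      exact hb r
  have h := hl.dist_le_mul ‖u‖ ‖v‖
  rw [Real.dist_eq, Real.dist_eq, NNReal.coe_one, one_mul] at h
  exact h.trans (abs_norm_sub_norm_le u v)

lemma zeta_le_norm {s : ℝ} (hs : 1 / 2 < s) (u : ℂ) : zeta s u ≤ ‖u‖ := by
  have h := abs_zeta_sub_le hs u 0
  have h0 : zeta s 0 = 0 := by simp [zeta]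
  rw [h0, sub_zero, sub_zero] at h
  exact (le_abs_self _).trans h

lemma norm_mul_phase (u : ℂ) : (‖u‖ : ℂ) * phase u = u := by
  rw [phase]
  split_ifs with h
  · simp [h]
  · have : (‖u‖ : ℂ) ≠ 0 := by simpa using h
    field_simp

lemma norm_mul_norm_phase_sub_le (u v : ℂ) : ‖u‖ * ‖phase u - phase v‖ ≤ 2 * ‖u - v‖ := by
  have h1 : (‖u‖ : ℂ) * (phase u - phase v) = (u - v) + ((‖v‖ - ‖u‖ : ℝ) : ℂ) * phase v := by
    push_cast
    linear_combination norm_mul_phase u - norm_mul_phase v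
  calc ‖u‖ * ‖phase u - phase v‖ = ‖(‖u‖ : ℂ) * (phase u - phase v)‖ := by simp
    _ ≤ ‖u - v‖ + |‖v‖ - ‖u‖| := by
        rw [h1]
        refine (norm_add_le _ _).trans ?_
        rw [norm_mul, norm_phase, Complex.norm_real, mul_one, Real.norm_eq_abs]
    _ ≤ 2 * ‖u - v‖ := by
        have := abs_norm_sub_norm_le v u
        rw [norm_sub_rev v u] at this
        linarith

lemma loss_le_loss_add {s : ℝ} (hs : 1 / 2 < s) (u v z : ℂ) :
    loss s u z ≤ loss s v z + 5 * ‖u - v‖ * ‖z‖ ^ 2 := by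
  have hb : ∀ t, |(z * starRingEnd ℂ (phase t)).im| ≤ ‖z‖ := fun t => by
    refine (Complex.abs_im_le_norm _).trans ?_
    rw [norm_mul, Complex.norm_conj, norm_phase, mul_one]
  have hd : |(z * starRingEnd ℂ (phase u)).im - (z * starRingEnd ℂ (phase v)).im| ≤
      ‖z‖ * ‖phase u - phase v‖ := by
    rw [← Complex.sub_im, ← mul_sub, ← map_sub]
    refine (Complex.abs_im_le_norm _).trans ?_
    rw [norm_mul, Complex.norm_conj]
  have h1 := (le_abs_self _).trans (abs_zeta_sub_le hs u v)
  have h2 := zeta_le_norm hs u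
  have h3 := norm_mul_norm_phase_sub_le u v
  have h0 := zeta_nonneg (show 0 < s by linarith) u
  simp only [loss]
  set A := (z * starRingEnd ℂ (phase u)).im
  set B := (z * starRingEnd ℂ (phase v)).im
  have hA := hb u
  have hB := hb v
  have h4 : A ^ 2 - B ^ 2 ≤ 2 * ‖z‖ ^ 2 * ‖phase u - phase v‖ := by
    calc A ^ 2 - B ^ 2 ≤ |(A - B) * (A + B)| := by
          refine le_trans (le_of_eq ?_) (le_abs_self _); ring
      _ ≤ (‖z‖ * ‖phase u - phase v‖) * (‖z‖ + ‖z‖) := by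
          rw [abs_mul]
          gcongr
          exact (abs_add_le _ _).trans (add_le_add hA hB)
      _ = _ := by ring
  have h5 : B ^ 2 ≤ ‖z‖ ^ 2 := by
    rw [← sq_abs]; gcongr
  have h6 : zeta s u * (A ^ 2 - B ^ 2) ≤ 4 * ‖u - v‖ * ‖z‖ ^ 2 := by
    calc _ ≤ zeta s u * (2 * ‖z‖ ^ 2 * ‖phase u - phase v‖) := by gcongr
      _ = 2 * ‖z‖ ^ 2 * (zeta s u * ‖phase u - phase v‖) := by ring
      _ ≤ 2 * ‖z‖ ^ 2 * (‖u‖ * ‖phase u - phase v‖) := by gcongr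
      _ ≤ 2 * ‖z‖ ^ 2 * (2 * ‖u - v‖) := by gcongr
      _ = _ := by ring
  have h7 : (zeta s u - zeta s v) * B ^ 2 ≤ ‖u - v‖ * ‖z‖ ^ 2 := by
    calc _ ≤ ‖u - v‖ * B ^ 2 := by gcongr
      _ ≤ _ := by gcongr
  nlinarith

/-- Decoupling identity for the expected loss at a randomly perturbed point. -/
lemma integral_loss_sub_mul {Ω : Type*} [MeasurableSpace Ω] {P : Measure Ω}
    [IsProbabilityMeasure P] {V r : Ω → ℂ} (hV : Measurable V) (hind : IndepFun V r P)
    (hr : MemLp r 2 P) (h0 : ∫ ω, r ω ∂P = 0) (h1 : ∫ ω, r ω * r ω ∂P = 0) {e : ℝ}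
    (h2 : ∫ ω, r ω * starRingEnd ℂ (r ω) ∂P = e) {s : ℝ} (hs : 0 < s) (α : ℂ) (τ : ℝ) :
    Integrable (fun ω => loss s (V ω) (α - τ * r ω)) P ∧
      ∫ ω, loss s (V ω) (α - τ * r ω) ∂P =
        ∫ ω, loss s (V ω) α ∂P + τ ^ 2 * e / 2 * ∫ ω, zeta s (V ω) ∂P := by
  have hφ1 : Measurable fun u => (zeta s u : ℂ) := Complex.measurable_ofReal.comp (measurable_zeta s)
  have hφ2 : Measurable fun u => (zeta s u : ℂ) * psi u := hφ1.mul measurable_psi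
  have hb1 : ∀ u, ‖(zeta s u : ℂ)‖ ≤ 1 := fun u => by
    rw [Complex.norm_real, Real.norm_eq_abs, abs_of_nonneg (zeta_nonneg hs u)]
    exact zeta_le_one s u
  have hb2 : ∀ u, ‖(zeta s u : ℂ) * psi u‖ ≤ 1 := fun u => by
    rw [norm_mul, norm_psi, mul_one]; exact hb1 u
  have key : ∀ (φ : ℂ → ℂ) (g : ℂ → ℂ), Measurable φ → (∀ u, ‖φ u‖ ≤ 1) → Measurable g →
      Integrable (fun ω => g (r ω)) P → Integrable (fun ω => φ (V ω) * g (r ω)) P ∧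
        ∫ ω, φ (V ω) * g (r ω) ∂P = (∫ ω, φ (V ω) ∂P) * ∫ ω, g (r ω) ∂P := by
    intro φ g hφ hb hg hi
    have hm : AEStronglyMeasurable (fun ω => φ (V ω)) P := (hφ.comp hV).aestronglyMeasurable
    refine ⟨hi.bdd_mul hm (ae_of_all _ fun ω => hb _), ?_⟩
    exact (hind.comp hφ hg).integral_fun_mul_eq_mul_integral hm hi.aestronglyMeasurable
  have hri : Integrable r P := hr.integrable (by norm_num)
  have hci : Integrable (fun ω => starRingEnd ℂ (r ω)) P :=
    hr.star.integrable (by norm_num)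
  have hrr : Integrable (fun ω => r ω * r ω) P := hr.integrable_mul hr
  have hrc : Integrable (fun ω => r ω * starRingEnd ℂ (r ω)) P := hr.integrable_mul hr.star
  have h0' : ∫ ω, starRingEnd ℂ (r ω) ∂P = 0 := by rw [integral_conj, h0, map_zero]
  have mc : Measurable (starRingEnd ℂ) := Complex.continuous_conj.measurable
  have k1 := key _ _ hφ1 hb1 measurable_id hri
  have k2 := key _ _ hφ1 hb1 mc hci
  have k3 := key _ (fun z => z * starRingEnd ℂ z) hφ1 hb1 (measurable_id.mul mc) hrc
  have k4 := key _ _ hφ2 hb2 measurable_id hri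
  have k5 := key _ (fun z => z * z) hφ2 hb2 (measurable_id.mul measurable_id) hrr
  simp only [id] at k1 k4
  rw [h0, mul_zero] at k1 k4
  rw [h0', mul_zero] at k2
  rw [h2] at k3
  rw [h1, mul_zero] at k5
  have j1 : Integrable (fun ω => (zeta s (V ω) : ℂ)) P :=
    Integrable.of_bound (hφ1.comp hV).aestronglyMeasurable 1 (ae_of_all _ fun ω => hb1 _)
  have j2 : Integrable (fun ω => (zeta s (V ω) : ℂ) * psi (V ω)) P :=
    Integrable.of_bound (hφ2.comp hV).aestronglyMeasurable 1 (ae_of_all _ fun ω => hb2 _)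
  have jα : Integrable (fun ω => (zeta s (V ω) : ℂ) * (α * starRingEnd ℂ α) -
      zeta s (V ω) * psi (V ω) * (α * α)) P := (j1.mul_const _).sub (j2.mul_const _)
  have eα : (fun ω => loss s (V ω) α) = fun ω => ((zeta s (V ω) : ℂ) * (α * starRingEnd ℂ α) -
      zeta s (V ω) * psi (V ω) * (α * α)).re / 2 := funext fun ω => loss_eq_re _ _ _
  set Z : Ω → ℂ := fun ω => (zeta s (V ω) : ℂ) * (α * starRingEnd ℂ α) -
      zeta s (V ω) * psi (V ω) * (α * α) with hZ
  set Y : Ω → ℂ := fun ω =>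
    (-(τ * starRingEnd ℂ α)) * ((zeta s (V ω) : ℂ) * r ω) +
    (-(τ * α)) * ((zeta s (V ω) : ℂ) * starRingEnd ℂ (r ω)) +
    (τ ^ 2 : ℂ) * ((zeta s (V ω) : ℂ) * (r ω * starRingEnd ℂ (r ω))) +
    (2 * τ * α) * ((zeta s (V ω) : ℂ) * psi (V ω) * r ω) +
    (-(τ ^ 2 : ℂ)) * ((zeta s (V ω) : ℂ) * psi (V ω) * (r ω * r ω)) with hY
  have e1 : (fun ω => loss s (V ω) (α - τ * r ω)) = fun ω => (Z ω + Y ω).re / 2 := by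
    funext ω
    rw [loss_eq_re]
    congr 2
    simp only [hZ, hY, map_sub, map_mul, Complex.conj_ofReal]
    ring
  have i1 := k1.1.const_mul (-(τ * starRingEnd ℂ α) : ℂ)
  have i2 := k2.1.const_mul (-(τ * α) : ℂ)
  have i3 := k3.1.const_mul (τ ^ 2 : ℂ)
  have i4 := k4.1.const_mul (2 * τ * α : ℂ)
  have i5 := k5.1.const_mul (-(τ ^ 2 : ℂ))
  have iY : Integrable Y P := (((i1.add i2).add i3).add i4).add i5
  have vY : ∫ ω, Y ω ∂P = (τ ^ 2 * e * ∫ ω, zeta s (V ω) ∂P : ℝ) := by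
    refine (integral_add (((i1.add i2).add i3).add i4) i5).trans ?_
    refine (congrArg (· + _) (integral_add ((i1.add i2).add i3) i4)).trans ?_
    refine (congrArg (· + _ + _) (integral_add (i1.add i2) i3)).trans ?_
    refine (congrArg (· + _ + _ + _) (integral_add i1 i2)).trans ?_
    simp only [integral_const_mul, k1.2, k2.2, k3.2, k4.2, k5.2]
    rw [integral_complex_ofReal]
    push_cast
    ring
  have re1 : ∫ ω, (Z ω).re ∂P = (∫ ω, Z ω ∂P).re := integral_re jα
  have re2 : ∫ ω, (Z ω + Y ω).re ∂P = (∫ ω, (Z ω + Y ω) ∂P).re := integral_re (jα.add iY)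
  have iZ : Integrable (fun ω => (Z ω + Y ω).re) P := (jα.add iY).re
  rw [e1, eα]
  refine ⟨iZ.div_const 2, ?_⟩
  rw [integral_div, integral_div, re1, re2, integral_add jα iY, vY, Complex.add_re,
    Complex.ofReal_re]
  ring

end Loss

section Measurement

open scoped Matrix.Norms.L2Operator

variable {m n : ℕ}

/-- The coefficients of the linear form `a ↦ (A_a x)_k`. -/
def rowVec (h : n ≤ m) (x : Fin n → ℂ) (k : Fin m) : Fin m → ℂ :=
  fun i => ∑ j, if k - Fin.castLE h j = i then x j else 0

lemma sum_rowVec_mul (h : n ≤ m) (x : Fin n → ℂ) (k : Fin m) (f : Fin m → ℂ) :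
    ∑ i, rowVec h x k i * f i = ∑ j, x j * f (k - Fin.castLE h j) := by
  simp only [rowVec, Finset.sum_mul, ite_mul, zero_mul]
  rw [Finset.sum_comm]
  simp

lemma Amat_mulVec_eq_dotProduct (h : n ≤ m) (x : Fin n → ℂ) (k : Fin m) (a : Fin m → ℂ) :
    (Amat h a *ᵥ x) k = rowVec h x k ⬝ᵥ a := by
  rw [dotProduct, sum_rowVec_mul]
  simp [mulVec, dotProduct, Amat, circulant_apply, mul_comm]

lemma rowVec_sub [NeZero m] (h : n ≤ m) (x : Fin n → ℂ) (k : Fin m) (j : Fin n) :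
    rowVec h x k (k - Fin.castLE h j) = x j := by
  rw [rowVec, Finset.sum_eq_single j]
  · simp
  · intro l _ hl
    rw [if_neg]
    exact fun h' => hl (sub_castLE_injective h k h')
  · simp

lemma sum_rowVec_mul_conj [NeZero m] (h : n ≤ m) (x w : Fin n → ℂ) (k : Fin m) :
    ∑ i, rowVec h x k i * starRingEnd ℂ (rowVec h w k i) = ∑ j, x j * starRingEnd ℂ (w j) := by
  rw [sum_rowVec_mul]
  simp only [rowVec_sub]

lemma sum_norm_rowVec_sq [NeZero m] (h : n ≤ m) (x : Fin n → ℂ) (k : Fin m) :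
    ∑ i, ‖rowVec h x k i‖ ^ 2 = cnorm x ^ 2 := by
  have h1 := sum_rowVec_mul_conj h x x k
  simp only [Complex.mul_conj'] at h1
  rw [cnorm_sq]
  exact_mod_cast h1

lemma measurable_Amat_mulVec (h : n ≤ m) (x : Fin n → ℂ) (k : Fin m) :
    Measurable fun a => (Amat h a *ᵥ x) k := by
  simp only [Amat_mulVec_eq_dotProduct, dotProduct]
  fun_prop

lemma integrable_zeta_comp {Ω : Type*} [MeasurableSpace Ω] {P : Measure Ω} [IsFiniteMeasure P]
    {V : Ω → ℂ} (hV : Measurable V) {s : ℝ} (hs : 0 < s) :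
    Integrable (fun ω => zeta s (V ω)) P :=
  Integrable.of_bound ((measurable_zeta s).comp hV).aestronglyMeasurable 1 (ae_of_all _ fun ω => by
    rw [Real.norm_eq_abs, abs_of_nonneg (zeta_nonneg hs _)]; exact zeta_le_one _ _)

lemma integral_zeta_Amat_mulVec [NeZero m] (h : n ≤ m) {x : Fin n → ℂ} (hx : cnorm x = 1)
    (k : Fin m) {s : ℝ} (hs : 0 < s) :
    ∫ a, zeta s ((Amat h a *ᵥ x) k) ∂(cgaussianVec m 1) = 1 / (2 * s + 1) := by
  rw [← integral_zeta_cgaussian hs, ← map_dotProduct_cgaussianVec (c := rowVec h x k)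
    (by rw [sum_norm_rowVec_sq, hx, one_pow])]
  simp only [← Amat_mulVec_eq_dotProduct]
  rw [integral_map (measurable_Amat_mulVec h x k).aemeasurable
    (measurable_zeta s).aestronglyMeasurable]

lemma sum_norm_le_sqrt_mul_cnorm (v : Fin m → ℂ) : ∑ k, ‖v k‖ ≤ √m * cnorm v := by
  rw [cnorm, ← Real.sqrt_mul (by positivity)]
  refine Real.le_sqrt_of_sq_le ?_
  simpa using sq_sum_le_card_mul_sum_sq (s := Finset.univ) (f := fun k => ‖v k‖)

lemma cnorm_Amat_mulVec_le (h : n ≤ m) (a : Fin m → ℂ) (x : Fin n → ℂ) :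
    cnorm (Amat h a *ᵥ x) ≤ ‖Amat h a‖ * cnorm x := by
  refine le_of_sq_le_sq ?_ (mul_nonneg (norm_nonneg _) (cnorm_nonneg _))
  rw [cnorm_sq, mul_pow, cnorm_sq]
  exact sum_norm_sq_mulVec_le _ _

lemma sum_zeta_add_sub_le [NeZero m] (h : n ≤ m) {x : Fin n → ℂ} (hx : cnorm x = 1) {s : ℝ}
    (hs : 1 / 2 < s) (a b : Fin m → ℂ) :
    ∑ k, zeta s ((Amat h (a + b) *ᵥ x) k) - ∑ k, zeta s ((Amat h a *ᵥ x) k) ≤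
      √m * √n * cnorm b := by
  rw [← Finset.sum_sub_distrib]
  calc _ ≤ ∑ k, ‖(Amat h b *ᵥ x) k‖ := by
        refine Finset.sum_le_sum fun k _ => ?_
        refine (le_abs_self _).trans ((abs_zeta_sub_le hs _ _).trans (le_of_eq ?_))
        rw [Amat_add, add_mulVec, Pi.add_apply, add_sub_cancel_left]
    _ ≤ √m * cnorm (Amat h b *ᵥ x) := sum_norm_le_sqrt_mul_cnorm _
    _ ≤ √m * (√n * cnorm b * 1) := by
        gcongr
        refine (cnorm_Amat_mulVec_le h b x).trans ?_
        rw [hx]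
        gcongr
        exact norm_Amat_le h b
    _ = _ := by ring

/-- Concentration of `∑ ζ(|A x|)`. -/
lemma measure_sum_zeta_ge_le [NeZero m] [NeZero n] (h : n ≤ m) {x : Fin n → ℂ} (hx : cnorm x = 1)
    {s : ℝ} (hs : 1 / 2 < s) {η p : ℝ} (hη : 0 < η) (hp : 8 * n * p ≤ η ^ 2 * m) :
    cgaussianVec m 1 {a | m / (2 * s + 1) + η * m ≤ ∑ k, zeta s ((Amat h a *ᵥ x) k)} ≤
      ENNReal.ofReal (Real.exp (-p)) := by
  have hs0 : 0 < s := by linarith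
  have hn : (0 : ℝ) < n := by exact_mod_cast NeZero.pos n
  have hm : (0 : ℝ) < m := by exact_mod_cast NeZero.pos m
  have hK : (0 : ℝ) ≤ √m * √n := by positivity
  have hlip := fun a b => sum_zeta_add_sub_le h hx hs a b
  have hL := lipschitzWith_of_sub_le
    (f := fun a => ∑ k, zeta s ((Amat h a *ᵥ x) k)) hK hlip
  have h1 := measure_ge_mean_add_le (integral_id_cgaussianVec 1) hL
    (ae_differentiableAt_cgaussianVec hL) (variance_fderiv_le
    (f := fun a => ∑ k, zeta s ((Amat h a *ᵥ x) k)) hK hlip)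
    (t := η / (4 * n)) (by positivity) (η * m)
  have h2 : ∫ a, ∑ k, zeta s ((Amat h a *ᵥ x) k) ∂(cgaussianVec m 1) = m / (2 * s + 1) := by
    rw [integral_finsetSum _ fun k _ => integrable_zeta_comp (measurable_Amat_mulVec h x k) hs0]
    simp [integral_zeta_Amat_mulVec h hx _ hs0, div_eq_mul_inv]
  rw [h2] at h1
  refine h1.trans (ENNReal.ofReal_le_ofReal (Real.exp_le_exp.2 ?_))
  rw [mul_pow, Real.sq_sqrt hm.le, Real.sq_sqrt hn.le]
  have h3 : 2 * (η / (4 * n)) ^ 2 * (m * n) - η / (4 * n) * (η * m) = -(η ^ 2 * m / (8 * n)) := by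
    field_simp; ring
  rw [h3, neg_le_neg_iff, le_div_iff₀ (by positivity)]
  linarith

/-- The expected loss at a perturbed point, compared with half the expected weight. -/
lemma integral_loss_add_mulVec [NeZero m] (h : n ≤ m) {x w : Fin n → ℂ} (hw : dotc x w = 0)
    {s : ℝ} (hs : 0 < s) (k : Fin m) (u α : ℂ) (r τ : ℝ) :
    Integrable (fun b => loss s (u + r * (Amat h b *ᵥ x) k) (α - τ * (Amat h b *ᵥ w) k))
      (cgaussianVec m 1) ∧
    ∫ b, loss s (u + r * (Amat h b *ᵥ x) k) (α - τ * (Amat h b *ᵥ w) k) ∂(cgaussianVec m 1) =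
      ∫ b, loss s (u + r * (Amat h b *ᵥ x) k) α ∂(cgaussianVec m 1) +
        τ ^ 2 * cnorm w ^ 2 / 2 *
          ∫ b, zeta s (u + r * (Amat h b *ᵥ x) k) ∂(cgaussianVec m 1) := by
  have hx := measurable_Amat_mulVec h x k
  have hV : Measurable fun b => u + r * (Amat h b *ᵥ x) k := by fun_prop
  refine integral_loss_sub_mul hV ?_ ?_ ?_ ?_ ?_ hs α τ
  · have h1 : IndepFun (fun b => (Amat h b *ᵥ x) k) (fun b => (Amat h b *ᵥ w) k)
        (cgaussianVec m 1) := by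
      simp only [Amat_mulVec_eq_dotProduct]
      refine indepFun_dotProduct ?_
      rw [sum_rowVec_mul_conj, ← map_zero (starRingEnd ℂ), ← hw, dotc, map_sum]
      simp
    exact h1.comp (φ := fun v => u + r * v) (ψ := id) (by fun_prop) measurable_id
  · simp only [Amat_mulVec_eq_dotProduct]
    exact memLp_dotProduct _ 2 (by simp)
  · simp only [Amat_mulVec_eq_dotProduct]
    exact integral_dotProduct _
  · simp only [Amat_mulVec_eq_dotProduct]
    exact integral_dotProduct_mul _ _
  · simp only [Amat_mulVec_eq_dotProduct]
    rw [integral_dotProduct_mul_conj, ← sum_norm_rowVec_sq h w k]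
    simp [Complex.mul_conj']

lemma integral_prod_loss_mulVec [NeZero m] (h : n ≤ m) {x w : Fin n → ℂ}
    {s : ℝ} (hs : 0 < s) (k : Fin m) (u : ℂ) (r : ℝ) :
    Integrable (fun z : (Fin m → ℂ) × (Fin m → ℂ) =>
      loss s (u + r * (Amat h z.1 *ᵥ x) k) ((Amat h z.2 *ᵥ w) k))
      ((cgaussianVec m 1).prod (cgaussianVec m 1)) ∧
    ∫ z, loss s (u + r * (Amat h z.1 *ᵥ x) k) ((Amat h z.2 *ᵥ w) k)
      ∂((cgaussianVec m 1).prod (cgaussianVec m 1)) =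
        cnorm w ^ 2 / 2 *
          ∫ b, zeta s (u + r * (Amat h b *ᵥ x) k) ∂(cgaussianVec m 1) := by
  have hx := measurable_Amat_mulVec h x k
  have hV : Measurable fun z : (Fin m → ℂ) × (Fin m → ℂ) => u + r * (Amat h z.1 *ᵥ x) k :=
    ((hx.comp measurable_fst).const_mul _).const_add _
  have hsnd : MeasurePreserving Prod.snd ((cgaussianVec m 1).prod (cgaussianVec m 1))
    (cgaussianVec m 1) := measurePreserving_snd
  have hi : ∀ f : (Fin m → ℂ) → ℂ, ∫ z, f z.2 ∂((cgaussianVec m 1).prod (cgaussianVec m 1)) =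
      ∫ b, f b ∂(cgaussianVec m 1) := fun f => by
    rw [integral_fun_snd]; simp
  have key := integral_loss_sub_mul (P := (cgaussianVec m 1).prod (cgaussianVec m 1))
    (r := fun z => (Amat h z.2 *ᵥ w) k) (e := cnorm w ^ 2) hV ?_ ?_ ?_ ?_ ?_ hs 0 (-1)
  · simp only [Complex.ofReal_neg, Complex.ofReal_one, neg_mul, one_mul, sub_neg_eq_add,
      zero_add] at key
    refine ⟨key.1, key.2.trans ?_⟩
    have h0 : ∀ v, loss s v 0 = 0 := fun v => by simp [loss]
    simp only [h0, integral_zero, zero_add]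
    rw [integral_fun_fst (fun b => zeta s (u + r * (Amat h b *ᵥ x) k))]
    simp
  · exact indepFun_prod (X := fun b => u + r * (Amat h b *ᵥ x) k)
      (Y := fun b => (Amat h b *ᵥ w) k) (by fun_prop) (measurable_Amat_mulVec h w k)
  · have : MemLp (fun b => (Amat h b *ᵥ w) k) 2 (cgaussianVec m 1) := by
      simp only [Amat_mulVec_eq_dotProduct]
      exact memLp_dotProduct _ 2 (by simp)
    exact this.comp_measurePreserving hsnd
  · rw [hi (fun b => (Amat h b *ᵥ w) k)]
    simp only [Amat_mulVec_eq_dotProduct]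
    exact integral_dotProduct _
  · rw [hi (fun b => (Amat h b *ᵥ w) k * (Amat h b *ᵥ w) k)]
    simp only [Amat_mulVec_eq_dotProduct]
    exact integral_dotProduct_mul _ _
  · rw [hi (fun b => (Amat h b *ᵥ w) k * starRingEnd ℂ ((Amat h b *ᵥ w) k))]
    simp only [Amat_mulVec_eq_dotProduct]
    rw [integral_dotProduct_mul_conj, ← sum_norm_rowVec_sq h w k]
    simp [Complex.mul_conj']

lemma integral_norm_Amat_mulVec_apply_le [NeZero m] (h : n ≤ m) {x : Fin n → ℂ} (hx : cnorm x = 1)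
    (k : Fin m) : Integrable (fun b => ‖(Amat h b *ᵥ x) k‖) (cgaussianVec m 1) ∧
    ∫ b, ‖(Amat h b *ᵥ x) k‖ ∂(cgaussianVec m 1) ≤ 1 := by
  have h1 := integral_norm_sum_mul_sq (sub_castLE_injective h k) x
  have e : ∀ b : Fin m → ℂ, ∑ j, x j * b (k - Fin.castLE h j) = (Amat h b *ᵥ x) k := fun b => by
    simp [mulVec, dotProduct, Amat, circulant_apply, mul_comm]
  simp only [e, ← cnorm_sq, hx, one_pow] at h1
  have hi : Integrable (fun b => ‖(Amat h b *ᵥ x) k‖) (cgaussianVec m 1) := by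
    simp only [Amat_mulVec_eq_dotProduct]
    exact ((memLp_dotProduct _ 1 (by simp)).integrable le_rfl).norm
  refine ⟨hi, ?_⟩
  calc _ ≤ ∫ b, (1 + ‖(Amat h b *ᵥ x) k‖ ^ 2) / 2 ∂(cgaussianVec m 1) := by
        refine integral_mono hi (((integrable_const _).add h1.1).div_const 2) fun b => ?_
        have := sq_nonneg (‖(Amat h b *ᵥ x) k‖ - 1)
        dsimp only
        linarith
    _ = 1 := by
        rw [integral_div, integral_add (integrable_const _) h1.1, h1.2]
        simp
    _ ≤ 1 := le_rfl

end Measurement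

section Decoupling

open scoped Matrix.Norms.L2Operator

variable {m n : ℕ}

instance (s : ℝ) : SFinite (cgaussianVec m s) := by
  have : IsFiniteMeasure (cgaussianVec m s) := inferInstance
  infer_instance

lemma norm_dotProduct_le (v w : Fin n → ℂ) : ‖v ⬝ᵥ w‖ ≤ cnorm v * cnorm w := by
  refine le_of_sq_le_sq ?_ (mul_nonneg (cnorm_nonneg _) (cnorm_nonneg _))
  rw [mul_pow, cnorm_sq, cnorm_sq]
  refine le_trans ?_ (Finset.sum_mul_sq_le_sq_mul_sq _ _ _)
  gcongr
  refine (norm_sum_le _ _).trans (le_of_eq ?_)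
  simp

lemma cnorm_star (v : Fin n → ℂ) : cnorm (star v) = cnorm v := by
  simp [cnorm]

lemma norm_dotProduct_mulVec_le (M : Matrix (Fin n) (Fin n) ℂ) (v w : Fin n → ℂ) :
    ‖v ⬝ᵥ (M *ᵥ w)‖ ≤ ‖M‖ * (cnorm v * cnorm w) := by
  have h : cnorm (M *ᵥ w) ≤ ‖M‖ * cnorm w := by
    refine le_of_sq_le_sq ?_ (mul_nonneg (norm_nonneg _) (cnorm_nonneg _))
    rw [cnorm_sq, mul_pow, cnorm_sq]
    exact sum_norm_sq_mulVec_le _ _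
  calc _ ≤ cnorm v * cnorm (M *ᵥ w) := norm_dotProduct_le _ _
    _ ≤ cnorm v * (‖M‖ * cnorm w) := mul_le_mul_of_nonneg_left h (cnorm_nonneg _)
    _ = _ := by ring

lemma star_mulVec_dotProduct_mulVec (G G' : Matrix (Fin m) (Fin n) ℂ) (D : Fin m → ℂ)
    (w : Fin n → ℂ) : ∑ k, D k * (starRingEnd ℂ ((G *ᵥ w) k) * (G' *ᵥ w) k) =
      star w ⬝ᵥ ((Gᴴ * (diagonal D * G')) *ᵥ w) := by
  rw [← mulVec_mulVec, dotProduct_mulVec, ← star_mulVec, ← mulVec_mulVec, dotProduct]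
  refine Finset.sum_congr rfl fun k _ => ?_
  rw [mulVec_diagonal, Pi.star_apply, ← starRingEnd_apply]
  ring

lemma mulVec_dotProduct_mulVec (G G' : Matrix (Fin m) (Fin n) ℂ) (D : Fin m → ℂ)
    (w : Fin n → ℂ) : ∑ k, D k * ((G *ᵥ w) k * (G' *ᵥ w) k) =
      w ⬝ᵥ ((Gᵀ * (diagonal D * G')) *ᵥ w) := by
  rw [← mulVec_mulVec, dotProduct_mulVec, vecMul_transpose, ← mulVec_mulVec, dotProduct]
  refine Finset.sum_congr rfl fun k _ => ?_
  rw [mulVec_diagonal]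
  ring

/-- The sum of the norms of the two decoupled chaoses with weights `ζ(A_b x)` and
`ζ(A_b x) ψ(A_b x)`. -/
def chaosNorm (h : n ≤ m) (s : ℝ) (x : Fin n → ℂ) (b : Fin m → ℂ)
    (z : (Fin m → ℂ) × (Fin m → ℂ)) : ℝ :=
  ‖(Amat h z.1)ᴴ * (diagonal (fun k => (zeta s ((Amat h b *ᵥ x) k) : ℂ)) * Amat h z.2)‖ +
  ‖(Amat h z.1)ᵀ * (diagonal (fun k => (zeta s ((Amat h b *ᵥ x) k) : ℂ) *
    psi ((Amat h b *ᵥ x) k)) * Amat h z.2)‖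

lemma loss_sub_loss (s : ℝ) (u p q : ℂ) : loss s u p - loss s u q =
    (-((zeta s u : ℂ) * (starRingEnd ℂ ((√2 / 2 : ℝ) * (p + q)) * ((√2 / 2 : ℝ) * (q - p)))) +
      zeta s u * psi u * (((√2 / 2 : ℝ) * (p + q)) * ((√2 / 2 : ℝ) * (q - p)))).re := by
  have h2 : ((√2 / 2 : ℝ) : ℂ) * (√2 / 2 : ℝ) = 1 / 2 := by
    rw [← Complex.ofReal_mul, div_mul_div_comm, Real.mul_self_sqrt (by norm_num)]
    norm_num
  have h3 : -((zeta s u : ℂ) * (starRingEnd ℂ ((√2 / 2 : ℝ) * (p + q)) * ((√2 / 2 : ℝ) * (q - p)))) +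
      zeta s u * psi u * (((√2 / 2 : ℝ) * (p + q)) * ((√2 / 2 : ℝ) * (q - p))) =
      ((zeta s u : ℂ) * (p * starRingEnd ℂ p) - zeta s u * psi u * (p * p)) / 2 -
      ((zeta s u : ℂ) * (q * starRingEnd ℂ q) - zeta s u * psi u * (q * q)) / 2 -
      ((zeta s u : ℝ) : ℂ) * ((starRingEnd ℂ p * q - starRingEnd ℂ (starRingEnd ℂ p * q)) / 2) := by
    simp only [map_mul, map_add, Complex.conj_ofReal, Complex.conj_conj]
    linear_combination (-(zeta s u : ℂ) * (starRingEnd ℂ p + starRingEnd ℂ q) * (q - p) +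
      zeta s u * psi u * (p + q) * (q - p)) * h2
  have e : ∀ (X Y W : ℂ) (t : ℝ),
      (X / 2 - Y / 2 - (t : ℂ) * ((W - starRingEnd ℂ W) / 2)).re = X.re / 2 - Y.re / 2 := by
    intro X Y W t
    simp
  rw [h3, e, loss_eq_re, loss_eq_re]

lemma sum_loss_sub_le (h : n ≤ m) (s : ℝ) (x w : Fin n → ℂ) (b : Fin m → ℂ)
    (y : (Fin m → ℂ) × (Fin m → ℂ)) :
    ∑ k, (loss s ((Amat h b *ᵥ x) k) ((Amat h y.1 *ᵥ w) k) -
      loss s ((Amat h b *ᵥ x) k) ((Amat h y.2 *ᵥ w) k)) ≤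
    chaosNorm h s x b (ContinuousLinearMap.rotation (Real.pi / 4) y) * cnorm w ^ 2 := by
  set z := ContinuousLinearMap.rotation (Real.pi / 4) y with hz
  have h1 : ∀ k, (Amat h z.1 *ᵥ w) k =
      (√2 / 2 : ℝ) * ((Amat h y.1 *ᵥ w) k + (Amat h y.2 *ᵥ w) k) := fun k => by
    simp only [hz, ContinuousLinearMap.rotation_apply, Real.cos_pi_div_four, Real.sin_pi_div_four,
      Amat_add, Amat_smul, add_mulVec, smul_mulVec, Pi.add_apply, Pi.smul_apply, Complex.real_smul]
    ring
  have h2 : ∀ k, (Amat h z.2 *ᵥ w) k =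
      (√2 / 2 : ℝ) * ((Amat h y.2 *ᵥ w) k - (Amat h y.1 *ᵥ w) k) := fun k => by
    simp only [hz, ContinuousLinearMap.rotation_apply, Real.cos_pi_div_four, Real.sin_pi_div_four,
      Amat_add, Amat_smul, add_mulVec, smul_mulVec, Pi.add_apply, Pi.smul_apply, Complex.real_smul]
    push_cast
    ring
  simp only [loss_sub_loss, ← h1, ← h2]
  rw [← Complex.re_sum, Finset.sum_add_distrib, Finset.sum_neg_distrib,
    star_mulVec_dotProduct_mulVec (Amat h z.1) (Amat h z.2)
      (fun k => (zeta s ((Amat h b *ᵥ x) k) : ℂ)),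
    mulVec_dotProduct_mulVec (Amat h z.1) (Amat h z.2)
      (fun k => (zeta s ((Amat h b *ᵥ x) k) : ℂ) * psi ((Amat h b *ᵥ x) k)), chaosNorm, add_mul]
  refine (Complex.re_le_norm _).trans ((norm_add_le _ _).trans ?_)
  rw [norm_neg]
  refine add_le_add ((norm_dotProduct_mulVec_le _ _ _).trans (le_of_eq ?_))
    ((norm_dotProduct_mulVec_le _ _ _).trans (le_of_eq ?_))
  · rw [cnorm_star, pow_two]
  · rw [pow_two]

/-- The Gaussian rotation that decouples the perturbed point from the chaos. -/
def decouple (θ : ℝ) (p : (Fin m → ℂ) × (Fin m → ℂ) × (Fin m → ℂ)) :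
    (Fin m → ℂ) × (Fin m → ℂ) × (Fin m → ℂ) :=
  ((ContinuousLinearMap.rotation θ (p.1, p.2.1)).1,
    ContinuousLinearMap.rotation (Real.pi / 4)
      ((ContinuousLinearMap.rotation θ (p.1, p.2.1)).2, p.2.2))

lemma measurePreserving_decouple (θ : ℝ) :
    MeasurePreserving (decouple (m := m) θ)
      ((cgaussianVec m 1).prod ((cgaussianVec m 1).prod (cgaussianVec m 1)))
      ((cgaussianVec m 1).prod ((cgaussianVec m 1).prod (cgaussianVec m 1))) := by
  have h1 := measurePreserving_prodAssoc (cgaussianVec m 1) (cgaussianVec m 1) (cgaussianVec m 1)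
  have h2 := (measurePreserving_rotation_cgaussianVec (m := m) θ).prod
    (MeasurePreserving.id (cgaussianVec m 1))
  have h3 := (MeasurePreserving.id (cgaussianVec m 1)).prod
    (measurePreserving_rotation_cgaussianVec (m := m) (Real.pi / 4))
  exact h3.comp (h1.comp (h2.comp (h1.symm _)))

/-- The decoupled chaos norm, as a function of the measurement vector and of the auxiliary noise. -/
def noisyChaosNorm (h : n ≤ m) (s : ℝ) (x : Fin n → ℂ) (θ : ℝ)
    (p : (Fin m → ℂ) × (Fin m → ℂ) × (Fin m → ℂ)) : ℝ :=
  chaosNorm h s x ((Real.cos θ)⁻¹ • (decouple θ p).1) (decouple θ p).2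

/-- Deterministic bound for the loss in terms of the averaged decoupled chaos. -/
lemma sum_loss_le [NeZero m] (h : n ≤ m) {s : ℝ} (hs : 1 / 2 < s) {x w : Fin n → ℂ}
    (hx : cnorm x = 1) (hw : dotc x w = 0) {θ : ℝ} (hc : 0 < Real.cos θ) (hsin : 0 < Real.sin θ)
    (a : Fin m → ℂ) (hN : Integrable (fun z => noisyChaosNorm h s x θ (a, z))
      ((cgaussianVec m 1).prod (cgaussianVec m 1))) :
    ∑ k, loss s ((Amat h a *ᵥ x) k) ((Amat h a *ᵥ w) k) ≤
      ((∑ k, zeta s ((Amat h a *ᵥ x) k) + Real.tan θ * m) / 2 + 5 * Real.tan θ * ‖Amat h a‖ ^ 2 +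
        (∫ z, noisyChaosNorm h s x θ (a, z) ∂((cgaussianVec m 1).prod (cgaussianVec m 1))) /
          Real.sin θ ^ 2) * cnorm w ^ 2 := by
  have hs0 : 0 < s := by linarith
  set r := Real.tan θ with hr
  have hr0 : 0 ≤ r := by rw [hr, Real.tan_eq_sin_div_cos]; positivity
  set u : Fin m → ℂ := Amat h a *ᵥ x with hu
  set z : Fin m → ℂ := Amat h a *ᵥ w with hz
  set J : Fin m → ℝ := fun k => ∫ b, loss s (u k + r * (Amat h b *ᵥ x) k) (z k) ∂(cgaussianVec m 1) with hJ
  set T : Fin m → ℝ := fun k => ∫ b, zeta s (u k + r * (Amat h b *ᵥ x) k) ∂(cgaussianVec m 1) with hT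
  have f1 := fun k => integral_loss_add_mulVec h hw hs0 k (u k) ((-Real.sin θ : ℝ) * z k) r
    (-Real.cos θ)
  have f2 := fun k => integral_prod_loss_mulVec (w := w) h (x := x) hs0 k (u k) r
  have f3 : ∀ k, Integrable (fun y : (Fin m → ℂ) × (Fin m → ℂ) =>
      loss s (u k + r * (Amat h y.1 *ᵥ x) k)
        ((-Real.sin θ : ℝ) * z k - (-Real.cos θ : ℝ) * (Amat h y.1 *ᵥ w) k)) ((cgaussianVec m 1).prod (cgaussianVec m 1)) ∧
      ∫ y, loss s (u k + r * (Amat h y.1 *ᵥ x) k)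
        ((-Real.sin θ : ℝ) * z k - (-Real.cos θ : ℝ) * (Amat h y.1 *ᵥ w) k) ∂((cgaussianVec m 1).prod (cgaussianVec m 1)) =
      Real.sin θ ^ 2 * J k + Real.cos θ ^ 2 * cnorm w ^ 2 / 2 * T k := by
    intro k
    refine ⟨(f1 k).1.comp_fst (cgaussianVec m 1), ?_⟩
    rw [integral_fun_fst (fun b => loss s (u k + r * (Amat h b *ᵥ x) k)
        ((-Real.sin θ : ℝ) * z k - (-Real.cos θ : ℝ) * (Amat h b *ᵥ w) k)), (f1 k).2]
    simp only [loss_ofReal_mul, integral_const_mul, neg_sq]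
    simp [hJ, hT]
  have hpt : ∀ y : (Fin m → ℂ) × (Fin m → ℂ),
      ∑ k, (loss s (u k + r * (Amat h y.1 *ᵥ x) k)
          ((-Real.sin θ : ℝ) * z k - (-Real.cos θ : ℝ) * (Amat h y.1 *ᵥ w) k) -
        loss s (u k + r * (Amat h y.1 *ᵥ x) k) ((Amat h y.2 *ᵥ w) k)) ≤
      noisyChaosNorm h s x θ (a, y) * cnorm w ^ 2 := by
    intro y
    have h1 := sum_loss_sub_le h s x w ((Real.cos θ)⁻¹ • (decouple θ (a, y)).1)
      ((ContinuousLinearMap.rotation θ (a, y.1)).2, y.2)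
    refine le_trans (le_of_eq ?_) h1
    refine Finset.sum_congr rfl fun k _ => ?_
    have e1 : (Amat h ((Real.cos θ)⁻¹ • (decouple θ (a, y)).1) *ᵥ x) k =
        u k + r * (Amat h y.1 *ᵥ x) k := by
      simp only [decouple, ContinuousLinearMap.rotation_apply, smul_add, smul_smul,
        inv_mul_cancel₀ hc.ne', one_smul, Amat_add, Amat_smul, add_mulVec, smul_mulVec,
        Pi.add_apply, Pi.smul_apply, Complex.real_smul, hu, hr, Real.tan_eq_sin_div_cos]
      push_cast
      ring
    have e2 : (Amat h (ContinuousLinearMap.rotation θ (a, y.1)).2 *ᵥ w) k =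
        (-Real.sin θ : ℝ) * z k - (-Real.cos θ : ℝ) * (Amat h y.1 *ᵥ w) k := by
      simp only [ContinuousLinearMap.rotation_apply, Amat_add, Amat_smul, add_mulVec, smul_mulVec,
        Pi.add_apply, Pi.smul_apply, Complex.real_smul, hz]
      push_cast
      ring
    rw [e1, e2]
  have hfint := integral_mono (μ := (cgaussianVec m 1).prod (cgaussianVec m 1))
    (integrable_finsetSum _ fun k _ => (f3 k).1.sub (f2 k).1) (hN.mul_const (cnorm w ^ 2)) hpt
  have hL : ∫ y : (Fin m → ℂ) × (Fin m → ℂ),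
      ∑ k, (loss s (u k + r * (Amat h y.1 *ᵥ x) k)
          ((-Real.sin θ : ℝ) * z k - (-Real.cos θ : ℝ) * (Amat h y.1 *ᵥ w) k) -
        loss s (u k + r * (Amat h y.1 *ᵥ x) k) ((Amat h y.2 *ᵥ w) k)) ∂((cgaussianVec m 1).prod (cgaussianVec m 1)) =
      Real.sin θ ^ 2 * ∑ k, (J k - cnorm w ^ 2 / 2 * T k) := by
    refine (integral_finsetSum _ fun k _ => (f3 k).1.sub (f2 k).1).trans ?_
    rw [Finset.mul_sum]
    refine Finset.sum_congr rfl fun k _ => ?_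
    refine (integral_sub (f3 k).1 (f2 k).1).trans ?_
    rw [(f3 k).2, (f2 k).2]
    have := Real.cos_sq_add_sin_sq θ
    simp only [hT]
    linear_combination (cnorm w ^ 2 / 2 * ∫ b, zeta s (u k + r * (Amat h b *ᵥ x) k) ∂(cgaussianVec m 1)) * this
  have hfint2 : Real.sin θ ^ 2 * ∑ k, (J k - cnorm w ^ 2 / 2 * T k) ≤
      (∫ y, noisyChaosNorm h s x θ (a, y) ∂((cgaussianVec m 1).prod (cgaussianVec m 1))) * cnorm w ^ 2 := by
    rw [← hL, ← integral_mul_const]; exact hfint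
  have hJb : ∀ k, loss s (u k) (z k) ≤ J k + 5 * r * ‖z k‖ ^ 2 := by
    intro k
    obtain ⟨i1, i2⟩ := integral_norm_Amat_mulVec_apply_le h hx k
    have j1 : Integrable (fun b => loss s (u k + r * (Amat h b *ᵥ x) k) (z k)) (cgaussianVec m 1) := by
      simpa using (integral_loss_add_mulVec h hw hs0 k (u k) (z k) r 0).1
    have j2 := i1.const_mul (5 * r * ‖z k‖ ^ 2)
    calc loss s (u k) (z k) = ∫ _b, loss s (u k) (z k) ∂(cgaussianVec m 1) := by simp
      _ ≤ ∫ b, (loss s (u k + r * (Amat h b *ᵥ x) k) (z k) +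
            5 * r * ‖z k‖ ^ 2 * ‖(Amat h b *ᵥ x) k‖) ∂(cgaussianVec m 1) := by
          refine integral_mono (integrable_const _) (j1.add j2) fun b => ?_
          refine (loss_le_loss_add hs _ (u k + r * (Amat h b *ᵥ x) k) _).trans (le_of_eq ?_)
          rw [sub_add_cancel_left, norm_neg, norm_mul, Complex.norm_real, Real.norm_eq_abs,
            abs_of_nonneg hr0]
          ring
      _ = J k + 5 * r * ‖z k‖ ^ 2 * ∫ b, ‖(Amat h b *ᵥ x) k‖ ∂(cgaussianVec m 1) := by
          rw [integral_add j1 j2, integral_const_mul]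
      _ ≤ J k + 5 * r * ‖z k‖ ^ 2 * 1 := by gcongr
      _ = _ := by ring
  have hTb : ∀ k, T k ≤ zeta s (u k) + r := by
    intro k
    obtain ⟨i1, i2⟩ := integral_norm_Amat_mulVec_apply_le h hx k
    have j1 : Integrable (fun b => zeta s (u k + r * (Amat h b *ᵥ x) k)) (cgaussianVec m 1) :=
      integrable_zeta_comp (((measurable_Amat_mulVec h x k).const_mul _).const_add _) hs0
    have j2 := i1.const_mul r
    calc T k ≤ ∫ b, (zeta s (u k) + r * ‖(Amat h b *ᵥ x) k‖) ∂(cgaussianVec m 1) := by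
          refine integral_mono j1 ((integrable_const _).add j2) fun b => ?_
          have := (le_abs_self _).trans (abs_zeta_sub_le hs (u k + r * (Amat h b *ᵥ x) k) (u k))
          rw [add_sub_cancel_left, norm_mul, Complex.norm_real, Real.norm_eq_abs,
            abs_of_nonneg hr0] at this
          dsimp only
          linarith
      _ = zeta s (u k) + r * ∫ b, ‖(Amat h b *ᵥ x) k‖ ∂(cgaussianVec m 1) := by
          rw [integral_add (integrable_const _) j2, integral_const_mul]; simp
      _ ≤ zeta s (u k) + r * 1 := by gcongr
      _ = _ := by ring
  have hzn : ∑ k, ‖z k‖ ^ 2 ≤ ‖Amat h a‖ ^ 2 * cnorm w ^ 2 := by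
    rw [cnorm_sq w]; exact sum_norm_sq_mulVec_le _ _
  have hfint3 : ∑ k, (J k - cnorm w ^ 2 / 2 * T k) ≤
      (∫ y, noisyChaosNorm h s x θ (a, y) ∂((cgaussianVec m 1).prod (cgaussianVec m 1))) / Real.sin θ ^ 2 * cnorm w ^ 2 := by
    rw [div_mul_eq_mul_div, le_div_iff₀ (by positivity)]
    linarith
  calc ∑ k, loss s (u k) (z k)
      ≤ ∑ k, ((J k - cnorm w ^ 2 / 2 * T k) + 5 * r * ‖z k‖ ^ 2 +
          cnorm w ^ 2 / 2 * (zeta s (u k) + r)) := by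
        refine Finset.sum_le_sum fun k _ => ?_
        have := mul_le_mul_of_nonneg_left (hTb k) (show 0 ≤ cnorm w ^ 2 / 2 by positivity)
        have := hJb k
        linarith
    _ = ∑ k, (J k - cnorm w ^ 2 / 2 * T k) + 5 * r * ∑ k, ‖z k‖ ^ 2 +
          cnorm w ^ 2 / 2 * (∑ k, zeta s (u k) + r * m) := by
        rw [Finset.sum_add_distrib, Finset.sum_add_distrib, ← Finset.mul_sum, ← Finset.mul_sum,
          Finset.sum_add_distrib (f := fun k => zeta s (u k))]
        simp [mul_comm r]
    _ ≤ (∫ y, noisyChaosNorm h s x θ (a, y) ∂((cgaussianVec m 1).prod (cgaussianVec m 1))) / Real.sin θ ^ 2 * cnorm w ^ 2 +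
          5 * r * (‖Amat h a‖ ^ 2 * cnorm w ^ 2) +
          cnorm w ^ 2 / 2 * (∑ k, zeta s (u k) + r * m) := by gcongr
    _ = _ := by ring

end Decoupling

section Tail

open scoped Matrix.Norms.L2Operator

lemma measure_ofReal_le_of_lintegral_pow_le {α : Type*} [MeasurableSpace α] {ν : Measure α}
    {f : α → ℝ≥0∞} (hf : Measurable f) {p : ℕ} {B T : ℝ} (hT : 0 < T)
    (hBT : Real.exp 1 * B ≤ T) (h : ∫⁻ a, f a ^ p ∂ν ≤ ENNReal.ofReal B ^ p) :
    ν {a | ENNReal.ofReal T ≤ f a} ≤ ENNReal.ofReal (Real.exp (-p)) := by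
  have hT0 : ENNReal.ofReal T ^ p ≠ 0 := pow_ne_zero _ (by simpa using hT)
  have hTt : ENNReal.ofReal T ^ p ≠ ⊤ := ENNReal.pow_ne_top ENNReal.ofReal_ne_top
  have hB : ENNReal.ofReal B ≤ ENNReal.ofReal (Real.exp (-1)) * ENNReal.ofReal T := by
    rw [← ENNReal.ofReal_mul (Real.exp_pos _).le]
    refine ENNReal.ofReal_le_ofReal ?_
    rw [Real.exp_neg, ← div_eq_inv_mul, le_div_iff₀ (Real.exp_pos _)]
    linarith
  calc ν {a | ENNReal.ofReal T ≤ f a} ≤ ν {a | ENNReal.ofReal T ^ p ≤ f a ^ p} :=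
        measure_mono (Set.ofPred_subset_ofPred.2 fun a ha => pow_le_pow_left₀ zero_le ha p)
    _ ≤ (∫⁻ a, f a ^ p ∂ν) / ENNReal.ofReal T ^ p :=
        meas_ge_le_lintegral_div (hf.pow_const p).aemeasurable hT0 hTt
    _ ≤ ENNReal.ofReal (Real.exp (-p)) := by
        refine ENNReal.div_le_of_le_mul ((h.trans (pow_le_pow_left₀ zero_le hB p)).trans
          (le_of_eq ?_))
        rw [mul_pow, ← ENNReal.ofReal_pow (Real.exp_pos _).le, ← Real.exp_nat_mul, mul_neg_one]

lemma lintegral_pow_le_lintegral_pow {α : Type*} [MeasurableSpace α] {ν : Measure α}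
    [IsProbabilityMeasure ν] {f : α → ℝ≥0∞} (hf : AEMeasurable f ν) {p : ℕ} (hp : 1 < p) :
    (∫⁻ a, f a ∂ν) ^ p ≤ ∫⁻ a, f a ^ p ∂ν := by
  have hp' : (1 : ℝ) < p := by exact_mod_cast hp
  have h := ENNReal.lintegral_mul_le_Lp_mul_Lq ν (Real.HolderConjugate.conjExponent hp') hf
    (aemeasurable_const (b := 1))
  simp only [Pi.mul_apply, mul_one, ENNReal.one_rpow, lintegral_one, measure_univ] at h
  have h2 := pow_le_pow_left₀ zero_le h p
  rw [← ENNReal.rpow_natCast ((_ : ℝ≥0∞) ^ _), ← ENNReal.rpow_mul, one_div,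
    inv_mul_cancel₀ (by linarith), ENNReal.rpow_one] at h2
  simpa only [ENNReal.rpow_natCast] using h2

lemma ennreal_add_pow_le (x y : ℝ≥0∞) (p : ℕ) : (x + y) ^ p ≤ 2 ^ p * (x ^ p + y ^ p) := by
  have h : x + y ≤ 2 * max x y := by
    rw [two_mul]; exact add_le_add (le_max_left _ _) (le_max_right _ _)
  refine (pow_le_pow_left₀ zero_le h p).trans ?_
  rw [mul_pow]
  gcongr
  rcases le_total x y with hxy | hxy
  · rw [max_eq_right hxy]; exact le_add_self
  · rw [max_eq_left hxy]; exact le_self_add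

lemma measurable_norm_matrix {α : Type*} [MeasurableSpace α] {k l : ℕ}
    {F : α → Matrix (Fin k) (Fin l) ℂ} (hF : ∀ i j, Measurable fun a => F a i j) :
    Measurable fun a => ‖F a‖ := by
  have h1 : Continuous fun f : Fin k → Fin l → ℂ => ‖(Matrix.of f : Matrix (Fin k) (Fin l) ℂ)‖ :=
    Continuous.norm (f := fun f : Fin k → Fin l → ℂ => (Matrix.of f : Matrix (Fin k) (Fin l) ℂ))
      continuous_id
  exact h1.measurable.comp (measurable_pi_iff.2 fun i => measurable_pi_iff.2 fun j => hF i j)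

variable {m n : ℕ}

lemma measurable_Amat_apply (h : n ≤ m) (i : Fin m) (j : Fin n) :
    Measurable fun a => Amat h a i j := measurable_pi_apply _

lemma measurable_chaosNorm (h : n ≤ m) (s : ℝ) (x : Fin n → ℂ) :
    Measurable fun p : (Fin m → ℂ) × (Fin m → ℂ) × (Fin m → ℂ) => chaosNorm h s x p.1 p.2 := by
  have hz : ∀ k, Measurable fun p : (Fin m → ℂ) × (Fin m → ℂ) × (Fin m → ℂ) =>
      (zeta s ((Amat h p.1 *ᵥ x) k) : ℂ) := fun k =>
    Complex.measurable_ofReal.comp ((measurable_zeta s).comp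
      ((measurable_Amat_mulVec h x k).comp measurable_fst))
  have hp : ∀ k, Measurable fun p : (Fin m → ℂ) × (Fin m → ℂ) × (Fin m → ℂ) =>
      psi ((Amat h p.1 *ᵥ x) k) := fun k =>
    measurable_psi.comp ((measurable_Amat_mulVec h x k).comp measurable_fst)
  have h1 : ∀ i j, Measurable fun p : (Fin m → ℂ) × (Fin m → ℂ) × (Fin m → ℂ) =>
      Amat h p.2.1 i j := fun i j =>
    (measurable_Amat_apply h i j).comp (measurable_fst.comp measurable_snd)
  have h2 : ∀ i j, Measurable fun p : (Fin m → ℂ) × (Fin m → ℂ) × (Fin m → ℂ) =>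
      Amat h p.2.2 i j := fun i j =>
    (measurable_Amat_apply h i j).comp (measurable_snd.comp measurable_snd)
  refine Measurable.add (measurable_norm_matrix fun i j => ?_)
    (measurable_norm_matrix fun i j => ?_)
  · simp only [Matrix.mul_apply, diagonal_apply, ite_mul, zero_mul, Finset.sum_ite_eq, Finset.mem_univ,
      if_true, conjTranspose_apply]
    exact Finset.measurable_sum _ fun k _ => (continuous_star.measurable.comp (h1 k i)).mul
      ((hz k).mul (h2 k j))
  · simp only [Matrix.mul_apply, diagonal_apply, ite_mul, zero_mul, Finset.sum_ite_eq, Finset.mem_univ,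
      if_true, transpose_apply]
    exact Finset.measurable_sum _ fun k _ => (h1 k i).mul (((hz k).mul (hp k)).mul (h2 k j))

lemma measurable_noisyChaosNorm (h : n ≤ m) (s : ℝ) (x : Fin n → ℂ) (θ : ℝ) :
    Measurable (noisyChaosNorm h s x θ) := by
  have hd := (measurePreserving_decouple (m := m) θ).measurable
  have h1 : Measurable fun p => (Real.cos θ)⁻¹ • (decouple (m := m) θ p).1 :=
    (continuous_const_smul _).measurable.comp hd.fst
  have h2 : Measurable fun p => ((Real.cos θ)⁻¹ • (decouple (m := m) θ p).1,
    (decouple (m := m) θ p).2) := h1.prodMk hd.snd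
  have h3 := (measurable_chaosNorm h s x).comp h2
  exact h3

lemma chaosNorm_nonneg (h : n ≤ m) (s : ℝ) (x : Fin n → ℂ) (b : Fin m → ℂ)
    (z : (Fin m → ℂ) × (Fin m → ℂ)) : 0 ≤ chaosNorm h s x b z :=
  add_nonneg (norm_nonneg _) (norm_nonneg _)

/-- The order of magnitude of the decoupled chaos. -/
def chaosScale (m n q q' s : ℕ) : ℝ :=
  4 * (87 * Real.exp 3 ^ 3 * √((m : ℝ) * (n * (q * q' + s))))

lemma lintegral_chaosNorm_pow_le [NeZero m] [NeZero n] (h : n ≤ m) (hnm : 2 * n ≤ m) {q q' : ℕ}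
    (hq0 : q ≠ 0) (hq : 2 * (n : ℝ) ≤ Real.exp q) (hq0' : q' ≠ 0) (hq' : 2 * (m : ℝ) ≤ Real.exp q')
    (hqq : (n : ℝ) * q * q' ≤ m) {t : ℕ} (ht0 : t ≠ 0) (ht : 2 * t * n ≤ m) {s : ℝ} (hs : 0 < s)
    (x : Fin n → ℂ) (b : Fin m → ℂ) :
    ∫⁻ z, ENNReal.ofReal (chaosNorm h s x b z) ^ (2 * t)
      ∂((cgaussianVec m 1).prod (cgaussianVec m 1)) ≤
    ENNReal.ofReal (chaosScale m n q q' t) ^ (2 * t) := by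
  set B := 87 * Real.exp 3 ^ 3 * √((m : ℝ) * (n * (q * q' + t))) with hB
  have hz : ∀ u : ℂ, ‖(zeta s u : ℂ)‖ ≤ 1 := fun u => by
    rw [Complex.norm_real, Real.norm_eq_abs, abs_of_nonneg (zeta_nonneg hs _)]
    exact zeta_le_one _ _
  have hm : ∀ (D : Fin m → ℂ), Measurable fun z : (Fin m → ℂ) × (Fin m → ℂ) =>
      ENNReal.ofReal ‖(Amat h z.1)ᴴ * (diagonal D * Amat h z.2)‖ ^ (2 * t) := fun D => by
    refine (measurable_norm_matrix fun i j => ?_).ennreal_ofReal.pow_const _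
    simp only [Matrix.mul_apply, diagonal_apply, ite_mul, zero_mul, Finset.sum_ite_eq, Finset.mem_univ,
      if_true, conjTranspose_apply]
    exact Finset.measurable_sum _ fun k _ => (continuous_star.measurable.comp
      ((measurable_Amat_apply h k i).comp measurable_fst)).mul (((measurable_Amat_apply h k j).comp measurable_snd).const_mul _)
  have h1 := lintegral_norm_chaos_pow_le h hnm hq0 hq hq0' hq' hqq t ht
    (D := fun k => (zeta s ((Amat h b *ᵥ x) k) : ℂ)) fun k => hz _
  have h2 := lintegral_norm_chaos_pow_le h hnm hq0 hq hq0' hq' hqq t ht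
    (D := fun k => (zeta s ((Amat h b *ᵥ x) k) : ℂ) * psi ((Amat h b *ᵥ x) k)) fun k => by
      rw [norm_mul, norm_psi, mul_one]; exact hz _
  rw [← lintegral_norm_chaos_transpose] at h2
  rw [← hB] at h1 h2
  have hc : chaosScale m n q q' t = 4 * B := rfl
  clear_value B
  calc _ ≤ ∫⁻ z : (Fin m → ℂ) × (Fin m → ℂ), 2 ^ (2 * t) *
        (ENNReal.ofReal ‖(Amat h z.1)ᴴ * (diagonal (fun k => (zeta s ((Amat h b *ᵥ x) k) : ℂ)) *
          Amat h z.2)‖ ^ (2 * t) +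
        ENNReal.ofReal ‖(Amat h z.1)ᵀ * (diagonal (fun k => (zeta s ((Amat h b *ᵥ x) k) : ℂ) *
          psi ((Amat h b *ᵥ x) k)) * Amat h z.2)‖ ^ (2 * t))
        ∂((cgaussianVec m 1).prod (cgaussianVec m 1)) := by
        refine lintegral_mono fun z => ?_
        rw [chaosNorm, ENNReal.ofReal_add (norm_nonneg _) (norm_nonneg _)]
        exact ennreal_add_pow_le _ _ _
    _ ≤ 2 ^ (2 * t) * (ENNReal.ofReal B ^ (2 * t) + ENNReal.ofReal B ^ (2 * t)) := by
        rw [lintegral_const_mul' _ _ (by simp), lintegral_add_left (hm _)]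
        gcongr
    _ = 2 * (2 ^ (2 * t) * ENNReal.ofReal B ^ (2 * t)) := by ring
    _ ≤ 2 ^ (2 * t) * (2 ^ (2 * t) * ENNReal.ofReal B ^ (2 * t)) := by
        gcongr
        exact le_self_pow₀ (by norm_num) (by omega)
    _ = _ := by
        rw [hc, ENNReal.ofReal_mul (by norm_num), mul_pow (ENNReal.ofReal 4),
          ← mul_assoc, ← mul_pow, ENNReal.ofReal_ofNat]
        norm_num

lemma measure_lintegral_noisyChaosNorm_ge_le [NeZero m] [NeZero n] (h : n ≤ m) (hnm : 2 * n ≤ m)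
    {q q' : ℕ} (hq0 : q ≠ 0) (hq : 2 * (n : ℝ) ≤ Real.exp q) (hq0' : q' ≠ 0)
    (hq' : 2 * (m : ℝ) ≤ Real.exp q') (hqq : (n : ℝ) * q * q' ≤ m) {t : ℕ} (ht0 : t ≠ 0)
    (ht : 2 * t * n ≤ m) {s : ℝ} (hs : 0 < s) (x : Fin n → ℂ) (θ : ℝ) {T : ℝ} (hT : 0 < T)
    (hT' : Real.exp 1 * chaosScale m n q q' t ≤ T) :
    cgaussianVec m 1 {a | ENNReal.ofReal T ≤ ∫⁻ z, ENNReal.ofReal (noisyChaosNorm h s x θ (a, z))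
      ∂((cgaussianVec m 1).prod (cgaussianVec m 1))} ≤ ENNReal.ofReal (Real.exp (-(2 * t : ℕ))) := by
  have hm := (measurable_noisyChaosNorm h s x θ).ennreal_ofReal
  refine measure_ofReal_le_of_lintegral_pow_le hm.lintegral_prod_right' hT hT' ?_
  have hm1 : Measurable fun p : (Fin m → ℂ) × (Fin m → ℂ) × (Fin m → ℂ) =>
      ((Real.cos θ)⁻¹ • p.1, p.2) :=
    ((continuous_const_smul _).measurable.comp measurable_fst).prodMk measurable_snd
  have hm2 : Measurable fun p : (Fin m → ℂ) × (Fin m → ℂ) × (Fin m → ℂ) =>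
      ENNReal.ofReal (chaosNorm h s x ((Real.cos θ)⁻¹ • p.1) p.2) ^ (2 * t) :=
    ((measurable_chaosNorm h s x).comp hm1).ennreal_ofReal.pow_const _
  calc _ ≤ ∫⁻ a, ∫⁻ z, ENNReal.ofReal (noisyChaosNorm h s x θ (a, z)) ^ (2 * t)
        ∂((cgaussianVec m 1).prod (cgaussianVec m 1)) ∂(cgaussianVec m 1) :=
        lintegral_mono fun a => lintegral_pow_le_lintegral_pow
          (hm.comp measurable_prodMk_left).aemeasurable (by omega)
    _ = ∫⁻ p, ENNReal.ofReal (noisyChaosNorm h s x θ p) ^ (2 * t)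
        ∂((cgaussianVec m 1).prod ((cgaussianVec m 1).prod (cgaussianVec m 1))) :=
        (lintegral_prod _ (hm.pow_const _).aemeasurable).symm
    _ = ∫⁻ p, ENNReal.ofReal (chaosNorm h s x ((Real.cos θ)⁻¹ • p.1) p.2) ^ (2 * t)
        ∂((cgaussianVec m 1).prod ((cgaussianVec m 1).prod (cgaussianVec m 1))) :=
        (measurePreserving_decouple θ).lintegral_comp hm2
    _ = ∫⁻ b, ∫⁻ z, ENNReal.ofReal (chaosNorm h s x ((Real.cos θ)⁻¹ • b) z) ^ (2 * t)
        ∂((cgaussianVec m 1).prod (cgaussianVec m 1)) ∂(cgaussianVec m 1) :=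
        lintegral_prod _ hm2.aemeasurable
    _ ≤ ∫⁻ _b, ENNReal.ofReal (chaosScale m n q q' t) ^ (2 * t) ∂(cgaussianVec m 1) :=
        lintegral_mono fun b =>
          lintegral_chaosNorm_pow_le h hnm hq0 hq hq0' hq' hqq ht0 ht hs x _
    _ = _ := by simp

lemma integrable_noisyChaosNorm (h : n ≤ m) (s : ℝ) (x : Fin n → ℂ) (θ : ℝ) {T : ℝ} (hT : 0 < T)
    {a : Fin m → ℂ} (ha : ∫⁻ z, ENNReal.ofReal (noisyChaosNorm h s x θ (a, z))
      ∂((cgaussianVec m 1).prod (cgaussianVec m 1)) < ENNReal.ofReal T) :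
    Integrable (fun z => noisyChaosNorm h s x θ (a, z))
      ((cgaussianVec m 1).prod (cgaussianVec m 1)) ∧
    ∫ z, noisyChaosNorm h s x θ (a, z) ∂((cgaussianVec m 1).prod (cgaussianVec m 1)) ≤ T := by
  have hm : Measurable fun z => noisyChaosNorm h s x θ (a, z) :=
    (measurable_noisyChaosNorm h s x θ).comp measurable_prodMk_left
  have h0 : ∀ z, 0 ≤ noisyChaosNorm h s x θ (a, z) := fun z => chaosNorm_nonneg _ _ _ _ _
  refine ⟨⟨hm.aestronglyMeasurable, ?_⟩, ?_⟩
  · rw [hasFiniteIntegral_iff_ofReal (Filter.Eventually.of_forall h0)]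
    exact ha.trans ENNReal.ofReal_lt_top
  · rw [integral_eq_lintegral_of_nonneg_ae (Filter.Eventually.of_forall h0)
      hm.aestronglyMeasurable]
    exact ENNReal.toReal_le_of_le_ofReal hT.le ha.le

end Tail

section Parameters

/-- The choice of moment orders for a sufficiently large number of measurements. -/
lemma exists_orders {R : ℝ} (hR : 1 ≤ R) : ∃ C : ℝ, 0 < C ∧ ∀ n m : ℕ, 2 ≤ n → n ≤ m →
    C * n * Real.log n ^ 4 ≤ m → ∃ q q' t : ℕ, q ≠ 0 ∧ q' ≠ 0 ∧ t ≠ 0 ∧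
      2 * (n : ℝ) ≤ Real.exp q ∧ 2 * (m : ℝ) ≤ Real.exp q' ∧
      Real.log n ^ 3 * Real.log m ≤ t ∧ R * (n * ((q : ℝ) * q' + 2 * t + 2)) ≤ m := by
  have hlogR : 0 ≤ Real.log (120 * R) := Real.log_nonneg (by linarith)
  refine ⟨120 * R * (2 * Real.log (120 * R) + 4), by positivity, fun n m hn hnm hm => ?_⟩
  have hn' : (2 : ℝ) ≤ n := by exact_mod_cast hn
  have hnm' : (n : ℝ) ≤ m := by exact_mod_cast hnm
  have hn0 : (0 : ℝ) < n := by linarith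
  have hm0 : (0 : ℝ) < m := by linarith
  have hl2 := Real.log_two_gt_d9
  have hl2' := Real.log_two_lt_d9
  set L := Real.log n with hL
  set M := Real.log m with hM
  have hLl : 0.69 ≤ L := (by linarith : (0.69 : ℝ) ≤ Real.log 2).trans
    (Real.log_le_log (by norm_num) hn')
  have hML : L ≤ M := Real.log_le_log hn0 hnm'
  have key : ∀ k : ℝ, 2 ≤ k → 0.69 ≤ Real.log k →
      ⌈Real.log (2 * k)⌉₊ ≠ 0 ∧ 2 * k ≤ Real.exp ⌈Real.log (2 * k)⌉₊ ∧
      (⌈Real.log (2 * k)⌉₊ : ℝ) ≤ 4 * Real.log k := by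
    intro k hk hlk
    have h1 : Real.log (2 * k) = Real.log 2 + Real.log k :=
      Real.log_mul (by norm_num) (by linarith)
    refine ⟨(Nat.ceil_pos.2 (by rw [h1]; linarith)).ne', ?_, ?_⟩
    · rw [← Real.log_le_iff_le_exp (by linarith)]
      exact Nat.le_ceil _
    · have := Nat.ceil_lt_add_one (a := Real.log (2 * k)) (by rw [h1]; linarith)
      rw [h1] at this ⊢
      linarith
  obtain ⟨a1, a2, a3⟩ := key n hn' hLl
  obtain ⟨b1, b2, b3⟩ := key m (hn'.trans hnm') (hLl.trans hML)
  rw [← hL] at a3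
  rw [← hM] at b3
  have hL0 : 0 < L := by linarith
  have hM0 : 0 < M := by linarith
  have hLM : 0 < L ^ 3 * M := by positivity
  have t1 := Nat.ceil_lt_add_one hLM.le
  refine ⟨_, _, ⌈L ^ 3 * M⌉₊, a1, b1, (Nat.ceil_pos.2 hLM).ne', a2, b2, Nat.le_ceil _, ?_⟩
  set q := ⌈Real.log (2 * n)⌉₊
  set q' := ⌈Real.log (2 * m)⌉₊
  set t := ⌈L ^ 3 * M⌉₊
  have c1 : (q : ℝ) * q' ≤ 16 * (L * M) := by
    calc (q : ℝ) * q' ≤ (4 * L) * (4 * M) := by gcongr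
      _ = _ := by ring
  have c2 : 0.47 * (L * M) ≤ L ^ 3 * M := by
    have : 0.47 ≤ L ^ 2 := by nlinarith
    calc _ ≤ L ^ 2 * (L * M) := by gcongr
      _ = _ := by ring
  have c3 : 0.47 ≤ L * M := by nlinarith
  have c4 : (q : ℝ) * q' + 2 * t + 2 ≤ 60 * (L ^ 3 * M) := by linarith
  set T := 120 * R * n * L ^ 3 with hT
  have hT0 : 0 < T := by positivity
  have d1 : M ≤ Real.log T + m / T - 1 := by
    have := Real.log_le_sub_one_of_pos (div_pos hm0 hT0)
    rw [Real.log_div hm0.ne' hT0.ne'] at this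
    linarith
  have d2 : Real.log T ≤ (2 * Real.log (120 * R) + 4) * L := by
    rw [hT, Real.log_mul (by positivity) (by positivity), Real.log_mul (by positivity) hn0.ne',
      Real.log_pow, ← hL]
    have := Real.log_le_sub_one_of_pos hL0
    push_cast
    nlinarith
  have d3 : T * Real.log T ≤ m := by
    calc T * Real.log T ≤ T * ((2 * Real.log (120 * R) + 4) * L) := by gcongr
      _ = 120 * R * (2 * Real.log (120 * R) + 4) * n * L ^ 4 := by rw [hT]; ring
      _ ≤ m := hm
  calc R * (n * ((q : ℝ) * q' + 2 * t + 2)) ≤ R * (n * (60 * (L ^ 3 * M))) := by gcongr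
    _ = T * M / 2 := by rw [hT]; ring
    _ ≤ T * (Real.log T + m / T - 1) / 2 := by gcongr
    _ = (T * Real.log T + m - T) / 2 := by field_simp
    _ ≤ m := by linarith

end Parameters

section OperatorNorm

open scoped Matrix.Norms.L2Operator

lemma cnorm_le_cnorm_pad {n m : ℕ} (h : n ≤ m) (x : Fin n → ℂ) : cnorm x ≤ cnorm (pad m x) := by
  refine Real.sqrt_le_sqrt ?_
  calc ∑ i, ‖x i‖ ^ 2 = ∑ i ∈ Finset.univ.map (Fin.castLEEmb h), ‖pad m x i‖ ^ 2 := by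
        simp [pad]
    _ ≤ _ := Finset.sum_le_sum_of_subset_of_nonneg (Finset.subset_univ _) fun _ _ _ => by positivity

lemma one_le_opNorm_Cx {n m : ℕ} [NeZero m] (h : n ≤ m) {x : Fin n → ℂ} (hx : cnorm x = 1) :
    1 ≤ opNorm (Cx m x) := by
  have hb : BddAbove {r : ℝ | ∃ v : Fin m → ℂ, cnorm v ≤ 1 ∧ r = cnorm ((Cx m x).mulVec v)} := by
    refine ⟨‖Cx m x‖, ?_⟩
    rintro r ⟨v, hv, rfl⟩
    refine le_of_sq_le_sq ?_ (norm_nonneg _)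
    calc cnorm ((Cx m x).mulVec v) ^ 2 ≤ ‖Cx m x‖ ^ 2 * cnorm v ^ 2 := by
          rw [cnorm_sq, cnorm_sq]; exact sum_norm_sq_mulVec_le _ _
      _ ≤ ‖Cx m x‖ ^ 2 * 1 := by
          gcongr; exact pow_le_one₀ (cnorm_nonneg _) hv
      _ = _ := mul_one _
  have h1 : (Cx m x).mulVec (Pi.single 0 1) = pad m x := by
    ext i
    simp [Cx, circulant_apply]
  refine le_trans ?_ (le_csSup hb ⟨Pi.single 0 1, ?_, rfl⟩)
  · rw [h1, ← hx]; exact cnorm_le_cnorm_pad h x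
  · simp [cnorm, Pi.single_apply, apply_ite]

end OperatorNorm

section ImaginaryPart

open scoped Matrix.Norms.L2Operator

lemma ofReal_le_measure_of_compl_subset {α : Type*} [MeasurableSpace α] {ν : Measure α}
    [IsProbabilityMeasure ν] {S E₁ E₂ E₃ : Set α} {b : ℝ} (hb : 0 ≤ b)
    (h₁ : ν E₁ ≤ ENNReal.ofReal b) (h₂ : ν E₂ ≤ ENNReal.ofReal b) (h₃ : ν E₃ ≤ ENNReal.ofReal b)
    (hS : ∀ a, a ∉ E₁ → a ∉ E₂ → a ∉ E₃ → a ∈ S) : ENNReal.ofReal (1 - 3 * b) ≤ ν S := by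
  have hcov : (Set.univ : Set α) ⊆ S ∪ (E₁ ∪ (E₂ ∪ E₃)) := by
    intro a _
    by_contra h
    simp only [Set.mem_union, not_or] at h
    exact h.1 (hS a h.2.1 h.2.2.1 h.2.2.2)
  have h : 1 ≤ ν S + ENNReal.ofReal (3 * b) := by
    calc 1 = ν Set.univ := measure_univ.symm
      _ ≤ ν S + (ν E₁ + (ν E₂ + ν E₃)) := (measure_mono hcov).trans <|
          (measure_union_le _ _).trans <| add_le_add le_rfl <| (measure_union_le _ _).trans <|
            add_le_add le_rfl (measure_union_le _ _)
      _ ≤ ν S + (ENNReal.ofReal b + (ENNReal.ofReal b + ENNReal.ofReal b)) := by gcongr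
      _ = _ := by
          rw [← ENNReal.ofReal_add hb hb, ← ENNReal.ofReal_add hb (add_nonneg hb hb)]
          ring_nf
  rw [ENNReal.ofReal_sub _ (by positivity), ENNReal.ofReal_one]
  exact tsub_le_iff_right.2 h

set_option maxHeartbeats 1000000 in
lemma exists_measure_sum_loss_ge {s κ : ℝ} (hs : 1 / 2 < s) (hκ : 0 < κ) :
    ∃ C : ℝ, 0 < C ∧ ∀ (n m : ℕ) (h : n ≤ m) (x : Fin n → ℂ), cnorm x = 1 → 2 ≤ n →
      C * n * Real.log n ^ 4 ≤ m →
      ENNReal.ofReal (1 - 3 * (m : ℝ) ^ (-(Real.log n ^ 3))) ≤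
      cgaussianVec m 1 {a | ∀ w : Fin n → ℂ, dotc x w = 0 → (2 * s + 1) / m *
        ∑ k, loss s ((Amat h a *ᵥ x) k) ((Amat h a *ᵥ w) k) ≤ (1 + κ) / 2 * cnorm w ^ 2} := by
  have hs0 : 0 < s := by linarith
  set c := 2 * s + 1 with hc
  have hc0 : 0 < c := by linarith
  set B := 10 * Real.exp 3 ^ 2 with hB
  have hB0 : 0 < B := by positivity
  set C₁ := (Real.exp 1 * B) ^ 2 with hC₁
  have hC₁0 : 0 < C₁ := by positivity
  set r := κ / (8 * c * (1 / 2 + 5 * C₁)) with hr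
  have hr0 : 0 < r := by positivity
  set θ := Real.arctan r with hθ
  have hcos : 0 < Real.cos θ := Real.cos_arctan_pos r
  have htan : Real.tan θ = r := Real.tan_arctan r
  have hsin : 0 < Real.sin θ := by
    rw [← Real.tan_mul_cos hcos.ne', htan]; positivity
  set η := κ / (4 * c) with hη
  have hη0 : 0 < η := by positivity
  set η' := κ * Real.sin θ ^ 2 / (8 * c) with hη'
  have hη'0 : 0 < η' := by positivity
  set K := Real.exp 1 * (4 * (87 * Real.exp 3 ^ 3)) with hK
  have hK0 : 0 < K := by positivity
  obtain ⟨C, hC, hCm⟩ := exists_orders (R := 1 + 8 / η ^ 2 + (K / η') ^ 2)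
    (by linarith [show 0 ≤ 8 / η ^ 2 by positivity, sq_nonneg (K / η')])
  refine ⟨C, hC, fun n m h x hx hn hm => ?_⟩
  have : NeZero n := ⟨by omega⟩
  have : NeZero m := ⟨by omega⟩
  obtain ⟨q, q', t, hq0, hq0', ht0, hq, hq', ht, hR⟩ := hCm n m hn h hm
  have hm0 : (0 : ℝ) < m := by exact_mod_cast NeZero.pos m
  have hsm : 0 < √(m : ℝ) := Real.sqrt_pos.2 hm0
  set Y := (n : ℝ) * ((q : ℝ) * q' + 2 * t + 2) with hY
  have hY0 : 0 ≤ Y := by positivity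
  have hR' : Y + 8 / η ^ 2 * Y + (K / η') ^ 2 * Y ≤ m := by
    refine le_trans (le_of_eq ?_) hR
    ring
  have hY1 : 0 ≤ 8 / η ^ 2 * Y := by positivity
  have hY2 : 0 ≤ (K / η') ^ 2 * Y := by positivity
  have r1 : Y ≤ m := by linarith
  have r2 : 8 / η ^ 2 * Y ≤ m := by linarith
  have r3 : (K / η') ^ 2 * Y ≤ m := by linarith
  have hle : ∀ v : ℝ, v ≤ (q : ℝ) * q' + 2 * t + 2 → (n : ℝ) * v ≤ Y := fun v hv =>
    mul_le_mul_of_nonneg_left hv (Nat.cast_nonneg n)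
  have ht0' : (0 : ℝ) ≤ t := Nat.cast_nonneg t
  have hqq0 : (0 : ℝ) ≤ (q : ℝ) * q' := by positivity
  have y1 := hle 2 (by linarith)
  have y2 := hle (q * q') (by linarith)
  have y3 := hle (2 * t) (by linarith)
  have y4 := hle (q * q' + t) (by linarith)
  have hnm : 2 * n ≤ m := by exact_mod_cast (by linarith : (2 : ℝ) * n ≤ m)
  have hqq : (n : ℝ) * q * q' ≤ m := by rw [mul_assoc]; linarith
  have htn : 2 * t * n ≤ m := by exact_mod_cast (by linarith : (2 : ℝ) * t * n ≤ m)
  have hb : Real.exp (-(2 * t : ℕ)) ≤ (m : ℝ) ^ (-(Real.log n ^ 3)) := by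
    rw [Real.rpow_def_of_pos hm0]
    refine Real.exp_le_exp.2 ?_
    push_cast
    nlinarith [show 0 ≤ (t : ℝ) by positivity]
  refine le_trans (ENNReal.ofReal_le_ofReal (by linarith)) (ofReal_le_measure_of_compl_subset
    (Real.exp_pos _).le
    (measure_sum_zeta_ge_le h hx hs hη0 (p := (2 * t : ℕ)) ?_)
    (measure_ofReal_le_of_lintegral_pow_le
      (f := fun a => ENNReal.ofReal ‖Amat h a‖) (T := Real.exp 1 * (B * √m))
      (continuous_Amat h).norm.measurable.ennreal_ofReal (by positivity) le_rfl
      (lintegral_norm_Amat_pow_le h hnm hq0 hq hq0' hq' hqq (2 * t) htn))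
    (measure_lintegral_noisyChaosNorm_ge_le h hnm hq0 hq hq0' hq' hqq ht0 htn hs0 x θ
      (T := η' * m) (by positivity) ?_) ?_)
  · rw [div_mul_eq_mul_div, div_le_iff₀ (by positivity)] at r2
    push_cast
    linarith
  · have h1 : √((m : ℝ) * (n * (q * q' + t))) ≤ η' / K * m := by
      refine Real.sqrt_le_iff.2 ⟨by positivity, ?_⟩
      have h2 : Y ≤ (η' / K) ^ 2 * m := by
        rw [div_pow, div_mul_eq_mul_div, div_le_iff₀ (by positivity)] at r3
        rw [div_pow, div_mul_eq_mul_div, le_div_iff₀ (by positivity)]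
        linarith
      calc (m : ℝ) * (n * (q * q' + t)) ≤ m * ((η' / K) ^ 2 * m) :=
            mul_le_mul_of_nonneg_left (y4.trans h2) hm0.le
        _ = _ := by ring
    calc Real.exp 1 * chaosScale m n q q' t = K * √((m : ℝ) * (n * (q * q' + t))) := by
          rw [chaosScale, hK]; ring
      _ ≤ K * (η' / K * m) := by gcongr
      _ = _ := by field_simp
  · intro a h1 h2 h3 w hw
    simp only [Set.mem_ofPred_eq, not_le] at h1 h2 h3
    have h2' := ENNReal.lt_ofReal_iff_toReal_lt (ENNReal.ofReal_ne_top) |>.1 h2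
    rw [ENNReal.toReal_ofReal (norm_nonneg _)] at h2'
    obtain ⟨i1, i2⟩ := integrable_noisyChaosNorm h s x θ (by positivity : 0 < η' * m) h3
    have hA : ‖Amat h a‖ ^ 2 ≤ C₁ * m := by
      calc ‖Amat h a‖ ^ 2 ≤ (Real.exp 1 * (B * √m)) ^ 2 := by gcongr
        _ = C₁ * √(m : ℝ) ^ 2 := by rw [hC₁]; ring
        _ = _ := by rw [Real.sq_sqrt hm0.le]
    have hd := sum_loss_le h hs hx hw hcos hsin a i1
    rw [htan] at hd
    calc c / m * ∑ k, loss s ((Amat h a *ᵥ x) k) ((Amat h a *ᵥ w) k)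
        ≤ c / m * (((m / c + η * m + r * m) / 2 + 5 * r * (C₁ * m) + η' * m / Real.sin θ ^ 2) *
          cnorm w ^ 2) := by
          refine mul_le_mul_of_nonneg_left (hd.trans ?_) (by positivity)
          gcongr
      _ = (1 / 2 + c * η / 2 + c * r * (1 / 2 + 5 * C₁) + c * η' / Real.sin θ ^ 2) *
          cnorm w ^ 2 := by field_simp; ring
      _ = (1 / 2 + 3 * κ / 8) * cnorm w ^ 2 := by
          rw [hη, hr, hη']; field_simp; ring
      _ ≤ _ := by gcongr; linarith

lemma rnorm_sq_eq_sum_loss {n m : ℕ} (h : n ≤ m) {s : ℝ} (hs : 0 < s) (x w : Fin n → ℂ)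
    (a : Fin m → ℂ) : rnorm (fun k => √((2 * s + 1) / (m : ℝ)) *
      √(zeta s ((yvec h x a k : ℝ) : ℂ)) *
        ((Amat h a).mulVec w k * starRingEnd ℂ (phase ((Amat h a).mulVec x k))).im) ^ 2 =
    (2 * s + 1) / m * ∑ k, loss s ((Amat h a *ᵥ x) k) ((Amat h a *ᵥ w) k) := by
  rw [rnorm, Real.sq_sqrt (Finset.sum_nonneg fun _ _ => sq_nonneg _), Finset.mul_sum]
  refine Finset.sum_congr rfl fun k _ => ?_
  have e : zeta s ((yvec h x a k : ℝ) : ℂ) = zeta s ((Amat h a *ᵥ x) k) := by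
    simp [zeta, yvec]
  rw [mul_pow, mul_pow, Real.sq_sqrt (by positivity), Real.sq_sqrt (zeta_nonneg hs _), e, loss]
  ring

end ImaginaryPart

/-- Lemma 5.4.
Fix `σ² > 1/2`.  Whenever `m ≥ C ‖C_x‖² δ⁻² n (log n)⁴`, with probability at least
`1 − c m^{−c′ (log n)³}`, for all `w ⊥ x`,
`‖ sqrt((2σ²+1)/m) diag(ζ_{σ²}(y)^{1/2}) Im((A w) ∘ e^{−iφ(A x)}) ‖²
  ≤ ((1 + (2+ε)δ + (1+δ)Δ_∞(ε))/2) ‖w‖²`. -/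
theorem imaginary_part_bound :
    ∀ σ2 : ℝ, 1 / 2 < σ2 →
      ∃ C c c' : ℝ, 0 < C ∧ 0 < c ∧ 0 < c' ∧
        ∀ (δ ε : ℝ), δ ∈ Set.Ioo (0 : ℝ) 1 → ε ∈ Set.Ioo (0 : ℝ) 1 →
        ∀ (n m : ℕ) (h : n ≤ m) (x : Fin n → ℂ), cnorm x = 1 →
          C * opNorm (Cx m x) ^ 2 * (δ ^ 2)⁻¹ * (n : ℝ) * Real.log n ^ 4 ≤ (m : ℝ) →
          cgaussianVec m 1 {a | ∀ w : Fin n → ℂ, dotc x w = 0 →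
              rnorm (fun k =>
                  Real.sqrt ((2 * σ2 + 1) / (m : ℝ)) *
                    Real.sqrt (zeta σ2 ((yvec h x a k : ℝ) : ℂ)) *
                    ((Amat h a).mulVec w k *
                        starRingEnd ℂ (phase ((Amat h a).mulVec x k))).im) ^ 2 ≤
                (1 + (2 + ε) * δ + (1 + δ) * DeltaInf σ2 ε) / 2 * cnorm w ^ 2} ≥
            ENNReal.ofReal (1 - c * (m : ℝ) ^ (-(c' * Real.log n ^ 3))) := by
  intro σ2 hσ
  have hσ0 : 0 < σ2 := by linarith
  obtain ⟨κ, hκ0, -, hκ⟩ := exists_le_DeltaInf hσ0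
  obtain ⟨C, hC, hCm⟩ := exists_measure_sum_loss_ge hσ hκ0
  refine ⟨C, 3, 1, hC, by norm_num, one_pos, ?_⟩
  rintro δ ε ⟨hδ0, hδ1⟩ hε n m h x hx hm
  have hn0 : n ≠ 0 := by
    rintro rfl
    simp [cnorm] at hx
  rw [one_mul, ge_iff_le]
  rcases Nat.lt_or_ge n 2 with hn | hn
  · obtain rfl : n = 1 := by omega
    rw [ENNReal.ofReal_of_nonpos (by norm_num)]
    exact zero_le
  have : NeZero m := ⟨by omega⟩
  have hone : 1 ≤ opNorm (Cx m x) ^ 2 * (δ ^ 2)⁻¹ :=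
    one_le_mul_of_one_le_of_one_le (one_le_pow₀ (one_le_opNorm_Cx h hx))
      ((one_le_inv₀ (by positivity)).2 (pow_le_one₀ hδ0.le hδ1.le))
  have hm' : C * n * Real.log n ^ 4 ≤ m := by
    refine le_trans ?_ hm
    calc C * n * Real.log n ^ 4 = 1 * (C * n * Real.log n ^ 4) := (one_mul _).symm
      _ ≤ (opNorm (Cx m x) ^ 2 * (δ ^ 2)⁻¹) * (C * n * Real.log n ^ 4) := by gcongr
      _ = _ := by ring
  refine (hCm n m h x hx hn hm').trans (measure_mono fun a ha w hw => ?_)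
  rw [rnorm_sq_eq_sum_loss h hσ0]
  refine (ha w hw).trans ?_
  have hΔ := hκ ε hε
  have : 0 ≤ (2 + ε) * δ := mul_nonneg (by linarith [hε.1]) hδ0.le
  have : 0 ≤ δ * DeltaInf σ2 ε := mul_nonneg hδ0.le (hκ0.le.trans hΔ)
  refine mul_le_mul_of_nonneg_right ?_ (by positivity)
  linarith

end ConvPR

end
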